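/- Let N ≥ 1, 0 < R < ∞, and let f be a (0,1)-form of class C¹ on the ball B_N(R) ⊆ ℂ^N (with the l¹ norm) which is ∂̄-closed and satisfies |f|₀ < ∞. Then there exists a continuously (real Fréchet) differentiable function u : B_N(R) → ℂ with ∂̄u = f and, for every z ∈ B_N(R), |u(z)| ≤ 2(R + 2R√N) · (R/(R − ‖z‖))^N · |f|₀. -/

import Mathlib

open Set
open scoped ENNReal NNReal

noncomputable section

/-- `l¹`: the space of absolutely summable sequences of complex numbers. -/
abbrev L1 : Type := lp (fun _ : ℕ => ℂ) 1

/-- `ℂ^N` equipped with the `l¹` norm. -/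
abbrev EN (N : ℕ) : Type := PiLp 1 (fun _ : Fin N => ℂ)

/-- The `(0,1)`-part of the real Fréchet derivative of `u` at `z`, applied to `ξ`:
`∂̄u(z)(ξ) = (Du(z)(ξ) + i·Du(z)(iξ))/2`. -/
noncomputable def dbar {V : Type*} [NormedAddCommGroup V] [NormedSpace ℂ V]
    (u : V → ℂ) (z ξ : V) : ℂ :=
  (fderiv ℝ u z ξ + Complex.I * fderiv ℝ u z (Complex.I • ξ)) / 2

/-- `f` is a `(0,1)`-form of class `C^m` on `Ω`: each `f z` is (continuous) conjugate-linear
and `(z,ξ) ↦ f z ξ` is `m` times continuously differentiable in the real sense on `Ω × V`. -/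
def IsForm01 {V : Type*} [NormedAddCommGroup V] [NormedSpace ℂ V]
    (m : ℕ) (Ω : Set V) (f : V → V → ℂ) : Prop :=
  (∀ z ∈ Ω, ∀ ξ η : V, f z (ξ + η) = f z ξ + f z η) ∧
  (∀ z ∈ Ω, ∀ (a : ℂ) (ξ : V), f z (a • ξ) = (starRingEnd ℂ) a * f z ξ) ∧
  ContDiffOn ℝ m (fun p : V × V => f p.1 p.2) (Ω ×ˢ (univ : Set V))

/-- A `(0,1)`-form `f` is `∂̄`-closed on `Ω`. -/
def DbarClosed {V : Type*} [NormedAddCommGroup V] [NormedSpace ℂ V]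
    (Ω : Set V) (f : V → V → ℂ) : Prop :=
  ∀ z ∈ Ω, ∀ ξ η : V, dbar (fun w => f w ξ) z η = dbar (fun w => f w η) z ξ

/-- The set of values `‖f z ξ‖`, `z ∈ A`, `‖ξ‖ ≤ 1`; its sup is `|f|_{0,A}`. -/
def formSet0 {V : Type*} [NormedAddCommGroup V]
    (f : V → V → ℂ) (A : Set V) : Set ℝ :=
  {x | ∃ z ∈ A, ∃ ξ : V, ‖ξ‖ ≤ 1 ∧ x = ‖f z ξ‖}

/-- The set of difference quotients `‖f z ξ - f w ξ‖/‖z-w‖`; its sup is `|f|_{1,A}`. -/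
def formSet1 {V : Type*} [NormedAddCommGroup V]
    (f : V → V → ℂ) (A : Set V) : Set ℝ :=
  {x | ∃ z ∈ A, ∃ w ∈ A, z ≠ w ∧ ∃ ξ : V, ‖ξ‖ ≤ 1 ∧ x = ‖f z ξ - f w ξ‖ / ‖z - w‖}

/-- `|f|_{0,A}`. -/
noncomputable def formNorm0 {V : Type*} [NormedAddCommGroup V]
    (f : V → V → ℂ) (A : Set V) : ℝ := sSup (formSet0 f A)

/-- `|f|_{1,A}`. -/
noncomputable def formNorm1 {V : Type*} [NormedAddCommGroup V]
    (f : V → V → ℂ) (A : Set V) : ℝ := sSup (formSet1 f A)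

/-- `f` is Lipschitz continuous on `A`: `|f|_{0,A} < ∞` and `|f|_{1,A} < ∞`. -/
def LipschitzForm {V : Type*} [NormedAddCommGroup V]
    (f : V → V → ℂ) (A : Set V) : Prop :=
  BddAbove (formSet0 f A) ∧ BddAbove (formSet1 f A)

/-- `‖k‖ = ∑_ν k_ν` for a multiindex `k`. -/
def knormN (k : ℕ →₀ ℕ) : ℕ := k.sum fun _ m => m

/-- `k^k = ∏_ν k_ν^{k_ν}` (with `0^0 = 1`). -/
noncomputable def kk (k : ℕ →₀ ℕ) : ℝ := ∏ ν ∈ k.support, (k ν : ℝ) ^ k ν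

/-- `‖k‖^{‖k‖}` (with `0^0 = 1`). -/
noncomputable def nn (k : ℕ →₀ ℕ) : ℝ := ((knormN k : ℝ)) ^ knormN k

/-- The monomial `z^k = ∏_ν z_ν^{k_ν}` (with `0^0 = 1`). -/
noncomputable def monom (k : ℕ →₀ ℕ) (z : ℕ → ℂ) : ℂ := ∏ ν ∈ k.support, z ν ^ k ν

/-- The term of the series defining `Δ(q,z)` corresponding to the multiindex `k`:
`(‖k‖^{‖k‖}/k^k)·|q|^{#k}·|z^k|`. -/
noncomputable def DeltaTerm (q : ℂ) (z : ℕ → ℂ) (k : ℕ →₀ ℕ) : ℝ :=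
  (nn k / kk k) * ‖q‖ ^ k.support.card * ∏ ν ∈ k.support, ‖z ν‖ ^ k ν

/-- `Δ(q,z) = ∑_k (‖k‖^{‖k‖}/k^k)·|q|^{#k}·|z^k|`. -/
noncomputable def Delta (q : ℂ) (z : ℕ → ℂ) : ℝ := ∑' k, DeltaTerm q z k

open MeasureTheory

lemma lintegral_CS {α : Type*} [MeasurableSpace α] (μ : Measure α) (f : α → ℝ≥0∞)
    (hf : AEMeasurable f μ) : (∫⁻ a, f a ∂μ) ^ 2 ≤ μ univ * ∫⁻ a, f a ^ 2 ∂μ := by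
  have h := ENNReal.lintegral_mul_le_Lp_mul_Lq μ (p := 2) (q := 2) (Real.HolderConjugate.two_two) hf (g := fun _ => 1) aemeasurable_const
  simp only [Pi.mul_apply, mul_one, ENNReal.one_rpow, lintegral_const, one_mul] at h
  calc (∫⁻ a, f a ∂μ) ^ 2 ≤ ((∫⁻ a, f a ^ (2:ℝ) ∂μ) ^ (1 / (2:ℝ)) * (μ univ) ^ (1 / (2:ℝ)))^2 := by
        gcongr
    _ = _ := by
        rw [mul_pow, ← ENNReal.rpow_natCast, ← ENNReal.rpow_natCast, ← ENNReal.rpow_mul, ← ENNReal.rpow_mul]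
        norm_num
        rw [mul_comm]

lemma oneD_base (p q : ℕ) (hp : 1 ≤ p) : ∃ b ∈ Ioo (0:ℝ) 1, ∀ y ∈ Ioo (0:ℝ) 1, ∀ s ∈ uIcc b y,
    y^p*(1-y)^q ≤ (3/2) * (s^p*(1-s)^q) := by
  have hp' : (0:ℝ) < p := by exact_mod_cast hp
  rcases Nat.eq_zero_or_pos q with rfl | hq
  · refine ⟨1 - 1/(3*p), ⟨?_, ?_⟩, ?_⟩
    · have : (1:ℝ) ≤ p := by exact_mod_cast hp
      have : 1/(3*(p:ℝ)) ≤ 1/3 := by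
        apply one_div_le_one_div_of_le <;> linarith
      linarith
    · have : 0 < 1/(3*(p:ℝ)) := by positivity
      linarith
    · intro y hy s hs
      simp only [pow_zero, mul_one]
      have hb : (2/3:ℝ) ≤ (1 - 1/(3*p))^p := by
        have := one_add_mul_le_pow (a := -(1/(3*(p:ℝ)))) (by
          have : (1:ℝ) ≤ p := by exact_mod_cast hp
          have : 1/(3*(p:ℝ)) ≤ 1/3 := by
            apply one_div_le_one_div_of_le <;> linarith
          linarith) p
        have e : 1 + (p:ℝ) * -(1/(3*p)) = 2/3 := by field_simp; norm_num
        rw [e] at this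
        simpa [sub_eq_add_neg] using this
      have hb0 : (0:ℝ) ≤ 1 - 1/(3*p) := by
        have : (1:ℝ) ≤ p := by exact_mod_cast hp
        have : 1/(3*(p:ℝ)) ≤ 1/3 := by
            apply one_div_le_one_div_of_le <;> linarith
        linarith
      rcases le_or_gt y s with h | h
      · have : y^p ≤ s^p := pow_le_pow_left₀ hy.1.le h p
        have : 0 ≤ y^p := pow_nonneg hy.1.le p
        linarith
      · have hbs : 1 - 1/(3*(p:ℝ)) ≤ s := by
          rcases mem_uIcc.1 hs with h' | h'
          · exact h'.1
          · exact absurd h (not_lt.2 h'.1)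
        have h1 : (1 - 1/(3*(p:ℝ)))^p ≤ s^p := pow_le_pow_left₀ hb0 hbs p
        have : y^p ≤ 1 := pow_le_one₀ hy.1.le hy.2.le
        linarith
  · have hq' : (0:ℝ) < q := by exact_mod_cast hq
    have hpq : (0:ℝ) < p + q := by positivity
    have hb0 : 0 < (p:ℝ)/(p+q) := by positivity
    have hb1 : (p:ℝ)/(p+q) < 1 := by rw [div_lt_one hpq]; linarith
    refine ⟨p/(p+q), ⟨hb0, hb1⟩, ?_⟩
    intro y hy s hs
    have hs01 : s ∈ Ioo (0:ℝ) 1 := by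
      have : uIcc ((p:ℝ)/(p+q)) y ⊆ Ioo 0 1 := (ordConnected_Ioo).uIcc_subset ⟨hb0, hb1⟩ hy
      exact this hs
    have hs0 := hs01.1
    have hs1 : 0 < 1 - s := by linarith [hs01.2]
    have hw : 0 < s^p*(1-s)^q := by positivity
    have key : (y/s)^p * ((1-y)/(1-s))^q ≤ 1 := by
      calc (y/s)^p * ((1-y)/(1-s))^q ≤ (Real.exp (y/s-1))^p * (Real.exp ((1-y)/(1-s)-1))^q := by
            have h1 := Real.add_one_le_exp (y/s-1)
            have h2 := Real.add_one_le_exp ((1-y)/(1-s)-1)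
            have : 0 ≤ y/s := div_nonneg hy.1.le hs0.le
            have : 0 ≤ (1-y)/(1-s) := div_nonneg (by linarith [hy.2]) hs1.le
            gcongr <;> linarith
        _ = Real.exp (p*(y/s-1) + q*((1-y)/(1-s)-1)) := by
            rw [← Real.exp_nat_mul, ← Real.exp_nat_mul, Real.exp_add]
        _ ≤ 1 := by
            rw [Real.exp_le_one_iff]
            have e : p*(y/s-1) + q*((1-y)/(1-s)-1) = (y-s)*(p - (p+q)*s)/(s*(1-s)) := by
              field_simp; ring
            rw [e]
            apply div_nonpos_of_nonpos_of_nonneg _ (by positivity)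
            rcases mem_uIcc.1 hs with h | h
            · have := h.1
              rw [div_le_iff₀ hpq] at this
              nlinarith [h.2]
            · have := h.2
              rw [le_div_iff₀ hpq] at this
              nlinarith [h.1]
    rw [div_pow, div_pow, div_mul_div_comm, div_le_one hw] at key
    have : 0 ≤ s^p*(1-s)^q := hw.le
    linarith

lemma oneD_int (p q : ℕ) (b : ℝ) (hb : b ∈ Ioo (0:ℝ) 1)
    (hbw : ∀ y ∈ Ioo (0:ℝ) 1, ∀ s ∈ uIcc b y, y^p*(1-y)^q ≤ (3/2) * (s^p*(1-s)^q))
    (g g' : ℝ → ℂ) (hg : ∀ y ∈ Ioo (0:ℝ) 1, HasDerivAt g (g' y) y)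
    (hg' : ContinuousOn g' (Ioo 0 1)) :
    ∫⁻ y in Ioo (0:ℝ) 1, ‖g y - g b‖ₑ^2 * ENNReal.ofReal (y^p*(1-y)^q) ≤
      ENNReal.ofReal (3/4) * ∫⁻ y in Ioo (0:ℝ) 1, ‖g' y‖ₑ^2 * ENNReal.ofReal (y^p*(1-y)^q) := by
  set I := ∫⁻ y in Ioo (0:ℝ) 1, ‖g' y‖ₑ^2 * ENNReal.ofReal (y^p*(1-y)^q) with hI
  have key : ∀ y ∈ Ioo (0:ℝ) 1, ‖g y - g b‖ₑ^2 * ENNReal.ofReal (y^p*(1-y)^q) ≤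
      ENNReal.ofReal |y-b| * (ENNReal.ofReal (3/2) * I) := by
    intro y hy
    have hsub : uIcc b y ⊆ Ioo 0 1 := (ordConnected_Ioo).uIcc_subset hb hy
    have hsub' : uIoc b y ⊆ uIcc b y := uIoc_subset_uIcc
    have hcont : ContinuousOn g' (uIcc b y) := hg'.mono hsub
    have hFTC : ∫ s in b..y, g' s = g y - g b :=
      intervalIntegral.integral_eq_sub_of_hasDerivAt (fun s hs => hg s (hsub hs)) hcont.intervalIntegrable
    have h1 : ‖g y - g b‖ₑ ≤ ∫⁻ s in uIoc b y, ‖g' s‖ₑ := by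
      rw [← hFTC, ← ofReal_norm, intervalIntegral.norm_intervalIntegral_eq, ofReal_norm]
      exact enorm_integral_le_lintegral_enorm _
    have hm : AEMeasurable (fun s => ‖g' s‖ₑ) (volume.restrict (uIoc b y)) :=
      ((hcont.mono hsub').aestronglyMeasurable measurableSet_uIoc).enorm
    have hv : volume (uIoc b y) = ENNReal.ofReal |y - b| := by
      rw [uIoc, Real.volume_Ioc]; congr 1; exact max_sub_min_eq_abs b y
    calc ‖g y - g b‖ₑ^2 * ENNReal.ofReal (y^p*(1-y)^q)
        ≤ (∫⁻ s in uIoc b y, ‖g' s‖ₑ)^2 * ENNReal.ofReal (y^p*(1-y)^q) := by gcongr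
      _ ≤ (ENNReal.ofReal |y-b| * ∫⁻ s in uIoc b y, ‖g' s‖ₑ^2) * ENNReal.ofReal (y^p*(1-y)^q) := by
          gcongr
          refine (lintegral_CS _ _ hm).trans ?_
          rw [Measure.restrict_apply_univ, hv]
      _ = ENNReal.ofReal |y-b| * ∫⁻ s in uIoc b y, ‖g' s‖ₑ^2 * ENNReal.ofReal (y^p*(1-y)^q) := by
          rw [mul_assoc, lintegral_mul_const'' _ (hm.pow_const 2)]
      _ ≤ ENNReal.ofReal |y-b| * ∫⁻ s in uIoc b y, ENNReal.ofReal (3/2) * (‖g' s‖ₑ^2 * ENNReal.ofReal (s^p*(1-s)^q)) := by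
          gcongr ENNReal.ofReal |y-b| * ?_
          apply setLIntegral_mono' measurableSet_uIoc
          intro s hs
          have := hbw y hy s (hsub' hs)
          rw [mul_left_comm, ← ENNReal.ofReal_mul (by norm_num)]
          gcongr
      _ = ENNReal.ofReal |y-b| * (ENNReal.ofReal (3/2) * ∫⁻ s in uIoc b y, (‖g' s‖ₑ^2 * ENNReal.ofReal (s^p*(1-s)^q))) := by
          rw [lintegral_const_mul' _ _ (by simp)]
      _ ≤ _ := by
          gcongr
          exact lintegral_mono_set (hsub'.trans hsub)
  calc _ ≤ ∫⁻ y in Ioo (0:ℝ) 1, ENNReal.ofReal |y-b| * (ENNReal.ofReal (3/2) * I) :=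
        setLIntegral_mono' measurableSet_Ioo key
    _ = (∫⁻ y in Ioo (0:ℝ) 1, ENNReal.ofReal |y-b|) * (ENNReal.ofReal (3/2) * I) := by
        rw [lintegral_mul_const]; fun_prop
    _ ≤ ENNReal.ofReal (1/2) * (ENNReal.ofReal (3/2) * I) := by
        gcongr
        have hint : ∀ c d : ℝ, IntervalIntegrable (fun y => |y-b|) volume c d := fun c d =>
          (by fun_prop : Continuous fun y : ℝ => |y-b|).intervalIntegrable c d
        rw [← ofReal_integral_eq_lintegral_ofReal]
        · apply ENNReal.ofReal_le_ofReal
          rw [← integral_Ioc_eq_integral_Ioo, ← intervalIntegral.integral_of_le zero_le_one,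
            ← intervalIntegral.integral_add_adjacent_intervals (hint 0 b) (hint b 1)]
          have e1 : ∫ y in (0:ℝ)..b, |y-b| = ∫ y in (0:ℝ)..b, (b-y) := by
            apply intervalIntegral.integral_congr
            intro y hy
            rw [uIcc_of_le hb.1.le] at hy
            simp only
            rw [abs_sub_comm, abs_of_nonneg]; linarith [hy.2]
          have e2 : ∫ y in b..1, |y-b| = ∫ y in b..1, (y-b) := by
            apply intervalIntegral.integral_congr
            intro y hy
            rw [uIcc_of_le hb.2.le] at hy
            simp only
            rw [abs_of_nonneg]; linarith [hy.1]
          rw [e1, e2, intervalIntegral.integral_sub (by simp) (by simp)]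
          simp
          nlinarith [hb.1, hb.2]
        · exact ((hint 0 1).1).mono_set Ioo_subset_Ioc_self
        · exact Filter.Eventually.of_forall (fun y => abs_nonneg _)
    _ = _ := by
        rw [← mul_assoc, ← ENNReal.ofReal_mul (by norm_num)]; norm_num

/-- open simplex -/
def Simp (N : ℕ) : Set (Fin N → ℝ) := {r | (∀ j, 0 < r j) ∧ ∑ j, r j < 1}

def Wt {N : ℕ} (k : Fin N → ℕ) (r : Fin N → ℝ) : ℝ := ∏ j, r j ^ (2 * k j + 1)

def Vf : (N : ℕ) → Fin N → (Fin N → ℝ) → (Fin N → ℝ)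
  | 0, j, _ => Fin.elim0 j
  | N+1, j, r => Fin.cases (motive := fun _ => Fin (N+1) → ℝ)
      (Fin.cons 1 (-((1 - r 0)⁻¹ • Fin.tail r)))
      (fun i => Fin.cons 0 ((1 - r 0) • Vf N i ((1 - r 0)⁻¹ • Fin.tail r))) j

lemma isOpen_Simp (N : ℕ) : IsOpen (Simp N) := by
  have : Simp N = (⋂ j, {r | 0 < r j}) ∩ {r | ∑ j, r j < 1} := by
    ext r; simp [Simp]
  rw [this]
  refine IsOpen.inter (isOpen_iInter_of_finite fun j => ?_) ?_
  · exact isOpen_lt continuous_const (continuous_apply j)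
  · exact isOpen_lt (by fun_prop) continuous_const

lemma convex_Simp (N : ℕ) : Convex ℝ (Simp N) := by
  intro x hx y hy a b ha hb hab
  refine ⟨fun j => ?_, ?_⟩
  · have h1 := hx.1 j
    have h2 := hy.1 j
    simp only [Pi.add_apply, Pi.smul_apply, smul_eq_mul]
    rcases ha.eq_or_lt with h | h
    · subst h
      have : b = 1 := by linarith
      subst this; simpa using h2
    · have := mul_pos h h1
      have := mul_nonneg hb h2.le
      linarith
  · simp only [Pi.add_apply, Pi.smul_apply, smul_eq_mul, Finset.sum_add_distrib, ← Finset.mul_sum]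
    rcases ha.eq_or_lt with h | h
    · subst h
      have : b = 1 := by linarith
      subst this; simpa using hy.2
    · have := mul_lt_mul_of_pos_left hx.2 h
      have := mul_le_mul_of_nonneg_left hy.2.le hb
      linarith

lemma measurable_Vf (N : ℕ) (j : Fin N) : Measurable (Vf N j) := by
  induction N with
  | zero => exact Fin.elim0 j
  | succ N ih =>
    have ht : Measurable (fun r : Fin (N+1) → ℝ => (1 - r 0)⁻¹ • Fin.tail r) := by
      have h1 : Measurable (fun r : Fin (N+1) → ℝ => (1 - r 0)⁻¹) := by fun_prop
      exact h1.smul (measurable_pi_iff.2 fun i => measurable_pi_apply _)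
    refine Fin.cases ?_ (fun i => ?_) j
    · refine measurable_pi_iff.2 fun l => ?_
      refine Fin.cases ?_ (fun l => ?_) l
      · simp only [Vf, Fin.cases_zero, Fin.cons_zero]; exact measurable_const
      · simp only [Vf, Fin.cases_zero, Fin.cons_succ]
        exact ((measurable_pi_apply l).comp ht).neg
    · refine measurable_pi_iff.2 fun l => ?_
      refine Fin.cases ?_ (fun l => ?_) l
      · simp only [Vf, Fin.cases_succ, Fin.cons_zero]; exact measurable_const
      · simp only [Vf, Fin.cases_succ, Fin.cons_succ]
        have h1 : Measurable (fun r : Fin (N+1) → ℝ => (1 - r 0)) := by fun_prop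
        exact h1.mul ((measurable_pi_apply l).comp ((ih i).comp ht))

lemma cons_mem_Simp {N : ℕ} {y : ℝ} (hy : y < 1) (w : Fin N → ℝ) :
    (Fin.cons y ((1-y) • w) : Fin (N+1) → ℝ) ∈ Simp (N+1) ↔ 0 < y ∧ w ∈ Simp N := by
  have h1 : 0 < 1 - y := by linarith
  simp only [Simp, mem_ofPred_eq, Fin.forall_fin_succ, Fin.cons_zero, Fin.cons_succ, Pi.smul_apply,
    smul_eq_mul, Fin.sum_univ_succ, ← Finset.mul_sum, mul_pos_iff_of_pos_left h1, and_assoc]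
  have : y + (1-y) * ∑ i, w i < 1 ↔ ∑ i, w i < 1 := by
    constructor
    · intro h
      have : (1-y) * ∑ i, w i < (1-y) * 1 := by linarith
      exact lt_of_mul_lt_mul_left this h1.le
    · intro h
      have : (1-y) * ∑ i, w i < (1-y) * 1 := mul_lt_mul_of_pos_left h h1
      linarith
  rw [this]

lemma Vf_cons_zero {N : ℕ} {y : ℝ} (hy : y < 1) (w : Fin N → ℝ) :
    Vf (N+1) 0 (Fin.cons y ((1-y) • w)) = Fin.cons 1 (-w) := by
  have h1 : 1 - y ≠ 0 := by linarith
  simp [Vf, Fin.tail_cons, smul_smul, h1]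

lemma Vf_cons_succ {N : ℕ} {y : ℝ} (hy : y < 1) (w : Fin N → ℝ) (j : Fin N) :
    Vf (N+1) j.succ (Fin.cons y ((1-y) • w)) = Fin.cons 0 ((1-y) • Vf N j w) := by
  have h1 : 1 - y ≠ 0 := by linarith
  simp [Vf, Fin.tail_cons, smul_smul, h1]

lemma Simp_cons_exists {N : ℕ} {r : Fin (N+1) → ℝ} (hr : r ∈ Simp (N+1)) :
    ∃ y ∈ Ioo (0:ℝ) 1, ∃ w ∈ Simp N, r = Fin.cons y ((1-y) • w) := by
  have hy : r 0 < 1 := by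
    have := hr.2
    rw [Fin.sum_univ_succ] at this
    have : 0 ≤ ∑ i : Fin N, r i.succ := Finset.sum_nonneg fun i _ => (hr.1 _).le
    linarith
  have h1 : 1 - r 0 ≠ 0 := by linarith
  have e : r = Fin.cons (r 0) ((1 - r 0) • ((1 - r 0)⁻¹ • Fin.tail r)) := by
    rw [smul_smul, mul_inv_cancel₀ h1, one_smul, Fin.cons_self_tail]
  refine ⟨r 0, ⟨hr.1 0, hy⟩, (1 - r 0)⁻¹ • Fin.tail r, ?_, e⟩
  have h := hr
  rw [e, cons_mem_Simp hy] at h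
  exact h.2

lemma Vf_bound (N : ℕ) (j : Fin N) (r : Fin N → ℝ) (hr : r ∈ Simp N) : ∑ i, |Vf N j r i| ≤ 2 := by
  induction N with
  | zero => exact Fin.elim0 j
  | succ N ih =>
    obtain ⟨y, hy, w, hw, rfl⟩ := Simp_cons_exists hr
    rw [Fin.sum_univ_succ]
    revert j
    refine Fin.cases ?_ (fun i => ?_)
    · rw [Vf_cons_zero hy.2]
      simp only [Fin.cons_zero, Fin.cons_succ, Pi.neg_apply, abs_neg, abs_one]
      have : ∑ i, |w i| = ∑ i, w i := Finset.sum_congr rfl fun i _ => abs_of_pos (hw.1 i)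
      rw [this]; linarith [hw.2]
    · rw [Vf_cons_succ hy.2]
      simp only [Fin.cons_zero, Fin.cons_succ, abs_zero, Pi.smul_apply, smul_eq_mul, abs_mul, ← Finset.mul_sum]
      have h1 : |1-y| ≤ 1 := by rw [abs_le]; constructor <;> linarith [hy.1, hy.2]
      have h2 := ih i w hw
      have h3 : 0 ≤ ∑ l, |Vf N i w l| := Finset.sum_nonneg fun _ _ => abs_nonneg _
      nlinarith [abs_nonneg (1-y)]

lemma lintegral_scale {N : ℕ} (a : ℝ) (ha : 0 < a) (H : (Fin N → ℝ) → ℝ≥0∞) :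
    ∫⁻ x, H x = ENNReal.ofReal (a ^ N) * ∫⁻ w, H (a • w) := by
  have h := lintegral_map_equiv (μ := (volume : Measure (Fin N → ℝ))) H
    (MeasurableEquiv.smul₀ a ha.ne')
  have e : Measure.map (MeasurableEquiv.smul₀ a ha.ne') (volume : Measure (Fin N → ℝ)) =
    ENNReal.ofReal (abs (a ^ N)⁻¹) • volume := by
    have := Measure.map_addHaar_smul (volume : Measure (Fin N → ℝ)) ha.ne'
    rw [Module.finrank_fin_fun] at this
    exact this
  rw [e, lintegral_smul_measure] at h
  have h' : ∫⁻ w, H (a • w) = ENNReal.ofReal |(a ^ N)⁻¹| * ∫⁻ x, H x := h.symm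
  rw [h', ← mul_assoc, ← ENNReal.ofReal_mul (by positivity), abs_of_pos (by positivity),
    mul_inv_cancel₀ (by positivity)]
  simp

lemma lintegral_slice {N : ℕ} (G : (Fin (N+1) → ℝ) → ℝ≥0∞) (hG : Measurable ((Simp (N+1)).indicator G)) :
    ∫⁻ r in Simp (N+1), G r = ∫⁻ y in Ioo (0:ℝ) 1, ∫⁻ w in Simp N,
      ENNReal.ofReal ((1-y)^N) * G (Fin.cons y ((1-y) • w)) := by
  rw [← lintegral_indicator (isOpen_Simp _).measurableSet]
  have hmp := (volume_preserving_piFinSuccAbove (fun _ : Fin (N+1) => ℝ) 0).symm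
  rw [hmp.lintegral_map_equiv, Measure.volume_eq_prod, lintegral_prod _ (by
    exact (hG.comp (MeasurableEquiv.measurable _)).aemeasurable),
    ← lintegral_indicator measurableSet_Ioo]
  congr 1
  ext y
  have hcons : ∀ w : Fin N → ℝ, (MeasurableEquiv.piFinSuccAbove (fun _ : Fin (N+1) => ℝ) 0).symm (y, w)
      = Fin.cons y w := by
    intro w
    simp [MeasurableEquiv.piFinSuccAbove_symm_apply, Fin.consEquiv]
  simp only [hcons]
  by_cases hy : y < 1
  · rw [lintegral_scale (1-y) (by linarith)]
    by_cases hy0 : 0 < y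
    · rw [indicator_of_mem (show y ∈ Ioo (0:ℝ) 1 from ⟨hy0, hy⟩), lintegral_const_mul' _ _ (by simp),
        ← lintegral_indicator (isOpen_Simp _).measurableSet]
      congr 2
      ext w
      by_cases hw : w ∈ Simp N
      · rw [indicator_of_mem hw, indicator_of_mem ((cons_mem_Simp hy w).2 ⟨hy0, hw⟩)]
      · rw [indicator_of_notMem hw, indicator_of_notMem (fun h => hw ((cons_mem_Simp hy w).1 h).2)]
    · rw [indicator_of_notMem (fun h => hy0 h.1)]
      have : ∀ w : Fin N → ℝ, (Simp (N+1)).indicator G (Fin.cons y ((1-y)•w)) = 0 := fun w =>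
        indicator_of_notMem (fun h => hy0 ((cons_mem_Simp hy w).1 h).1) _
      simp [this]
  · rw [indicator_of_notMem (fun h => hy h.2)]
    have : ∀ w : Fin N → ℝ, (Simp (N+1)).indicator G (Fin.cons y w) = 0 := fun w =>
        indicator_of_notMem (fun h => hy (by
          obtain ⟨y', hy', w', hw', e⟩ := Simp_cons_exists h
          have := congrFun e 0
          simp only [Fin.cons_zero] at this
          rw [this]; exact hy'.2)) _
    simp [this]

lemma Wt_cons {N : ℕ} (k : Fin (N+1) → ℕ) (y : ℝ) (w : Fin N → ℝ) :
    (1-y)^N * Wt k (Fin.cons y ((1-y) • w)) =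
    (y^(2 * k 0 + 1) * (1-y)^(N + ∑ i : Fin N, (2 * k i.succ + 1))) * Wt (fun i => k i.succ) w := by
  simp only [Wt, Fin.prod_univ_succ, Fin.cons_zero, Fin.cons_succ, Pi.smul_apply, smul_eq_mul, mul_pow,
    Finset.prod_mul_distrib, Finset.prod_pow_eq_pow_sum, pow_add (1-y) N]
  ring

lemma lint_sq {α : Type*} [MeasurableSpace α] {m : Measure α} {Y : α → ℂ} (hY : MemLp Y 2 m) :
    ∫⁻ a, ‖Y a‖ₑ^2 ∂m = ENNReal.ofReal (∫ a, ‖Y a‖^2 ∂m) := by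
  rw [ofReal_integral_eq_lintegral_ofReal ((memLp_two_iff_integrable_sq_norm hY.1).1 hY)
    (Filter.Eventually.of_forall fun a => by positivity)]
  congr 1; ext a
  rw [ENNReal.ofReal_pow (norm_nonneg _), ofReal_norm]

lemma int_sq_sub {α : Type*} [MeasurableSpace α] {m : Measure α} [IsFiniteMeasure m] {Y : α → ℂ}
    (hY : MemLp Y 2 m) (c : ℂ) :
    ∫ a, ‖Y a - c‖^2 ∂m = ∫ a, ‖Y a‖^2 ∂m - 2 * ((starRingEnd ℂ) c * ∫ a, Y a ∂m).re + m.real univ * ‖c‖^2 := by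
  have hi : Integrable Y m := hY.integrable (by norm_num)
  have h2 := (memLp_two_iff_integrable_sq_norm hY.1).1 hY
  have e : ∀ a, ‖Y a - c‖^2 = ‖Y a‖^2 - 2 * ((starRingEnd ℂ) c * Y a).re + ‖c‖^2 := by
    intro a
    rw [← Complex.normSq_eq_norm_sq, ← Complex.normSq_eq_norm_sq, ← Complex.normSq_eq_norm_sq,
      Complex.normSq_sub]
    simp [Complex.mul_re]; ring
  simp_rw [e]
  have h3 : Integrable (fun a => 2 * ((starRingEnd ℂ) c * Y a).re) m := ((hi.const_mul _).re).const_mul 2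
  have h4 : Integrable (fun a => ‖Y a‖^2 - 2 * ((starRingEnd ℂ) c * Y a).re) m := h2.sub h3
  rw [integral_add h4 (integrable_const _), integral_sub h2 h3]
  congr 1
  · congr 1
    have h5 : ∫ a, ((starRingEnd ℂ) c * Y a).re ∂m = (∫ a, (starRingEnd ℂ) c * Y a ∂m).re :=
      integral_re (hi.const_mul ((starRingEnd ℂ) c))
    rw [integral_const_mul, h5, integral_const_mul]
  · simp

lemma var_lemma {α : Type*} [MeasurableSpace α] (m : Measure α) [IsFiniteMeasure m] (X Z : α → ℂ)
    (hX : MemLp X 2 m) (hZ : MemLp Z 2 m) (c' : ℂ) :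
    ∫⁻ a, ‖X a - ((m.real univ)⁻¹ : ℝ) * ∫ b, Z b ∂m‖ₑ^2 ∂m ≤ ∫⁻ a, ‖X a - c'‖ₑ^2 ∂m + ∫⁻ a, ‖X a - Z a‖ₑ^2 ∂m := by
  by_cases hm : m = 0
  · subst hm; simp
  have hμ : 0 < m.real univ := by
    rw [measureReal_def]; exact ENNReal.toReal_pos (by simpa using hm) (by simp)
  have hXZ : MemLp (fun a => X a - Z a) 2 m := hX.sub hZ
  have hc : ∀ c : ℂ, MemLp (fun a => X a - c) 2 m := fun c => hX.sub (memLp_const c)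
  have hB : ‖(∫ a, X a ∂m) - ∫ a, Z a ∂m‖^2 ≤ m.real univ * ∫ a, ‖X a - Z a‖^2 ∂m := by
    have h1 := lintegral_CS m (fun a => ‖X a - Z a‖ₑ) hXZ.1.enorm
    rw [lint_sq hXZ] at h1
    rw [← integral_sub (hX.integrable (by norm_num)) (hZ.integrable (by norm_num))]
    have h2 : ‖∫ a, (X a - Z a) ∂m‖ₑ^2 ≤ m univ * ENNReal.ofReal (∫ a, ‖X a - Z a‖^2 ∂m) := by
      refine le_trans ?_ h1
      gcongr
      exact enorm_integral_le_lintegral_enorm _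
    have hB0 : 0 ≤ ∫ a, ‖X a - Z a‖^2 ∂m := integral_nonneg fun a => by positivity
    rw [← ofReal_norm, ← ENNReal.ofReal_pow (norm_nonneg _), ← ofReal_measureReal (by simp), ← ENNReal.ofReal_mul hμ.le] at h2
    exact (ENNReal.ofReal_le_ofReal_iff (by positivity)).1 h2
  have e1 := lint_sq (hc (((m.real univ)⁻¹ : ℝ) * ∫ b, Z b ∂m))
  have e2 := lint_sq (hc c')
  have e3 := lint_sq hXZ
  rw [e1, e2, e3, ← ENNReal.ofReal_add (integral_nonneg fun a => by positivity) (integral_nonneg fun a => by positivity)]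
  apply ENNReal.ofReal_le_ofReal
  rw [int_sq_sub hX, int_sq_sub hX]
  set S := ∫ a, X a ∂m
  set T := ∫ a, Z a ∂m
  set μ := m.real univ
  set B := ∫ a, ‖X a - Z a‖^2 ∂m
  have h4 : 0 ≤ ‖S - μ * c'‖^2 := by positivity
  have h5 : ‖(((μ⁻¹ : ℝ) : ℂ) * T)‖^2 = μ⁻¹^2 * ‖T‖^2 := by
    rw [norm_mul, mul_pow, Complex.norm_real, Real.norm_eq_abs, sq_abs]
  have h6 : ((starRingEnd ℂ) (((μ⁻¹ : ℝ) : ℂ) * T) * S).re = μ⁻¹ * (T.re * S.re + T.im * S.im) := by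
    simp [Complex.mul_re]; ring
  have h7 : ((starRingEnd ℂ) c' * S).re = c'.re * S.re + c'.im * S.im := by
    simp [Complex.mul_re]
  have n : ∀ z : ℂ, ‖z‖^2 = z.re^2 + z.im^2 := fun z => by
    rw [← Complex.normSq_eq_norm_sq, Complex.normSq_apply]; ring
  rw [h5, h6, h7]
  rw [n] at h4 hB
  rw [n, n]
  simp only [Complex.sub_re, Complex.sub_im, Complex.mul_re, Complex.mul_im, Complex.ofReal_re, Complex.ofReal_im] at h4 hB
  have hμ' : μ * μ⁻¹ = 1 := mul_inv_cancel₀ hμ.ne'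
  have hB' : μ⁻¹ * ((S.re - T.re)^2 + (S.im - T.im)^2) ≤ B := by
    rw [inv_mul_le_iff₀ hμ]; exact hB
  have h4' : 0 ≤ μ⁻¹ * ((S.re - (μ * c'.re - 0 * c'.im))^2 + (S.im - (μ * c'.im + 0 * c'.re))^2) :=
    mul_nonneg (by positivity) h4
  have e : μ⁻¹ * ((S.re - (μ * c'.re - 0 * c'.im))^2 + (S.im - (μ * c'.im + 0 * c'.re))^2)
    = μ⁻¹ * (S.re^2 + S.im^2) - 2 * (c'.re * S.re + c'.im * S.im) + μ * (c'.re^2 + c'.im^2) := by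
    field_simp; ring
  have e' : μ * (μ⁻¹^2 * (T.re^2 + T.im^2)) = μ⁻¹ * (T.re^2 + T.im^2) := by
    field_simp
  rw [e] at h4'
  rw [e']
  linarith

def mS {N : ℕ} (k : Fin N → ℕ) : Measure (Fin N → ℝ) :=
  (volume.restrict (Simp N)).withDensity (fun r => ENNReal.ofReal (Wt k r))

lemma Simp_sub_Icc {N : ℕ} : Simp N ⊆ Icc 0 1 := by
  intro r hr
  refine ⟨fun j => (hr.1 j).le, fun j => ?_⟩
  exact (Finset.single_le_sum (fun i _ => (hr.1 i).le) (Finset.mem_univ j)).trans hr.2.le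

lemma Simp_vol {N : ℕ} : volume (Simp N) ≤ 1 := by
  refine (measure_mono Simp_sub_Icc).trans ?_
  rw [Real.volume_Icc_pi]; simp

lemma measurable_Wt {N : ℕ} (k : Fin N → ℕ) : Continuous (Wt k) := by
  unfold Wt; fun_prop

lemma lintegral_mS {N : ℕ} (k : Fin N → ℕ) (f : (Fin N → ℝ) → ℝ≥0∞) :
    ∫⁻ r, f r ∂(mS k) = ∫⁻ r in Simp N, f r * ENNReal.ofReal (Wt k r) := by
  unfold mS
  rw [lintegral_withDensity_eq_lintegral_mul_non_measurable _
    (measurable_Wt k).measurable.ennreal_ofReal (by simp)]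
  simp [mul_comm]

lemma Wt_le {N : ℕ} (k : Fin N → ℕ) {r : Fin N → ℝ} (hr : r ∈ Simp N) :
    Wt k r ≤ (∏ j, r j ^ k j)^2 := by
  unfold Wt
  rw [← Finset.prod_pow]
  apply Finset.prod_le_prod (fun j _ => pow_nonneg (hr.1 j).le _)
  intro j _
  rw [pow_succ, pow_mul', sq]
  have h1 : r j ≤ 1 := (Simp_sub_Icc hr).2 j
  have := pow_nonneg (hr.1 j).le (k j)
  rw [← sq]
  nlinarith [sq_nonneg (r j ^ k j)]

instance {N : ℕ} (k : Fin N → ℕ) : IsFiniteMeasure (mS k) := by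
  constructor
  have h := lintegral_mS k (fun _ => 1)
  simp only [lintegral_const, one_mul] at h
  rw [h]
  refine lt_of_le_of_lt (setLIntegral_mono' (isOpen_Simp N).measurableSet (g := fun _ => 1) ?_) ?_
  · intro r hr
    rw [← ENNReal.ofReal_one]
    apply ENNReal.ofReal_le_ofReal
    refine (Wt_le k hr).trans ?_
    apply pow_le_one₀ (Finset.prod_nonneg fun j _ => pow_nonneg (hr.1 j).le _)
    exact Finset.prod_le_one (fun j _ => pow_nonneg (hr.1 j).le _) fun j _ =>
      pow_le_one₀ (hr.1 j).le ((Simp_sub_Icc hr).2 j)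
  · simp only [lintegral_const, one_mul, Measure.restrict_apply_univ]
    exact lt_of_le_of_lt Simp_vol (by simp)

lemma memLp_mS {N : ℕ} (k : Fin N → ℕ) (ψ : (Fin N → ℝ) → ℂ) (hψ : ContinuousOn ψ (Simp N))
    (C : ℝ) (hC : ∀ r ∈ Simp N, (∏ j, r j ^ k j) * ‖ψ r‖ ≤ C) : MemLp ψ 2 (mS k) := by
  have hm : AEStronglyMeasurable ψ (mS k) :=
    (hψ.aestronglyMeasurable (isOpen_Simp N).measurableSet).mono_ac (withDensity_absolutelyContinuous _ _)
  refine ⟨hm, ?_⟩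
  rw [eLpNorm_lt_top_iff_lintegral_rpow_enorm_lt_top (by norm_num) (by norm_num)]
  simp only [ENNReal.toReal_ofNat, ENNReal.rpow_ofNat]
  rw [lintegral_mS]
  refine lt_of_le_of_lt (setLIntegral_mono' (isOpen_Simp N).measurableSet (g := fun _ => ENNReal.ofReal (C^2)) ?_) ?_
  · intro r hr
    rw [← ofReal_norm, ← ENNReal.ofReal_pow (norm_nonneg _), ← ENNReal.ofReal_mul (by positivity)]
    apply ENNReal.ofReal_le_ofReal
    have h1 := Wt_le k hr
    have h2 := hC r hr
    have h3 : 0 ≤ ∏ j, r j ^ k j := Finset.prod_nonneg fun j _ => pow_nonneg (hr.1 j).le _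
    calc ‖ψ r‖^2 * Wt k r ≤ ‖ψ r‖^2 * (∏ j, r j ^ k j)^2 := by gcongr
      _ = ((∏ j, r j ^ k j) * ‖ψ r‖)^2 := by ring
      _ ≤ C^2 := by gcongr
  · simp only [lintegral_const, Measure.restrict_apply_univ]
    exact ENNReal.mul_lt_top (by simp) (lt_of_le_of_lt Simp_vol (by simp))

lemma Wt_pos {N : ℕ} (k : Fin N → ℕ) {r : Fin N → ℝ} (hr : r ∈ Simp N) : 0 < Wt k r :=
  Finset.prod_pos fun j _ => pow_pos (hr.1 j) _

lemma measurable_ind {α : Type*} [TopologicalSpace α] [MeasurableSpace α] [BorelSpace α]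
    {β : Type*} [TopologicalSpace β] [MeasurableSpace β] [BorelSpace β] [Zero β] {s : Set α} (hs : MeasurableSet s) {f : α → β}
    (hf : ContinuousOn f s) : Measurable (s.indicator f) := by
  classical
  rw [← piecewise_eq_indicator]
  exact hf.measurable_piecewise continuousOn_const hs

def Lcons (N : ℕ) (a : ℝ) : (Fin N → ℝ) →L[ℝ] (Fin (N+1) → ℝ) :=
  ContinuousLinearMap.pi (Fin.cons 0 (fun i => a • ContinuousLinearMap.proj i))

lemma Lcons_apply (N : ℕ) (a : ℝ) (v : Fin N → ℝ) : Lcons N a v = Fin.cons 0 (a • v) := by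
  ext i
  refine Fin.cases ?_ (fun i => ?_) i <;> simp [Lcons]

lemma hasFDerivAt_cons (N : ℕ) (y a : ℝ) (w : Fin N → ℝ) :
    HasFDerivAt (fun w : Fin N → ℝ => (Fin.cons y (a • w) : Fin (N+1) → ℝ)) (Lcons N a) w := by
  rw [hasFDerivAt_pi']
  refine Fin.cases ?_ (fun i => ?_)
  · simp only [Fin.cons_zero]
    convert! hasFDerivAt_const y w
  · simp only [Fin.cons_succ, Pi.smul_apply]
    convert! (hasFDerivAt_apply (𝕜 := ℝ) i w).const_smul a

lemma hasDerivAt_cons (N : ℕ) (y : ℝ) (w : Fin N → ℝ) :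
    HasDerivAt (fun y : ℝ => (Fin.cons y ((1-y) • w) : Fin (N+1) → ℝ)) (Fin.cons 1 (-w)) y := by
  rw [hasDerivAt_pi]
  refine Fin.cases ?_ (fun i => ?_)
  · simp only [Fin.cons_zero]; exact hasDerivAt_id y
  · simp only [Fin.cons_succ, Pi.smul_apply, smul_eq_mul, Pi.neg_apply]
    have := ((hasDerivAt_id y).const_sub 1).mul_const (w i)
    simpa using this

theorem PN : ∀ (N : ℕ) (k : Fin N → ℕ) (ψ : (Fin N → ℝ) → ℂ) (ψ' : (Fin N → ℝ) → ((Fin N → ℝ) →L[ℝ] ℂ)),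
    (∀ r ∈ Simp N, HasFDerivAt ψ (ψ' r) r) → ContinuousOn ψ' (Simp N) →
    (∃ C, ∀ r ∈ Simp N, (∏ j, r j ^ k j) * ‖ψ r‖ ≤ C) →
    ∃ c : ℂ, ∫⁻ r in Simp N, ‖ψ r - c‖ₑ^2 * ENNReal.ofReal (Wt k r) ≤
      ENNReal.ofReal (3/4) * ∫⁻ r in Simp N, (∑ j, ‖ψ' r (Vf N j r)‖ₑ^2) * ENNReal.ofReal (Wt k r) := by
  intro N
  induction N with
  | zero =>
    intro k ψ ψ' _ _ _
    refine ⟨ψ 0, ?_⟩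
    have : ∀ r : Fin 0 → ℝ, ‖ψ r - ψ 0‖ₑ^2 * ENNReal.ofReal (Wt k r) = 0 := by
      intro r
      rw [Subsingleton.elim r 0]; simp
    rw [lintegral_congr this]; simp
  | succ N ih =>
    intro k ψ ψ' hψ hψ' ⟨C, hC⟩
    set k' : Fin N → ℕ := fun i => k i.succ with hk'
    set p := 2 * k 0 + 1 with hp
    set q := N + ∑ i : Fin N, (2 * k i.succ + 1) with hq
    obtain ⟨b, hb, hbw⟩ := oneD_base p q (by omega)
    set A : ℝ → ℝ≥0∞ := fun y => ENNReal.ofReal (y^p * (1-y)^q) with hA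
    set B : (Fin N → ℝ) → ℝ≥0∞ := fun w => ENNReal.ofReal (Wt k' w) with hB
    set φ : ℝ → (Fin N → ℝ) → (Fin (N+1) → ℝ) := fun y w => Fin.cons y ((1-y) • w) with hφ
    have hAB : ∀ y ∈ Ioo (0:ℝ) 1, ∀ w, ENNReal.ofReal ((1-y)^N) * ENNReal.ofReal (Wt k (φ y w)) = A y * B w := by
      intro y hy w
      have h1 : 0 ≤ 1 - y := by linarith [hy.2]
      have h0 := hy.1.le
      simp only [hA, hB, hφ]
      rw [← ENNReal.ofReal_mul (by positivity), ← ENNReal.ofReal_mul (by positivity), Wt_cons]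
    have hmem : ∀ y ∈ Ioo (0:ℝ) 1, ∀ w ∈ Simp N, φ y w ∈ Simp (N+1) := fun y hy w hw =>
      (cons_mem_Simp hy.2 w).2 ⟨hy.1, hw⟩
    have hψc : ContinuousOn ψ (Simp (N+1)) := fun r hr => (hψ r hr).continuousAt.continuousWithinAt
    have hφc : Continuous (fun z : ℝ × (Fin N → ℝ) => φ z.1 z.2) := by
      refine continuous_pi ?_
      refine Fin.cases ?_ (fun i => ?_)
      · simp only [hφ, Fin.cons_zero]; fun_prop
      · simp only [hφ, Fin.cons_succ, Pi.smul_apply]; fun_prop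
    have hSm := (isOpen_Simp N).measurableSet
    have hSm1 := (isOpen_Simp (N+1)).measurableSet
    have hφy : ∀ y, Continuous (φ y) := fun y => hφc.comp (by fun_prop : Continuous fun w : Fin N → ℝ => (y, w))
    have hφw : ∀ w, Continuous (fun y => φ y w) := fun w => hφc.comp (by fun_prop : Continuous fun y : ℝ => (y, w))
    have hLp : ∀ y ∈ Ioo (0:ℝ) 1, ∃ C, ∀ w ∈ Simp N, (∏ j, w j ^ k' j) * ‖ψ (φ y w)‖ ≤ C := by
      intro y hy
      have h1 : 0 < 1 - y := by linarith [hy.2]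
      have h0 := hy.1
      set D := y ^ k 0 * (1-y) ^ (∑ i, k' i) with hD
      have hD0 : 0 < D := by positivity
      refine ⟨C / D, fun w hw => ?_⟩
      rw [le_div_iff₀ hD0]
      refine le_trans (le_of_eq ?_) (hC _ (hmem y hy w hw))
      simp only [hφ, Fin.prod_univ_succ, Fin.cons_zero, Fin.cons_succ, Pi.smul_apply, smul_eq_mul, mul_pow,
        Finset.prod_mul_distrib, Finset.prod_pow_eq_pow_sum, hD, hk']
      ring
    have hXc : ∀ y ∈ Ioo (0:ℝ) 1, ContinuousOn (fun w => ψ (φ y w)) (Simp N) := fun y hy =>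
      hψc.comp (hφy y).continuousOn (fun w hw => hmem y hy w hw)
    have hLp2 : ∀ y ∈ Ioo (0:ℝ) 1, MemLp (fun w => ψ (φ y w)) 2 (mS k') := fun y hy => by
      obtain ⟨C, hC⟩ := hLp y hy
      exact memLp_mS k' _ (hXc y hy) C hC
    set c : ℂ := (((mS k').real univ)⁻¹ : ℝ) * ∫ w, ψ (φ b w) ∂(mS k') with hc
    refine ⟨c, ?_⟩
    -- slices
    have hG1 : Measurable ((Simp (N+1)).indicator (fun r => ‖ψ r - c‖ₑ^2 * ENNReal.ofReal (Wt k r))) := by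
      have h1 : Measurable ((Simp (N+1)).indicator (fun r => ψ r - c)) :=
        measurable_ind hSm1 (hψc.sub continuousOn_const)
      have h2 := (h1.enorm.pow_const 2).mul (measurable_Wt k).measurable.ennreal_ofReal
      convert! h2 using 1
      ext r
      by_cases hr : r ∈ Simp (N+1)
      · simp [indicator_of_mem hr]
      · simp [indicator_of_notMem hr]
    have hG2 : Measurable ((Simp (N+1)).indicator (fun r => (∑ j, ‖ψ' r (Vf (N+1) j r)‖ₑ^2) * ENNReal.ofReal (Wt k r))) := by
      have h1 : ∀ i, Measurable ((Simp (N+1)).indicator (fun r => ψ' r (Pi.single i 1))) := fun i =>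
        measurable_ind hSm1 (hψ'.clm_apply continuousOn_const)
      have h2 : Measurable (fun r => (∑ j, ‖∑ i, (Vf (N+1) j r i) • (Simp (N+1)).indicator (fun r => ψ' r (Pi.single i 1)) r‖ₑ^2) * ENNReal.ofReal (Wt k r)) := by
        refine Measurable.mul (Finset.measurable_sum _ fun j _ => (Measurable.pow_const (Measurable.enorm
          (Finset.measurable_sum _ fun i _ => ?_)) 2)) (measurable_Wt k).measurable.ennreal_ofReal
        exact ((measurable_pi_apply i).comp (measurable_Vf (N+1) j)).smul (h1 i)
      convert! h2 using 1
      ext r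
      by_cases hr : r ∈ Simp (N+1)
      · simp only [indicator_of_mem hr]
        congr 1
        refine Finset.sum_congr rfl fun j _ => ?_
        congr 2
        conv_lhs => rw [pi_eq_sum_univ' (Vf (N+1) j r), map_sum]
        refine Finset.sum_congr rfl fun i _ => ?_
        rw [map_smul]
      · simp [indicator_of_notMem hr]
    rw [lintegral_slice _ hG1, lintegral_slice _ hG2]
    have step1 : ∀ y ∈ Ioo (0:ℝ) 1, ∫⁻ w in Simp N, ENNReal.ofReal ((1-y)^N) * (‖ψ (φ y w) - c‖ₑ^2 * ENNReal.ofReal (Wt k (φ y w)))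
        ≤ (∫⁻ w in Simp N, ‖ψ (φ y w) - ψ (φ b w)‖ₑ^2 * (A y * B w)) +
          ENNReal.ofReal (3/4) * ∫⁻ w in Simp N, (∑ j, ‖ψ' (φ y w) (Fin.cons 0 ((1-y) • Vf N j w))‖ₑ^2) * (A y * B w) := by
      intro y hy
      have hA' : A y ≠ ∞ := by simp [hA]
      obtain ⟨c', hc'⟩ := ih k' (fun w => ψ (φ y w)) (fun w => (ψ' (φ y w)).comp (Lcons N (1-y)))
        (fun w hw => (hψ _ (hmem y hy w hw)).comp w (hasFDerivAt_cons N y (1-y) w))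
        ((hψ'.comp (hφy y).continuousOn (fun w hw => hmem y hy w hw)).clm_comp continuousOn_const) (hLp y hy)
      have hv := var_lemma (mS k') _ _ (hLp2 y hy) (hLp2 b hb) c'
      rw [← hc, lintegral_mS, lintegral_mS, lintegral_mS] at hv
      have e1 : ∀ (f : (Fin N → ℝ) → ℝ≥0∞), ∫⁻ w in Simp N, f w * (A y * B w) = A y * ∫⁻ w in Simp N, f w * B w := by
        intro f
        rw [← lintegral_const_mul' _ _ hA']
        congr 1; ext w; ring
      have e2 : ∀ w, ENNReal.ofReal ((1-y)^N) * (‖ψ (φ y w) - c‖ₑ^2 * ENNReal.ofReal (Wt k (φ y w))) =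
          ‖ψ (φ y w) - c‖ₑ^2 * (A y * B w) := fun w => by rw [← hAB y hy w]; ring
      simp only [e2]
      rw [e1, e1, e1]
      simp only [ContinuousLinearMap.comp_apply, Lcons_apply] at hc'
      calc _ ≤ A y * _ := mul_le_mul_right hv _
        _ ≤ A y * (_ + _) := mul_le_mul_right (add_le_add_left hc' _) _
        _ = _ := by ring
    refine (setLIntegral_mono' measurableSet_Ioo step1).trans ?_
    have hABm' : Measurable (fun z : ℝ × (Fin N → ℝ) => A z.1 * B z.2) := by
      refine Measurable.mul (Measurable.ennreal_ofReal (by fun_prop)) ?_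
      exact ((measurable_Wt k').measurable.comp measurable_snd).ennreal_ofReal
    have hABm : ∀ {m : Measure (ℝ × (Fin N → ℝ))}, AEMeasurable (fun z : ℝ × (Fin N → ℝ) => A z.1 * B z.2) m :=
      hABm'.aemeasurable
    have hmeasX : AEMeasurable (Function.uncurry fun (y : ℝ) (w : Fin N → ℝ) => ‖ψ (φ y w) - ψ (φ b w)‖ₑ^2 * (A y * B w))
        ((volume.restrict (Ioo (0:ℝ) 1)).prod (volume.restrict (Simp N))) := by
      rw [Measure.prod_restrict]
      refine AEMeasurable.mul (((ContinuousOn.aestronglyMeasurable ?_ (measurableSet_Ioo.prod hSm)).enorm).pow_const 2) ?_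
      · refine ContinuousOn.sub (hψc.comp hφc.continuousOn fun z hz => hmem _ hz.1 _ hz.2)
          (hψc.comp (f := fun z : ℝ × (Fin N → ℝ) => φ b z.2) ((hφy b).comp continuous_snd).continuousOn fun z hz => hmem _ hb _ hz.2)
      · exact hABm
    have hmeas0 : AEMeasurable (Function.uncurry fun (w : Fin N → ℝ) (y : ℝ) => ‖ψ' (φ y w) (Fin.cons 1 (-w))‖ₑ^2 * (A y * B w))
        ((volume.restrict (Simp N)).prod (volume.restrict (Ioo (0:ℝ) 1))) := by
      rw [Measure.prod_restrict]
      refine AEMeasurable.mul (((ContinuousOn.aestronglyMeasurable ?_ (hSm.prod measurableSet_Ioo)).enorm).pow_const 2) ?_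
      · refine ContinuousOn.clm_apply (hψ'.comp (f := fun z : (Fin N → ℝ) × ℝ => φ z.2 z.1) (hφc.comp continuous_swap).continuousOn fun z hz => hmem _ hz.2 _ hz.1) ?_
        refine Continuous.continuousOn (continuous_pi ?_)
        refine Fin.cases ?_ (fun i => ?_)
        · simp only [Fin.cons_zero]; fun_prop
        · simp only [Fin.cons_succ, Pi.neg_apply]; fun_prop
      · exact (hABm'.comp measurable_swap).aemeasurable
    have hmX : AEMeasurable (fun y => ∫⁻ w in Simp N, ‖ψ (φ y w) - ψ (φ b w)‖ₑ^2 * (A y * B w)) (volume.restrict (Ioo (0:ℝ) 1)) :=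
      AEMeasurable.lintegral_prod_right' hmeasX
    rw [lintegral_add_left' hmX, lintegral_const_mul' _ _ (by simp)]
    have step2 : ∫⁻ y in Ioo (0:ℝ) 1, ∫⁻ w in Simp N, ‖ψ (φ y w) - ψ (φ b w)‖ₑ^2 * (A y * B w) ≤
        ENNReal.ofReal (3/4) * ∫⁻ y in Ioo (0:ℝ) 1, ∫⁻ w in Simp N, ‖ψ' (φ y w) (Fin.cons 1 (-w))‖ₑ^2 * (A y * B w) := by
      rw [lintegral_lintegral_swap hmeasX, ← lintegral_lintegral_swap hmeas0, ← lintegral_const_mul' _ _ (by simp)]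
      apply setLIntegral_mono' hSm
      intro w hw
      have h1 := oneD_int p q b hb hbw (fun y => ψ (φ y w)) (fun y => ψ' (φ y w) (Fin.cons 1 (-w)))
        (fun y hy => (hψ _ (hmem y hy w hw)).comp_hasDerivAt y (hasDerivAt_cons N y w))
        ((hψ'.comp (hφw w).continuousOn (fun y hy => hmem y hy w hw)).clm_apply continuousOn_const)
      have e1 : ∀ (f : ℝ → ℝ≥0∞), ∫⁻ y in Ioo (0:ℝ) 1, f y * (A y * B w) = (∫⁻ y in Ioo (0:ℝ) 1, f y * A y) * B w := by
        intro f
        rw [← lintegral_mul_const' _ _ (by simp [hB])]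
        congr 1; ext w; ring
      rw [e1, e1, ← mul_assoc]
      exact mul_le_mul_left h1 _
    refine (add_le_add_left step2 _).trans ?_
    rw [← mul_add]
    refine mul_le_mul_right ?_ _
    refine (le_lintegral_add _ _).trans ?_
    apply setLIntegral_mono' measurableSet_Ioo
    intro y hy
    refine (le_lintegral_add _ _).trans ?_
    apply lintegral_mono
    intro w
    simp only
    rw [Fin.sum_univ_succ, Vf_cons_zero hy.2]
    simp only [Vf_cons_succ hy.2]
    rw [← add_mul, ← hAB y hy w]
    apply le_of_eq
    ring

theorem param_bdd {A X E : Type*} [TopologicalSpace A] [NormedAddCommGroup X] [NormedSpace ℝ X]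
    [FiniteDimensional ℝ X] [NormedAddCommGroup E] {S : Set A} (hS : IsCompact S) {U : Set X}
    (hU : IsOpen U) {g : A × X → E} (hg : ContinuousOn g (S ×ˢ U)) {z : X} (hz : z ∈ U) :
    ∃ ε > 0, Metric.closedBall z ε ⊆ U ∧ ∃ C, 0 ≤ C ∧ ∀ a ∈ S, ∀ x ∈ Metric.closedBall z ε,
      ‖g (a, x)‖ ≤ C := by
  have : ProperSpace X := FiniteDimensional.proper ℝ X
  obtain ⟨ε, he, hsub⟩ := Metric.nhds_basis_closedBall.mem_iff.1 (hU.mem_nhds hz)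
  have hc : IsCompact (S ×ˢ Metric.closedBall z ε) := hS.prod (isCompact_closedBall z ε)
  obtain ⟨C, hC⟩ := hc.exists_bound_of_continuousOn (hg.mono (prod_mono_right hsub))
  exact ⟨ε, he, hsub, max C 0, le_max_right _ _,
    fun a ha x hx => (hC (a, x) ⟨ha, hx⟩).trans (le_max_left _ _)⟩

/-- derivative of parametric integrals over compact sets -/
theorem paramInt {A X : Type*} [TopologicalSpace A] [MeasurableSpace A]
    [OpensMeasurableSpace A] [SecondCountableTopology A]
    [NormedAddCommGroup X] [NormedSpace ℝ X] [FiniteDimensional ℝ X] {μ : Measure A}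
    {S : Set A} (hS : IsCompact S) (hSm : MeasurableSet S) (hμ : μ S ≠ ∞) {U : Set X}
    (hU : IsOpen U) (c : A → ℂ) (hc : AEStronglyMeasurable c (μ.restrict S)) (C0 : ℝ)
    (hcb : ∀ a ∈ S, ‖c a‖ ≤ C0)
    (g : A × X → ℂ) (g' : A × X → (X →L[ℝ] ℂ)) (hg : ContinuousOn g (S ×ˢ U))
    (hg' : ContinuousOn g' (S ×ˢ U))
    (hd : ∀ a ∈ S, ∀ z ∈ U, HasFDerivAt (fun z => g (a, z)) (g' (a, z)) z) :
    (∀ z ∈ U, HasFDerivAt (fun z => ∫ a in S, c a * g (a, z) ∂μ)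
      (∫ a in S, c a • g' (a, z) ∂μ) z) ∧
    ContinuousOn (fun z => ∫ a in S, c a • g' (a, z) ∂μ) U := by
  have hfin : IsFiniteMeasure (μ.restrict S) := ⟨by simpa using hμ.lt_top⟩
  have hsl : ∀ z ∈ U, ContinuousOn (fun a => g (a, z)) S := fun z hz =>
    hg.comp (by fun_prop) (fun a ha => ⟨ha, hz⟩)
  have hsl' : ∀ z ∈ U, ContinuousOn (fun a => g' (a, z)) S := fun z hz =>
    hg'.comp (by fun_prop) (fun a ha => ⟨ha, hz⟩)
  have hm : ∀ z ∈ U, AEStronglyMeasurable (fun a => c a * g (a, z)) (μ.restrict S) := fun z hz =>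
    hc.mul ((hsl z hz).aestronglyMeasurable hSm)
  have hm' : ∀ z ∈ U, AEStronglyMeasurable (fun a => c a • g' (a, z)) (μ.restrict S) := fun z hz =>
    hc.smul ((hsl' z hz).aestronglyMeasurable hSm)
  have hb' : ∀ z ∈ U, ∃ ε > 0, Metric.closedBall z ε ⊆ U ∧ ∃ C, 0 ≤ C ∧ ∀ a ∈ S,
      ∀ x ∈ Metric.closedBall z ε, ‖c a • g' (a, x)‖ ≤ C := by
    intro z hz
    obtain ⟨ε, he, hsub, C, hC0, hC⟩ := param_bdd hS hU hg' hz
    refine ⟨ε, he, hsub, |C0| * C, by positivity, fun a ha x hx => ?_⟩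
    rw [norm_smul]
    exact mul_le_mul ((hcb a ha).trans (le_abs_self _)) (hC a ha x hx) (norm_nonneg _)
      (abs_nonneg _)
  have hae : ∀ {p : A → Prop}, (∀ a ∈ S, p a) → ∀ᵐ a ∂(μ.restrict S), p a := fun h =>
    (ae_restrict_iff' hSm).2 (Filter.Eventually.of_forall h)
  constructor
  · intro z hz
    obtain ⟨ε, he, hsub, C, hC0, hC⟩ := hb' z hz
    obtain ⟨ε1, he1, hsub1, C1, hC10, hC1⟩ := param_bdd hS hU hg hz
    refine hasFDerivAt_integral_of_dominated_of_fderiv_le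
      (F := fun z a => c a * g (a, z)) (F' := fun z a => c a • g' (a, z))
      (bound := fun _ => C) (Metric.closedBall_mem_nhds z he) ?_ ?_ (hm' z hz) ?_ ?_ ?_
    · filter_upwards [hU.mem_nhds hz] with x hx using hm x hx
    · refine Integrable.of_bound (hm z hz) (|C0| * C1) (hae fun a ha => ?_)
      rw [norm_mul]
      exact mul_le_mul ((hcb a ha).trans (le_abs_self _))
        (hC1 a ha z (Metric.mem_closedBall_self he1.le)) (norm_nonneg _) (abs_nonneg _)
    · exact hae fun a ha x hx => hC a ha x hx
    · exact integrable_const _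
    · exact hae fun a ha x hx => (hd a ha x (hsub hx)).const_mul (c a)
  · intro z hz
    obtain ⟨ε, he, hsub, C, hC0, hC⟩ := hb' z hz
    refine (continuousAt_of_dominated (bound := fun _ => C) ?_ ?_ (integrable_const _)
      ?_).continuousWithinAt
    · filter_upwards [hU.mem_nhds hz] with x hx using hm' x hx
    · filter_upwards [Metric.closedBall_mem_nhds z he] with x hx
      exact hae fun a ha => hC a ha x hx
    · refine hae fun a ha => ?_
      have : ContinuousOn (fun x => g' (a, x)) U := hg'.comp (by fun_prop) (fun x hx => ⟨ha, hx⟩)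
      have h0 := this.continuousAt (hU.mem_nhds hz)
      exact Filter.Tendsto.const_smul h0 (c a)

theorem contDiffOn_one_of {X E : Type*} [NormedAddCommGroup X] [NormedSpace ℝ X]
    [NormedAddCommGroup E] [NormedSpace ℝ E] {U : Set X} (hU : IsOpen U) {g : X → E}
    {g' : X → X →L[ℝ] E} (h : ∀ z ∈ U, HasFDerivAt g (g' z) z) (hc : ContinuousOn g' U) :
    ContDiffOn ℝ 1 g U := by
  rw [show (1 : WithTop ℕ∞) = 0 + 1 by simp, contDiffOn_succ_iff_fderiv_of_isOpen hU]
  refine ⟨fun z hz => (h z hz).differentiableAt.differentiableWithinAt, by simp, ?_⟩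
  rw [contDiffOn_zero]
  exact hc.congr fun z hz => (h z hz).fderiv

theorem contDiffOn_fderiv {X E : Type*} [NormedAddCommGroup X] [NormedSpace ℝ X]
    [NormedAddCommGroup E] [NormedSpace ℝ E] {U : Set X} (hU : IsOpen U) {g : X → E}
    (h : ContDiffOn ℝ 1 g U) : (∀ z ∈ U, HasFDerivAt g (fderiv ℝ g z) z) ∧
      ContinuousOn (fderiv ℝ g) U :=
  ⟨fun z hz => ((h.differentiableOn (by simp)).differentiableAt (hU.mem_nhds hz)).hasFDerivAt,
   h.continuousOn_fderiv_of_isOpen hU le_rfl⟩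

/-- affine substitution version -/
theorem paramInt2 {A X : Type*} [TopologicalSpace A] [MeasurableSpace A]
    [OpensMeasurableSpace A] [SecondCountableTopology A]
    [NormedAddCommGroup X] [NormedSpace ℝ X] [FiniteDimensional ℝ X] {μ : Measure A}
    {S : Set A} (hS : IsCompact S) (hSm : MeasurableSet S) (hμ : μ S ≠ ∞) {U Ω : Set X}
    (hU : IsOpen U) (hΩ : IsOpen Ω) (c : A → ℂ) (hc : ContinuousOn c S)
    (L : A → X →L[ℝ] X) (hL : Continuous L) (τ : A → X) (hτ : Continuous τ)
    (hmap : ∀ a ∈ S, ∀ z ∈ U, L a z + τ a ∈ Ω) (F : X → ℂ) (hF : ContDiffOn ℝ 1 F Ω) :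
    (∀ z ∈ U, HasFDerivAt (fun z => ∫ a in S, c a * F (L a z + τ a) ∂μ)
      (∫ a in S, c a • (fderiv ℝ F (L a z + τ a)).comp (L a) ∂μ) z) ∧
    ContDiffOn ℝ 1 (fun z => ∫ a in S, c a * F (L a z + τ a) ∂μ) U := by
  obtain ⟨C0, hC0⟩ := hS.exists_bound_of_continuousOn hc
  obtain ⟨hF1, hF2⟩ := contDiffOn_fderiv hΩ hF
  have hcm : ContinuousOn (fun p : A × X => L p.1 p.2 + τ p.1) (S ×ˢ U) := by fun_prop
  have hmt : MapsTo (fun p : A × X => L p.1 p.2 + τ p.1) (S ×ˢ U) Ω :=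
    fun p hp => hmap p.1 hp.1 p.2 hp.2
  have := paramInt hS hSm hμ hU c (hc.aestronglyMeasurable hSm) C0 hC0
    (fun p => F (L p.1 p.2 + τ p.1)) (fun p => (fderiv ℝ F (L p.1 p.2 + τ p.1)).comp (L p.1))
    (hF.continuousOn.comp hcm hmt) ((hF2.comp hcm hmt).clm_comp (by fun_prop)) (by
      intro a ha z hz
      exact (hF1 _ (hmap a ha z hz)).comp z ((L a).hasFDerivAt.add_const (τ a)))
  exact ⟨this.1, contDiffOn_one_of hU this.1 this.2⟩

abbrev XN (N : ℕ) := Fin N → ℂ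
def n1 {N : ℕ} (z : XN N) : ℝ := ∑ j, ‖z j‖
def Om (N : ℕ) : Set (XN N) := {z | n1 z < 1}
abbrev TN (N : ℕ) := UnitAddTorus (Fin N)
def muT (N : ℕ) : Measure (TN N) := Measure.pi fun _ => AddCircle.haarAddCircle
instance (N : ℕ) : IsProbabilityMeasure (muT N) := by unfold muT; infer_instance
instance (N : ℕ) : (muT N).IsAddHaarMeasure := by unfold muT; infer_instance
def ef (t : UnitAddCircle) : ℂ := fourier 1 t

theorem continuous_n1 {N : ℕ} : Continuous (n1 (N := N)) := by unfold n1; fun_prop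
theorem isOpen_Om (N : ℕ) : IsOpen (Om N) := isOpen_lt continuous_n1 continuous_const
@[fun_prop] theorem continuous_ef : Continuous ef := (fourier (T := 1) 1).continuous
theorem norm_ef (t : UnitAddCircle) : ‖ef t‖ = 1 := by
  unfold ef; rw [fourier_apply]; exact Circle.norm_coe _
theorem ef_add (s t : UnitAddCircle) : ef (s + t) = ef s * ef t := by
  unfold ef; simp [fourier_apply, smul_add, AddCircle.toCircle_add]
theorem ef_zero : ef 0 = 1 := by simp [ef]
theorem ef_coe (x : ℝ) : ef (x : UnitAddCircle) = Complex.exp (2 * Real.pi * Complex.I * x) := by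
  unfold ef; rw [fourier_coe_apply]; simp
theorem conj_ef (t : UnitAddCircle) : (starRingEnd ℂ) (ef t) = ef (-t) := by
  unfold ef; rw [← fourier_neg]; simp [fourier_apply]
theorem conj_ef_mul (t : UnitAddCircle) : (starRingEnd ℂ) (ef t) * ef t = 1 := by
  rw [conj_ef, ← ef_add]; simp [ef_zero]

/-- rotation -/
def rot {N : ℕ} (t : TN N) : XN N →L[ℝ] XN N :=
  LinearMap.toContinuousLinearMap
    { toFun := fun z j => ef (t j) * z j
      map_add' := by intro x y; ext j; simp [mul_add]
      map_smul' := by intro c x; ext j; simp; ring }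

theorem rot_apply {N : ℕ} (t : TN N) (z : XN N) (j : Fin N) : rot t z j = ef (t j) * z j := rfl
@[fun_prop] theorem continuous_rot {N : ℕ} : Continuous (rot (N := N)) := by
  rw [continuous_clm_apply]
  intro y
  refine continuous_pi fun j => ?_
  simp only [rot_apply]
  fun_prop
theorem n1_rot {N : ℕ} (t : TN N) (z : XN N) : n1 (rot t z) = n1 z := by
  simp [n1, rot_apply, norm_ef]
theorem rot_mem {N : ℕ} {t : TN N} {z : XN N} (hz : z ∈ Om N) : rot t z ∈ Om N := by
  simpa [Om, n1_rot] using hz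
theorem rot_add {N : ℕ} (s t : TN N) (z : XN N) : rot (s + t) z = rot s (rot t z) := by
  ext j; simp [rot_apply, ef_add, mul_assoc]
theorem rot_single {N : ℕ} (t : TN N) (j : Fin N) (a : ℂ) :
    rot t (Pi.single j a) = (ef (t j) • Pi.single j a : XN N) := by
  ext i
  by_cases h : i = j
  · subst h; simp [rot_apply]
  · simp [rot_apply, h]

theorem dbar_add {V : Type*} [NormedAddCommGroup V] [NormedSpace ℂ V]
    (u : V → ℂ) (z ξ η : V) : dbar u z (ξ + η) = dbar u z ξ + dbar u z η := by
  simp only [dbar, smul_add, map_add]; ring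
theorem dbar_smul {V : Type*} [NormedAddCommGroup V] [NormedSpace ℂ V]
    (u : V → ℂ) (z ξ : V) (a : ℂ) : dbar u z (a • ξ) = (starRingEnd ℂ) a * dbar u z ξ := by
  have h : ∀ b : ℂ, fderiv ℝ u z (b • ξ) = b.re * fderiv ℝ u z ξ +
      b.im * fderiv ℝ u z (Complex.I • ξ) := by
    intro b
    have : b • ξ = b.re • ξ + b.im • (Complex.I • ξ) := by
      conv_lhs => rw [← Complex.re_add_im b]
      rw [add_smul, mul_smul]; rfl
    rw [this, map_add, map_smul, map_smul]; simp
  simp only [dbar]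
  rw [smul_smul, h a, h (Complex.I * a)]
  apply Complex.ext <;> simp <;> ring

structure Dat (N : ℕ) (M : ℝ) (F : Fin N → XN N → ℂ) : Prop where
  c1 : ∀ j, ContDiffOn ℝ 1 (F j) (Om N)
  bd : ∀ j, ∀ z ∈ Om N, ‖F j z‖ ≤ M
  cl : ∀ z ∈ Om N, ∀ i j, dbar (F j) z (Pi.single i 1) = dbar (F i) z (Pi.single j 1)

/-- averages over the torus -/
def avg {N : ℕ} (c : C(TN N, ℂ)) (F : Fin N → XN N → ℂ) (j : Fin N) (z : XN N) : ℂ :=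
  ∫ t, (c t * (starRingEnd ℂ) (ef (t j))) * F j (rot t z) ∂(muT N)

theorem avg_hasFDerivAt {N : ℕ} (c : C(TN N, ℂ)) {M : ℝ} {F : Fin N → XN N → ℂ} (h : Dat N M F)
    (j : Fin N) : (∀ z ∈ Om N, HasFDerivAt (avg c F j)
      (∫ t, (c t * (starRingEnd ℂ) (ef (t j))) • (fderiv ℝ (F j) (rot t z)).comp (rot t) ∂(muT N)) z) ∧
      ContDiffOn ℝ 1 (avg c F j) (Om N) := by
  have := paramInt2 (A := TN N) (X := XN N) (μ := muT N) (S := univ) isCompact_univ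
    MeasurableSet.univ (measure_ne_top _ _) (isOpen_Om N) (isOpen_Om N)
    (fun t => c t * (starRingEnd ℂ) (ef (t j))) (by fun_prop) rot (by fun_prop) (fun _ => 0)
    (by fun_prop) (by intro a _ z hz; simpa using rot_mem hz) (F j) (h.c1 j)
  simp only [Measure.restrict_univ, add_zero] at this
  exact this

theorem avg_fderiv_apply {N : ℕ} (c : C(TN N, ℂ)) {M : ℝ} {F : Fin N → XN N → ℂ} (h : Dat N M F)
    (j : Fin N) {z : XN N} (hz : z ∈ Om N) (ξ : XN N) : fderiv ℝ (avg c F j) z ξ =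
      ∫ t, (c t * (starRingEnd ℂ) (ef (t j))) * fderiv ℝ (F j) (rot t z) (rot t ξ) ∂(muT N) := by
  rw [((avg_hasFDerivAt c h j).1 z hz).fderiv, ContinuousLinearMap.integral_apply]
  · rfl
  · refine Continuous.integrable_of_hasCompactSupport ?_ (HasCompactSupport.of_compactSpace _)
    have h2 : Continuous fun t => fderiv ℝ (F j) (rot t z) :=
      (contDiffOn_fderiv (isOpen_Om N) (h.c1 j)).2.comp_continuous (by fun_prop)
        (fun t => rot_mem hz)
    have := h2.clm_comp (continuous_rot (N := N))
    fun_prop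

theorem cont_dbar {N : ℕ} {u : XN N → ℂ} {Ω : Set (XN N)} (hΩ : IsOpen Ω)
    (h : ContDiffOn ℝ 1 u Ω) (ξ : XN N) : ContinuousOn (fun z => dbar u z ξ) Ω := by
  have h2 := (contDiffOn_fderiv hΩ h).2
  unfold dbar
  fun_prop

theorem avg_dbar {N : ℕ} (c : C(TN N, ℂ)) {M : ℝ} {F : Fin N → XN N → ℂ} (h : Dat N M F)
    (i j : Fin N) {z : XN N} (hz : z ∈ Om N) : dbar (avg c F j) z (Pi.single i 1) =
      ∫ t, (c t * (starRingEnd ℂ) (ef (t j)) * (starRingEnd ℂ) (ef (t i))) *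
        dbar (F j) (rot t z) (Pi.single i 1) ∂(muT N) := by
  have hc : ∀ ξ : XN N, Integrable (fun t => (c t * (starRingEnd ℂ) (ef (t j))) *
      fderiv ℝ (F j) (rot t z) (rot t ξ)) (muT N) := by
    intro ξ
    refine Continuous.integrable_of_hasCompactSupport ?_ (HasCompactSupport.of_compactSpace _)
    have h2 : Continuous fun t => fderiv ℝ (F j) (rot t z) :=
      (contDiffOn_fderiv (isOpen_Om N) (h.c1 j)).2.comp_continuous (by fun_prop)
        (fun t => rot_mem hz)
    fun_prop
  unfold dbar
  rw [avg_fderiv_apply c h j hz, avg_fderiv_apply c h j hz, ← integral_const_mul,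
    ← integral_add (hc _) ((hc _).const_mul _), ← integral_div]
  refine integral_congr_ae (Filter.Eventually.of_forall fun t => ?_)
  have := dbar_smul (F j) (rot t z) (Pi.single i 1) (ef (t i))
  rw [← rot_single] at this
  simp only [dbar] at this
  have hI : rot t (Complex.I • Pi.single i 1) = Complex.I • rot t (Pi.single i 1) := by
    ext l; simp [rot_apply]; ring
  simp only
  rw [hI, mul_assoc _ _ ((fderiv ℝ (F j) (rot t z) (Pi.single i 1) + _)/2), ← this]
  ring

theorem avg_dat {N : ℕ} (c : C(TN N, ℂ)) {M : ℝ} (hM : 0 ≤ M) {F : Fin N → XN N → ℂ}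
    (h : Dat N M F) (C : ℝ) (hc : ∫ t, ‖c t‖ ∂(muT N) ≤ C) : Dat N (C * M) (avg c F) := by
  refine ⟨fun j => (avg_hasFDerivAt c h j).2, fun j z hz => ?_, fun z hz i j => ?_⟩
  · calc ‖avg c F j z‖ ≤ ∫ t, ‖c t‖ * M ∂(muT N) := by
          refine norm_integral_le_of_norm_le ?_ (Filter.Eventually.of_forall fun t => ?_)
          · exact Continuous.integrable_of_hasCompactSupport (by fun_prop)
              (HasCompactSupport.of_compactSpace _)
          · rw [norm_mul, norm_mul, RCLike.norm_conj, norm_ef, mul_one]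
            exact mul_le_mul_of_nonneg_left (h.bd j _ (rot_mem hz)) (norm_nonneg _)
      _ = (∫ t, ‖c t‖ ∂(muT N)) * M := integral_mul_const _ _
      _ ≤ _ := mul_le_mul_of_nonneg_right hc hM
  · rw [avg_dbar c h i j hz, avg_dbar c h j i hz]
    refine integral_congr_ae (Filter.Eventually.of_forall fun t => ?_)
    simp only
    rw [h.cl _ (rot_mem hz) i j]; ring

/-- the Fourier modes -/
def phi {N : ℕ} (F : Fin N → XN N → ℂ) (k : Fin N → ℤ) : Fin N → XN N → ℂ :=
  avg (UnitAddTorus.mFourier (-k)) F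

theorem mF_norm {N : ℕ} (k : Fin N → ℤ) (t : TN N) : ‖UnitAddTorus.mFourier k t‖ = 1 := by
  simp [UnitAddTorus.mFourier, fourier_apply]
  exact Finset.prod_eq_one fun _ _ => Circle.norm_coe _

theorem mF_add {N : ℕ} (k : Fin N → ℤ) (s t : TN N) :
    UnitAddTorus.mFourier k (s + t) = UnitAddTorus.mFourier k s * UnitAddTorus.mFourier k t := by
  simp [UnitAddTorus.mFourier, fourier_apply, AddCircle.toCircle_add, smul_add, Finset.prod_mul_distrib]

theorem phi_dat {N : ℕ} (k : Fin N → ℤ) {M : ℝ} (hM : 0 ≤ M) {F : Fin N → XN N → ℂ}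
    (h : Dat N M F) : Dat N M (phi F k) := by
  have := avg_dat (UnitAddTorus.mFourier (-k)) hM h 1 (by simp [mF_norm])
  rwa [one_mul] at this

theorem phi_rot {N : ℕ} (k : Fin N → ℤ) (F : Fin N → XN N → ℂ) (j : Fin N) (s : TN N) (z : XN N) :
    phi F k j (rot s z) = UnitAddTorus.mFourier k s * ef (s j) * phi F k j z := by
  unfold phi avg
  rw [← integral_add_right_eq_self _ (-s), ← integral_const_mul]
  refine integral_congr_ae (Filter.Eventually.of_forall fun t => ?_)
  simp only
  rw [← rot_add, mF_add, Pi.add_apply, ef_add, map_mul]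
  have h1 : UnitAddTorus.mFourier (-k) (-s) = UnitAddTorus.mFourier k s := by
    simp [UnitAddTorus.mFourier, fourier_apply]
  rw [h1, Pi.neg_apply, conj_ef (-s j), neg_neg, neg_add_cancel_right]
  ring

theorem bessel {N : ℕ} {M : ℝ} (hM : 0 ≤ M) {F : Fin N → XN N → ℂ}
    (h : Dat N M F) {z : XN N} (hz : z ∈ Om N) (v : Fin N → ℂ) (s : Finset (Fin N → ℤ)) :
    ∑ k ∈ s, ‖∑ j, v j * phi F k j z‖ ^ 2 ≤ (M * ∑ j, ‖v j‖) ^ 2 := by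
  let H : C(TN N, ℂ) := ⟨fun t => ∑ j, v j * ((starRingEnd ℂ) (ef (t j)) * F j (rot t z)), by
    refine continuous_finsetSum _ fun j _ => ?_
    have h1 : Continuous fun t => F j (rot t z) :=
      (h.c1 j).continuousOn.comp_continuous (by fun_prop) (fun t => rot_mem hz)
    have h2 : Continuous fun t : TN N => (starRingEnd ℂ) (ef (t j)) := by fun_prop
    exact continuous_const.mul (h2.mul h1)⟩
  have hco : ∀ k, ∑ j, v j * phi F k j z = UnitAddTorus.mFourierCoeff H k := by
    intro k
    change _ = ∫ t, UnitAddTorus.mFourier (-k) t • H t ∂(muT N)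
    simp only [phi, avg]
    simp_rw [← integral_const_mul]
    rw [← integral_finsetSum]
    · refine integral_congr_ae (Filter.Eventually.of_forall fun t => ?_)
      simp only [H, ContinuousMap.coe_mk, smul_eq_mul, Finset.mul_sum]
      exact Finset.sum_congr rfl fun j _ => by ring
    · intro j _
      have h1 : Continuous fun t => F j (rot t z) :=
        (h.c1 j).continuousOn.comp_continuous (by fun_prop) (fun t => rot_mem hz)
      refine Continuous.integrable_of_hasCompactSupport ?_ (HasCompactSupport.of_compactSpace _)
      have h2 : Continuous fun t : TN N => (UnitAddTorus.mFourier (-k) t *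
        (starRingEnd ℂ) (ef (t j))) := by fun_prop
      exact continuous_const.mul (h2.mul h1)
  have hHb : ∀ t, ‖H t‖ ≤ M * ∑ j, ‖v j‖ := by
    intro t
    change ‖∑ j, v j * ((starRingEnd ℂ) (ef (t j)) * F j (rot t z))‖ ≤ _
    refine (norm_sum_le _ _).trans ?_
    rw [Finset.mul_sum]
    refine Finset.sum_le_sum fun j _ => ?_
    rw [norm_mul, norm_mul, RCLike.norm_conj, norm_ef, one_mul, mul_comm M]
    exact mul_le_mul_of_nonneg_left (h.bd j _ (rot_mem hz)) (norm_nonneg _)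
  have hs := UnitAddTorus.hasSum_sq_mFourierCoeff (H.toLp 2 (muT N) ℂ)
  simp_rw [hco]
  have h3 : ∀ k, UnitAddTorus.mFourierCoeff (H.toLp 2 (muT N) ℂ) k = UnitAddTorus.mFourierCoeff H k :=
    fun k => UnitAddTorus.mFourierCoeff_toLp H k
  have hs2 : HasSum (fun k => ‖UnitAddTorus.mFourierCoeff H k‖ ^ 2)
      (∫ t, ‖(H.toLp 2 (muT N) ℂ) t‖ ^ 2 ∂(muT N)) :=
    hs.congr_fun (fun k => congrArg (fun x : ℂ => ‖x‖ ^ 2) (h3 k).symm)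
  refine (sum_le_hasSum s (fun _ _ => sq_nonneg _) hs2).trans ?_
  change ∫ t, ‖(H.toLp 2 (muT N) ℂ) t‖ ^ 2 ∂(muT N) ≤ _
  rw [integral_congr_ae (g := fun t => ‖H t‖ ^ 2)]
  · calc ∫ t, ‖H t‖ ^ 2 ∂(muT N) ≤ ∫ t, (M * ∑ j, ‖v j‖) ^ 2 ∂(muT N) := by
          refine integral_mono ?_ (integrable_const _) fun t => ?_
          · exact Continuous.integrable_of_hasCompactSupport (by fun_prop)
              (HasCompactSupport.of_compactSpace _)
          · exact pow_le_pow_left₀ (norm_nonneg _) (hHb t) 2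
      _ = _ := by simp
  · filter_upwards [ContinuousMap.coeFn_toLp (p := 2) (𝕜 := ℂ) (muT N) H] with t ht
    rw [ht]

/-- radial/angular derivative identity -/
theorem phi_radial {N : ℕ} (k : Fin N → ℤ) {M : ℝ} (hM : 0 ≤ M) {F : Fin N → XN N → ℂ}
    (h : Dat N M F) (i j : Fin N) {w : XN N} (hw : w ∈ Om N) :
    fderiv ℝ (phi F k i) w (Pi.single j (w j)) =
      2 * (starRingEnd ℂ) (w j) * dbar (phi F k i) w (Pi.single j 1) +
        (k j + if i = j then 1 else 0) * phi F k i w := by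
  have hd := (contDiffOn_fderiv (isOpen_Om N) ((phi_dat k hM h).c1 i)).1 w hw
  have hang : fderiv ℝ (phi F k i) w (Pi.single j (Complex.I * w j)) =
      Complex.I * (k j + if i = j then 1 else 0) * phi F k i w := by
    let γ : ℝ → XN N := fun x => w + Pi.single j ((Complex.exp (2 * Real.pi * Complex.I * x) - 1) * w j)
    have hγ : ∀ x : ℝ, γ x = rot (Pi.single j (x : UnitAddCircle)) w := by
      intro x; ext l
      by_cases hl : l = j
      · subst hl; simp [γ, rot_apply, ef_coe]; ring
      · simp [γ, rot_apply, hl, ef_zero]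
    have hE : ∀ a : ℂ, HasDerivAt (fun x : ℝ => Complex.exp (a * x)) a 0 := by
      intro a
      have h1 : HasDerivAt (fun x : ℂ => Complex.exp (a * x)) a ((0:ℝ):ℂ) := by
        have := ((hasDerivAt_id ((0:ℝ):ℂ)).const_mul a).cexp
        simpa using this
      exact h1.comp_ofReal
    have hγd : HasDerivAt γ (Pi.single j (2 * Real.pi * Complex.I * w j)) 0 := by
      have h1 : HasDerivAt (fun x : ℝ => (Complex.exp (2 * Real.pi * Complex.I * x) - 1) * w j)
        (2 * Real.pi * Complex.I * w j) 0 := ((hE _).sub_const 1).mul_const _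
      refine hasDerivAt_pi.2 fun l => ?_
      by_cases hl : l = j
      · subst hl; simpa [γ] using h1.const_add (w l)
      · simpa [γ, hl] using hasDerivAt_const (0:ℝ) (w l)
    have hγ0 : γ 0 = w := by simp [γ]
    have h1 : HasDerivAt (fun x => phi F k i (γ x))
        (fderiv ℝ (phi F k i) w (Pi.single j (2 * Real.pi * Complex.I * w j))) 0 := by
      rw [← hγ0] at hd
      have := hd.comp_hasDerivAt (0:ℝ) hγd
      rwa [hγ0] at this
    have h2 : HasDerivAt (fun x => phi F k i (γ x))
        ((2 * Real.pi * Complex.I * (k j + if i = j then 1 else 0)) * phi F k i w) 0 := by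
      have := (hE (2 * Real.pi * Complex.I * (k j + if i = j then 1 else 0))).mul_const (phi F k i w)
      refine this.congr_of_eventuallyEq (Filter.Eventually.of_forall fun x => ?_)
      simp only
      rw [hγ, phi_rot]
      congr 1
      have : UnitAddTorus.mFourier k (Pi.single j (x : UnitAddCircle)) =
          Complex.exp (2 * Real.pi * Complex.I * k j * x) := by
        simp only [UnitAddTorus.mFourier, ContinuousMap.coe_mk]
        rw [Finset.prod_eq_single j]
        · simp only [Pi.single_eq_same]; rw [fourier_coe_apply]; simp
        · intro l _ hl; simp [hl]
        · simp
      rw [this]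
      by_cases hij : i = j
      · subst hij
        simp only [Pi.single_eq_same, ef_coe, if_true]
        rw [← Complex.exp_add]; congr 1; ring
      · simp [hij, ef_zero]
    have h3 := h1.unique h2
    have h4 : (Pi.single j (2 * Real.pi * Complex.I * w j) : XN N) =
        (2 * Real.pi : ℝ) • Pi.single j (Complex.I * w j) := by
      ext l
      by_cases hl : l = j
      · subst hl; simp; ring
      · simp [hl]
    rw [h4, map_smul] at h3
    have hp : ((2 * Real.pi : ℝ) : ℂ) ≠ 0 := by exact_mod_cast (by positivity)
    refine mul_left_cancel₀ hp ?_
    rw [Complex.real_smul] at h3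
    rw [h3]; push_cast; ring
  have hs : (Pi.single j (w j) : XN N) = w j • Pi.single j 1 := by
    ext l; by_cases hl : l = j
    · subst hl; simp
    · simp [hl]
  have := dbar_smul (phi F k i) w (Pi.single j 1) (w j)
  rw [← hs] at this
  rw [mul_assoc, ← this]
  unfold dbar
  have hI : (Complex.I • Pi.single j (w j) : XN N) = Pi.single j (Complex.I * w j) := by
    ext l; by_cases hl : l = j
    · subst hl; simp
    · simp [hl]
  rw [hI, hang]
  linear_combination (-(k j + if i = j then 1 else 0) * phi F k i w) * Complex.I_sq

def Bs (N : ℕ) : Set (XN N) := {z | z ∈ Om N ∧ ∀ j, z j ≠ 0}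

theorem dbar_basis {N : ℕ} (u : XN N → ℂ) (z ξ : XN N) :
    dbar u z ξ = ∑ j, (starRingEnd ℂ) (ξ j) * dbar u z (Pi.single j 1) := by
  have hz : dbar u z 0 = 0 := by simp [dbar]
  have hsum : ∀ (s : Finset (Fin N)) (g : Fin N → XN N), dbar u z (∑ j ∈ s, g j) =
      ∑ j ∈ s, dbar u z (g j) := by
    intro s g
    induction s using Finset.induction_on with
    | empty => simp [hz]
    | insert a s ha ih => rw [Finset.sum_insert ha, Finset.sum_insert ha, dbar_add, ih]
  conv_lhs => rw [show ξ = ∑ j, ξ j • (Pi.single j 1 : XN N) by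
    ext i; simp [Finset.sum_apply, Pi.single_apply]]
  rw [hsum]
  exact Finset.sum_congr rfl fun j _ => dbar_smul _ _ _ _

theorem dbar_of {N : ℕ} {u : XN N → ℂ} {u' : XN N →L[ℝ] ℂ} {z : XN N} (h : HasFDerivAt u u' z)
    (ξ : XN N) : dbar u z ξ = (u' ξ + Complex.I * u' (Complex.I • ξ)) / 2 := by
  unfold dbar; rw [h.fderiv]

/-- shrinking the `j`-th coordinate -/
def Sj {N : ℕ} (j : Fin N) (s : ℝ) : XN N →L[ℝ] XN N :=
  LinearMap.toContinuousLinearMap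
    { toFun := fun z l => (if l = j then (s : ℂ) else 1) * z l
      map_add' := by intro x y; ext j; simp [mul_add]
      map_smul' := by intro c x; ext j; simp; ring_nf }

theorem Sj_apply {N : ℕ} (j : Fin N) (s : ℝ) (z : XN N) (l : Fin N) :
    Sj j s z l = (if l = j then (s : ℂ) else 1) * z l := rfl
@[fun_prop] theorem continuous_Sj {N : ℕ} (j : Fin N) : Continuous (Sj j) := by
  rw [continuous_clm_apply]
  intro y
  refine continuous_pi fun l => ?_
  simp only [Sj_apply]
  split_ifs <;> fun_prop
theorem Sj_mem {N : ℕ} (j : Fin N) {s : ℝ} (hs : s ∈ Icc (0:ℝ) 1) {z : XN N} (hz : z ∈ Om N) :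
    Sj j s z ∈ Om N := by
  have hz' : ∑ l, ‖z l‖ < 1 := hz
  change ∑ l, ‖Sj j s z l‖ < 1
  refine lt_of_le_of_lt (Finset.sum_le_sum fun l _ => ?_) hz'
  rw [Sj_apply]
  split_ifs
  · rw [norm_mul, Complex.norm_real, Real.norm_of_nonneg hs.1]
    exact mul_le_of_le_one_left (norm_nonneg _) hs.2
  · simp
theorem Sj_one {N : ℕ} (j : Fin N) (z : XN N) : Sj j 1 z = z := by
  ext l; simp [Sj_apply]
theorem Sj_rot {N : ℕ} (j : Fin N) (s : ℝ) (t : TN N) (z : XN N) :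
    Sj j s (rot t z) = rot t (Sj j s z) := by
  ext l; simp [Sj_apply, rot_apply]; ring_nf
theorem Sj_single {N : ℕ} (i j : Fin N) (s : ℝ) (a : ℂ) :
    Sj j s (Pi.single i a) = (if i = j then (s : ℂ) else 1) • (Pi.single i a : XN N) := by
  ext l
  by_cases h : l = i
  · subst h; simp [Sj_apply]
  · simp [Sj_apply, h]

theorem Sj_deriv {N : ℕ} (k : Fin N → ℤ) {M : ℝ} (hM : 0 ≤ M) {F : Fin N → XN N → ℂ}
    (h : Dat N M F) (i j : Fin N) (p : ℕ) (hp : (p : ℤ) + 1 = - k j + (if i = j then 1 else 0))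
    {z : XN N} (hz : z ∈ Om N) {s : ℝ} (hs : s ∈ Ioo (0:ℝ) 1) :
    HasDerivAt (fun s : ℝ => (s : ℂ) ^ (p + 1) * phi F k i (Sj j s z))
      (2 * (starRingEnd ℂ) (z j) * s ^ (p+1) * dbar (phi F k i) (Sj j s z) (Pi.single j 1) +
        2 * (if i = j then 1 else 0) * s ^ p * phi F k i (Sj j s z)) s := by
  have hw := Sj_mem j ⟨hs.1.le, hs.2.le⟩ hz
  have hd := (contDiffOn_fderiv (isOpen_Om N) ((phi_dat k hM h).c1 i)).1 _ hw
  have hγ : HasDerivAt (fun s : ℝ => Sj j s z) (Pi.single j (z j)) s := by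
    refine hasDerivAt_pi.2 fun l => ?_
    simp only [Sj_apply]
    by_cases hl : l = j
    · subst hl
      simpa using (Complex.ofRealCLM.hasDerivAt (x := s)).mul_const (z l)
    · simpa [hl] using hasDerivAt_const s (z l)
  have h1 := hd.comp_hasDerivAt s hγ
  have h2 : HasDerivAt (fun s : ℝ => (s : ℂ) ^ (p+1)) ((p + 1 : ℕ) * (s : ℂ) ^ p) s := by
    simpa using (hasDerivAt_pow (p + 1) (s : ℂ)).comp_ofReal
  have h3 := h2.mul h1
  refine h3.congr_deriv ?_
  have hr := phi_radial k hM h i j hw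
  have hsj : (Pi.single j (Sj j s z j) : XN N) = s • Pi.single j (z j) := by
    ext l; by_cases hl : l = j
    · subst hl; simp [Sj_apply]
    · simp [hl]
  rw [hsj, map_smul, Complex.real_smul] at hr
  have hsz : Sj j s z j = s * z j := by simp [Sj_apply]
  rw [hsz, map_mul, Complex.conj_ofReal] at hr
  have hp' : ((p : ℂ) + 1) = - (k j : ℂ) + (if i = j then 1 else 0) := by
    have := congrArg (fun x : ℤ => (x : ℂ)) hp
    push_cast at this
    exact this
  simp only [Function.comp]
  push_cast
  rw [pow_succ]
  linear_combination (s : ℂ) ^ p * hr + (s : ℂ)^p * phi F k i (Sj j s z) * hp'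

theorem Sj_ftc {N : ℕ} (k : Fin N → ℤ) {M : ℝ} (hM : 0 ≤ M) {F : Fin N → XN N → ℂ}
    (h : Dat N M F) (i j : Fin N) (p : ℕ) (hp : (p : ℤ) + 1 = - k j + (if i = j then 1 else 0))
    {z : XN N} (hz : z ∈ Om N) :
    ∫ s in Icc (0:ℝ) 1, 
      (2 * (starRingEnd ℂ) (z j) * (s:ℂ) ^ (p+1) * dbar (phi F k i) (Sj j s z) (Pi.single j 1) +
        2 * (if i = j then 1 else 0) * s ^ p * phi F k i (Sj j s z)) = phi F k i z := by
  have hc1 := (phi_dat k hM h).c1 i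
  have hm : ContinuousOn (fun s : ℝ => Sj j s z) (Icc 0 1) := by fun_prop
  have hA : ContinuousOn (fun s : ℝ => phi F k i (Sj j s z)) (Icc 0 1) :=
    hc1.continuousOn.comp hm fun s hs => Sj_mem j hs hz
  have hB : ContinuousOn (fun s : ℝ => dbar (phi F k i) (Sj j s z) (Pi.single j 1)) (Icc 0 1) :=
    (cont_dbar (isOpen_Om N) hc1 _).comp hm fun s hs => Sj_mem j hs hz
  rw [integral_Icc_eq_integral_Ioc, ← intervalIntegral.integral_of_le zero_le_one,
    intervalIntegral.integral_eq_sub_of_hasDerivAt_of_le zero_le_one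
    (f := fun s : ℝ => (s : ℂ) ^ (p + 1) * phi F k i (Sj j s z)) (by fun_prop)
    (fun s hs => Sj_deriv k hM h i j p hp hz hs)]
  · simp [Sj_one]
  · refine ContinuousOn.intervalIntegrable ?_
    rw [uIcc_of_le zero_le_one]
    fun_prop

def Bk {N : ℕ} (φ : Fin N → XN N → ℂ) : ℝ≥0∞ :=
  ENNReal.ofReal (3/4) * (∫⁻ z in Om N, ∑ j, ‖∑ i, (2 * Vf N j (fun l => ‖z l‖) i : ℂ) *
      φ i (fun l => (‖z l‖ : ℂ))‖ₑ ^ 2)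
  + ∫⁻ z in Om N, ∑ j, 4 * ‖z j‖ₑ ^ 2 * ∫⁻ s in Icc (0:ℝ) 1, ‖φ j (Sj j s z)‖ₑ ^ 2

structure Sol {N : ℕ} (k : Fin N → ℤ) (φ : Fin N → XN N → ℂ) (u : XN N → ℂ) : Prop where
  cont : ContinuousOn u (Om N)
  rot : ∀ t, ∀ z ∈ Om N, u (rot t z) = UnitAddTorus.mFourier k t * u z
  diff : ∀ z ∈ Bs N, DifferentiableAt ℝ u z
  dbar : ∀ z ∈ Bs N, ∀ i, dbar u z (Pi.single i 1) = φ i z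
  l2 : ∫⁻ z in Om N, ‖u z‖ₑ ^ 2 ≤ Bk φ

theorem sol_neg {N : ℕ} (k : Fin N → ℤ) {M : ℝ} (hM : 0 ≤ M) {F : Fin N → XN N → ℂ}
    (h : Dat N M F) (j : Fin N) (hj : k j < 0) : ∃ u, Sol k (phi F k) u := by
  obtain ⟨p, hp⟩ : ∃ p : ℕ, (p : ℤ) + 1 = - k j := ⟨(- k j - 1).toNat, by omega⟩
  have hD := phi_dat k hM h
  set P : XN N → ℂ := fun z => ∫ s in Icc (0:ℝ) 1, (s : ℂ) ^ (p + 1) * phi F k j (Sj j s z) with hP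
  have hPar := paramInt2 (A := ℝ) (X := XN N) (μ := volume) (S := Icc 0 1) isCompact_Icc
    measurableSet_Icc (by simp) (isOpen_Om N) (isOpen_Om N) (fun s => (s : ℂ) ^ (p + 1))
    (by fun_prop) (Sj j) (by fun_prop) (fun _ => 0) (by fun_prop)
    (by intro a ha z hz; simpa using Sj_mem j ha hz) (phi F k j) (hD.c1 j)
  simp only [add_zero] at hPar
  have hPc : ContDiffOn ℝ 1 P (Om N) := hPar.2
  have hPd : ∀ z ∈ Om N, ∀ i, dbar P z (Pi.single i 1) = ∫ s in Icc (0:ℝ) 1,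
      (s : ℂ) ^ (p + 1) * ((if i = j then (s:ℂ) else 1) * dbar (phi F k j) (Sj j s z) (Pi.single i 1)) := by
    intro z hz i
    have hcd : ContinuousOn (fun s : ℝ => fderiv ℝ (phi F k j) (Sj j s z)) (Icc 0 1) :=
      (contDiffOn_fderiv (isOpen_Om N) (hD.c1 j)).2.comp (by fun_prop) fun s hs => Sj_mem j hs hz
    have hint : IntegrableOn (fun s : ℝ => ((s : ℂ) ^ (p + 1)) •
        (fderiv ℝ (phi F k j) (Sj j s z)).comp (Sj j s)) (Icc 0 1) := by
      refine ContinuousOn.integrableOn_compact isCompact_Icc ?_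
      have h2 : ContinuousOn (fun s : ℝ => (fderiv ℝ (phi F k j) (Sj j s z)).comp (Sj j s)) (Icc 0 1) :=
        hcd.clm_comp (by fun_prop)
      have h3 : ContinuousOn (fun s : ℝ => (s : ℂ) ^ (p + 1)) (Icc 0 1) := by fun_prop
      exact h3.smul h2
    have hint2 : ∀ ξ : XN N, IntegrableOn (fun s : ℝ => ((s : ℂ) ^ (p + 1)) *
        (fderiv ℝ (phi F k j) (Sj j s z)) (Sj j s ξ)) (Icc 0 1) := by
      intro ξ
      refine ContinuousOn.integrableOn_compact isCompact_Icc ?_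
      fun_prop
    rw [dbar_of (hPar.1 z hz), ContinuousLinearMap.integral_apply hint,
      ContinuousLinearMap.integral_apply hint]
    change ((∫ s in Icc (0:ℝ) 1, ((s : ℂ) ^ (p + 1)) *
        (fderiv ℝ (phi F k j) (Sj j s z)) (Sj j s _)) + Complex.I * ∫ s in Icc (0:ℝ) 1, ((s : ℂ) ^ (p + 1)) *
        (fderiv ℝ (phi F k j) (Sj j s z)) (Sj j s _)) / 2 = _
    rw [← integral_const_mul, ← integral_add (hint2 _) ((hint2 _).const_mul _), ← integral_div]
    refine integral_congr_ae (Filter.Eventually.of_forall fun s => ?_)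
    have := dbar_smul (phi F k j) (Sj j s z) (Pi.single i 1) (if i = j then (s:ℂ) else 1)
    rw [← Sj_single] at this
    have h5 : (starRingEnd ℂ) (if i = j then (s:ℂ) else 1) = if i = j then (s:ℂ) else 1 := by
      split_ifs <;> simp
    rw [h5] at this
    simp only
    rw [← this]
    unfold dbar
    have hI : Sj j s (Complex.I • Pi.single i 1) = Complex.I • Sj j s (Pi.single i 1) := by
      ext l; simp [Sj_apply]; ring
    rw [hI]; ring
  refine ⟨fun z => (starRingEnd ℂ) (z j) * (2 * P z), ?_, ?_, ?_, ?_, ?_⟩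
  · have := hPc.continuousOn
    have h3 : ContinuousOn (fun z : XN N => (starRingEnd ℂ) (z j)) (Om N) := by fun_prop
    exact h3.mul (continuousOn_const.mul this)
  · intro t z hz
    have : P (rot t z) = UnitAddTorus.mFourier k t * ef (t j) * P z := by
      simp only [hP]
      rw [← integral_const_mul]
      refine integral_congr_ae (Filter.Eventually.of_forall fun s => ?_)
      beta_reduce
      rw [Sj_rot, phi_rot]; ring
    rw [this, rot_apply, map_mul]
    linear_combination (UnitAddTorus.mFourier k t * (starRingEnd ℂ) (z j) * (2 * P z)) * conj_ef_mul (t j)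
  · intro z hz
    have h1 := (contDiffOn_fderiv (isOpen_Om N) hPc).1 z hz.1
    have h2 : DifferentiableAt ℝ (fun z : XN N => (starRingEnd ℂ) (z j)) z :=
      (Complex.conjCLE.toContinuousLinearMap.comp
        (ContinuousLinearMap.proj (R := ℝ) (φ := fun _ : Fin N => ℂ) j)).differentiableAt
    exact h2.mul (h1.differentiableAt.const_mul 2)
  · intro z hz i
    have h1 := (contDiffOn_fderiv (isOpen_Om N) hPc).1 z hz.1
    have h2 : HasFDerivAt (fun z : XN N => (starRingEnd ℂ) (z j))
      (Complex.conjCLE.toContinuousLinearMap.comp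
        (ContinuousLinearMap.proj (R := ℝ) (φ := fun _ : Fin N => ℂ) j)) z :=
      (Complex.conjCLE.toContinuousLinearMap.comp
        (ContinuousLinearMap.proj (R := ℝ) (φ := fun _ : Fin N => ℂ) j)).hasFDerivAt
    have h3 : dbar (fun z => (starRingEnd ℂ) (z j) * (2 * P z)) z (Pi.single i 1) =
        (if i = j then 1 else 0) * (2 * P z) + 2 * (starRingEnd ℂ) (z j) * dbar P z (Pi.single i 1) := by
      rw [dbar_of (u := fun z => (starRingEnd ℂ) (z j) * (2 * P z)) (h2.mul (h1.const_mul 2))]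
      unfold dbar
      by_cases hij : i = j
      · subst hij
        simp
        linear_combination (- P z) * Complex.I_sq
      · have hji : j ≠ i := fun h => hij h.symm
        simp [hij, hji]
        ring
    have hA : ∀ i, ContinuousOn (fun s : ℝ => phi F k i (Sj j s z)) (Icc 0 1) := fun i =>
      (hD.c1 i).continuousOn.comp (by fun_prop) fun s hs => Sj_mem j hs hz.1
    have hB : ∀ i, ContinuousOn (fun s : ℝ => dbar (phi F k i) (Sj j s z) (Pi.single j 1)) (Icc 0 1) :=
      fun i => (cont_dbar (isOpen_Om N) (hD.c1 i) _).comp (by fun_prop) fun s hs => Sj_mem j hs hz.1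
    rw [h3, hPd z hz.1 i]
    by_cases hij : i = j
    · subst hij
      rw [← Sj_ftc k hM h i i (p + 1) (by simp; omega) hz.1]
      simp only [if_true, one_mul, hP]
      rw [← integral_const_mul, ← integral_const_mul, ← integral_add]
      · refine setIntegral_congr_fun measurableSet_Icc fun s hs => ?_
        ring
      · refine ContinuousOn.integrableOn_compact isCompact_Icc ?_
        have := hA i; fun_prop
      · refine ContinuousOn.integrableOn_compact isCompact_Icc ?_
        have := hB i; fun_prop
    · rw [← Sj_ftc k hM h i j p (by simp [hij]; omega) hz.1]
      simp only [hij, if_false, zero_mul, zero_add, hP]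
      rw [← integral_const_mul]
      refine setIntegral_congr_fun measurableSet_Icc fun s hs => ?_
      beta_reduce
      rw [hD.cl _ (Sj_mem j hs hz.1) i j]
      ring
  · unfold Bk
    refine le_trans ?_ le_add_self
    refine setLIntegral_mono_ae' (isOpen_Om N).measurableSet (Filter.Eventually.of_forall fun z hz => ?_)
    refine le_trans ?_ (Finset.single_le_sum (f := fun j => 4 * ‖z j‖ₑ ^ 2 *
      ∫⁻ s in Icc (0:ℝ) 1, ‖phi F k j (Sj j s z)‖ₑ ^ 2) (fun _ _ => zero_le) (Finset.mem_univ j))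
    have hA : ContinuousOn (fun s : ℝ => phi F k j (Sj j s z)) (Icc 0 1) :=
      (hD.c1 j).continuousOn.comp (by fun_prop) fun s hs => Sj_mem j hs hz
    have e1 : ‖P z‖ₑ ≤ ∫⁻ s in Icc (0:ℝ) 1, ‖phi F k j (Sj j s z)‖ₑ := by
      refine (enorm_integral_le_lintegral_enorm _).trans ?_
      refine setLIntegral_mono_ae' measurableSet_Icc (Filter.Eventually.of_forall fun s hs => ?_)
      rw [enorm_mul]
      refine mul_le_of_le_one_left (zero_le) ?_
      rw [← ofReal_norm, norm_pow, Complex.norm_real, Real.norm_of_nonneg hs.1, ← ENNReal.ofReal_one]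
      exact ENNReal.ofReal_le_ofReal (pow_le_one₀ hs.1 hs.2)
    have e2 := lintegral_CS (volume.restrict (Icc (0:ℝ) 1)) (fun s => ‖phi F k j (Sj j s z)‖ₑ)
      (hA.aestronglyMeasurable measurableSet_Icc).enorm
    simp only [Measure.restrict_apply_univ, Real.volume_Icc, sub_zero, ENNReal.ofReal_one, one_mul] at e2
    rw [enorm_mul, enorm_mul, mul_pow, mul_pow]
    have e3 : ‖(starRingEnd ℂ) (z j)‖ₑ = ‖z j‖ₑ := by
      rw [← ofReal_norm, ← ofReal_norm, RCLike.norm_conj]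
    have e4 : ‖(2:ℂ)‖ₑ ^ 2 = 4 := by
      rw [← ofReal_norm]; simp; norm_num
    rw [e3, e4]
    calc ‖z j‖ₑ ^ 2 * (4 * ‖P z‖ₑ ^ 2) = 4 * ‖z j‖ₑ ^ 2 * ‖P z‖ₑ ^ 2 := by ring
      _ ≤ _ := by
        gcongr
        exact (pow_le_pow_left' e1 2).trans e2

def emb {N : ℕ} : (Fin N → ℝ) →L[ℝ] XN N :=
  ContinuousLinearMap.pi fun j => Complex.ofRealCLM.comp (ContinuousLinearMap.proj j)
theorem emb_apply {N : ℕ} (r : Fin N → ℝ) (j : Fin N) : emb r j = (r j : ℂ) := rfl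
theorem emb_mem {N : ℕ} {r : Fin N → ℝ} (hr : r ∈ Simp N) : emb r ∈ Om N := by
  change ∑ j, ‖emb r j‖ < 1
  have : ∀ j, ‖emb r j‖ = r j := fun j => by
    rw [emb_apply, Complex.norm_real, Real.norm_of_nonneg (hr.1 j).le]
  simp_rw [this]; exact hr.2
theorem emb_single {N : ℕ} (j : Fin N) (a : ℝ) : emb (Pi.single j a) = (Pi.single j (a : ℂ) : XN N) := by
  ext l; by_cases hl : l = j
  · subst hl; simp [emb_apply]
  · simp [emb_apply, hl]

def Wc {N : ℕ} (κ : Fin N → ℕ) (r : Fin N → ℝ) : ℂ := ∏ l, (r l : ℂ) ^ κ l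
theorem Wc_ne {N : ℕ} (κ : Fin N → ℕ) {r : Fin N → ℝ} (hr : r ∈ Simp N) : Wc κ r ≠ 0 :=
  Finset.prod_ne_zero_iff.2 fun l _ => pow_ne_zero _ (by exact_mod_cast (hr.1 l).ne')

theorem Wc_deriv {N : ℕ} (κ : Fin N → ℕ) {a : Fin N → ℝ} (ha : a ∈ Simp N) :
    ∃ D : (Fin N → ℝ) →L[ℝ] ℂ, HasFDerivAt (Wc κ) D a ∧ ∀ i, D (Pi.single i 1) = κ i / a i * Wc κ a := by
  have h1 : ∀ l, HasFDerivAt (fun r : Fin N → ℝ => (r l : ℂ) ^ κ l)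
      ((κ l * (a l : ℂ) ^ (κ l - 1)) • (Complex.ofRealCLM.comp
        (ContinuousLinearMap.proj (R := ℝ) (φ := fun _ : Fin N => ℝ) l))) a := by
    intro l
    have h2 := (hasDerivAt_pow (κ l) (a l : ℂ)).comp_ofReal
    have h3 := HasFDerivAt.comp (f := fun r : Fin N → ℝ => r l) a h2.hasFDerivAt
      (ContinuousLinearMap.proj (R := ℝ) (φ := fun _ : Fin N => ℝ) l).hasFDerivAt
    refine h3.congr_fderiv ?_
    ext x
    simp [mul_comm]
  refine ⟨_, HasFDerivAt.finsetProd fun l _ => h1 l, fun i => ?_⟩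
  rw [sum_apply, Finset.sum_eq_single i]
  · have hai : (a i : ℂ) ≠ 0 := by exact_mod_cast (ha.1 i).ne'
    have : Wc κ a = (a i : ℂ) ^ κ i * ∏ j ∈ Finset.univ.erase i, (a j : ℂ) ^ κ j :=
      (Finset.mul_prod_erase _ _ (Finset.mem_univ i)).symm
    rw [this]
    simp only [smul_apply, ContinuousLinearMap.comp_apply,
      ContinuousLinearMap.proj_apply, Pi.single_eq_same, smul_eq_mul, Complex.ofRealCLM_apply,
      Complex.ofReal_one, mul_one]
    rcases Nat.eq_zero_or_pos (κ i) with h0 | h0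
    · simp [h0]
    · obtain ⟨m, hm⟩ : ∃ m, κ i = m + 1 := ⟨κ i - 1, by omega⟩
      rw [hm]
      field_simp
      simp [pow_succ]
      ring
  · intro l _ hl
    simp [hl]
  · simp

section pos
variable {N : ℕ} (κ : Fin N → ℕ) {M : ℝ} (hM : 0 ≤ M) {F : Fin N → XN N → ℂ} (h : Dat N M F)

def Gj (κ : Fin N → ℕ) (F : Fin N → XN N → ℂ) (j : Fin N) (r : Fin N → ℝ) : ℂ :=
  2 * phi F (fun l => (κ l : ℤ)) j (emb r) * (Wc κ r)⁻¹

include hM h in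
theorem Gj_deriv (j : Fin N) {a : Fin N → ℝ} (ha : a ∈ Simp N) :
    ∃ D : (Fin N → ℝ) →L[ℝ] ℂ, HasFDerivAt (Gj κ F j) D a ∧ ∀ i, D (Pi.single i 1) =
      (Wc κ a)⁻¹ * (4 * dbar (phi F (fun l => (κ l : ℤ)) j) (emb a) (Pi.single i 1) +
        (if j = i then 2 / (a i : ℂ) else 0) * phi F (fun l => (κ l : ℤ)) j (emb a)) := by
  obtain ⟨D1, hD1, hD1'⟩ := Wc_deriv κ ha
  have hd := (contDiffOn_fderiv (isOpen_Om N) ((phi_dat (fun l => (κ l : ℤ)) hM h).c1 j)).1 _ (emb_mem ha)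
  have h2 := hd.comp a emb.hasFDerivAt
  have h3 := (hasDerivAt_inv (Wc_ne κ ha)).comp_hasFDerivAt_of_eq a
    hD1 rfl
  refine ⟨_, (h2.const_mul 2).mul h3, fun i => ?_⟩
  have hr := phi_radial (fun l => (κ l : ℤ)) hM h j i (emb_mem ha)
  have hai : (a i : ℂ) ≠ 0 := by exact_mod_cast (ha.1 i).ne'
  have hW := Wc_ne κ ha
  have hs : (Pi.single i (emb a i) : XN N) = (a i) • (Pi.single i 1 : XN N) := by
    ext l; by_cases hl : l = i
    · subst hl; simp [emb_apply]
    · simp [hl]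
  rw [hs, map_smul, emb_apply, Complex.conj_ofReal, Complex.real_smul] at hr
  simp only [add_apply, smul_apply, ContinuousLinearMap.comp_apply, emb_single, smul_eq_mul,
    hD1', Function.comp, Complex.ofReal_one]
  have hfd : fderiv ℝ (phi F (fun l => ↑(κ l)) j) (emb a) (Pi.single i 1) =
      2 * dbar (phi F (fun l => ↑(κ l)) j) (emb a) (Pi.single i 1) +
      (κ i + if j = i then 1 else 0) * phi F (fun l => ↑(κ l)) j (emb a) / a i := by
    field_simp
    push_cast at hr
    linear_combination hr
  rw [hfd]
  by_cases hij : j = i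
  · simp only [hij, if_true]; field_simp; ring
  · simp only [hij, if_false]; field_simp; ring

def om (κ : Fin N → ℕ) (F : Fin N → XN N → ℂ) (r : Fin N → ℝ) : (Fin N → ℝ) →L[ℝ] ℂ :=
  ∑ j, Gj κ F j r • (Complex.ofRealCLM.comp
        (ContinuousLinearMap.proj (R := ℝ) (φ := fun _ : Fin N => ℝ) j))

theorem om_apply (r x : Fin N → ℝ) : om κ F r x = ∑ j, Gj κ F j r * (x j : ℂ) := by
  simp [om]

include hM h in
theorem om_cont : ContinuousOn (om κ F) (Simp N) := by
  unfold om
  refine continuousOn_finsetSum _ fun j _ => ?_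
  have : ContinuousOn (Gj κ F j) (Simp N) := fun a ha => by
    obtain ⟨D, hD, _⟩ := Gj_deriv κ hM h j ha
    exact hD.continuousAt.continuousWithinAt
  exact this.smul continuousOn_const

include hM h in
theorem psi_exists : ∃ ψ : (Fin N → ℝ) → ℂ, ∀ a ∈ Simp N, HasFDerivAt ψ (om κ F a) a := by
  have key : ∀ a ∈ Simp N, ∃ D : (Fin N → ℝ) →L[ℝ] (Fin N → ℝ) →L[ℝ] ℂ, HasFDerivAt (om κ F) D a ∧
      ∀ x y, D x y = D y x := by
    intro a ha
    choose D hD hD' using fun j => Gj_deriv κ hM h j ha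
    let T : Fin N → ℂ →L[ℝ] ((Fin N → ℝ) →L[ℝ] ℂ) := fun j =>
      ((ContinuousLinearMap.compL ℝ (Fin N → ℝ) ℂ ℂ).flip (Complex.ofRealCLM.comp
        (ContinuousLinearMap.proj (R := ℝ) (φ := fun _ : Fin N => ℝ) j))).comp
        (ContinuousLinearMap.mul ℝ ℂ)
    have hT : ∀ j c x, T j c x = c * (x j : ℂ) := fun j c x => rfl
    have hom : om κ F = fun r => ∑ j, T j (Gj κ F j r) := by
      funext r; ext x; rw [om_apply, sum_apply]; rfl
    refine ⟨∑ j, (T j).comp (D j), ?_, fun x y => ?_⟩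
    · rw [hom]
      exact HasFDerivAt.fun_sum fun j _ => (T j).hasFDerivAt.comp a (hD j)
    have hx : ∀ j (x : Fin N → ℝ), D j x = ∑ i, (x i : ℂ) * D j (Pi.single i 1) := by
      intro j x
      conv_lhs => rw [show x = ∑ i, x i • (Pi.single i (1:ℝ) : Fin N → ℝ) by
        ext i; simp [Finset.sum_apply, Pi.single_apply]]
      rw [map_sum]
      exact Finset.sum_congr rfl fun i _ => by rw [map_smul]; simp
    have hsym : ∀ i j, D j (Pi.single i 1) = D i (Pi.single j 1) := by
      intro i j
      rw [hD', hD']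
      by_cases hij : j = i
      · subst hij; rfl
      · have hji : i ≠ j := fun h => hij h.symm
        rw [(phi_dat (fun l => (κ l : ℤ)) hM h).cl _ (emb_mem ha) i j]
        simp [hij, hji]
    simp only [sum_apply, ContinuousLinearMap.comp_apply, hT]
    simp_rw [hx _ x, hx _ y, Finset.sum_mul]
    rw [Finset.sum_comm]
    refine Finset.sum_congr rfl fun i _ => Finset.sum_congr rfl fun j _ => ?_
    rw [hsym i j]; ring
  refine (convex_Simp N).exists_forall_hasFDerivAt_of_fderiv_symmetric (isOpen_Simp N) ?_ ?_
  · intro a ha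
    obtain ⟨D, hD, _⟩ := key a ha
    exact hD.differentiableAt.differentiableWithinAt
  · intro a ha x y
    obtain ⟨D, hD, hs⟩ := key a ha
    rw [hD.fderiv]; exact hs x y

end pos

def rho {N : ℕ} (z : XN N) : Fin N → ℝ := fun l => ‖z l‖
theorem continuous_rho {N : ℕ} : Continuous (rho (N := N)) := by unfold rho; fun_prop
theorem rho_mem {N : ℕ} {z : XN N} (hz : z ∈ Bs N) : rho z ∈ Simp N :=
  ⟨fun j => norm_pos_iff.2 (hz.2 j), hz.1⟩
theorem isOpen_Bs (N : ℕ) : IsOpen (Bs N) := by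
  have : Bs N = Om N ∩ ⋂ j, {z : XN N | z j ≠ 0} := by ext z; simp [Bs]
  rw [this]
  exact (isOpen_Om N).inter (isOpen_iInter_of_finite fun j =>
    isOpen_ne_fun (continuous_apply j) continuous_const)

theorem Bs_ae (N : ℕ) : ∀ᵐ z ∂(volume.restrict (Om N)), z ∈ Bs N := by
  rw [ae_restrict_iff' (isOpen_Om N).measurableSet]
  have : ∀ j : Fin N, ∀ᵐ z : XN N, z j ≠ 0 := by
    intro j
    have h1 := Measure.pi_hyperplane (fun _ : Fin N => (volume : Measure ℂ)) j 0
    rw [ae_iff]; simpa [volume_pi] using h1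
  filter_upwards [ae_all_iff.2 this] with z hz hzO using ⟨hzO, hz⟩

theorem polar {N : ℕ} (G : (Fin N → ℝ) → ℝ≥0∞) (hG : Measurable G) :
    ∫⁻ z in Om N, G (rho z) = ENNReal.ofReal (2 * Real.pi) ^ N *
      ∫⁻ r in Simp N, G r * ENNReal.ofReal (∏ j, r j) := by
  rw [← lintegral_indicator (isOpen_Om N).measurableSet, ← Complex.lintegral_comp_pi_polarCoord_symm]
  have hmp := volume_measurePreserving_arrowProdEquivProdArrow ℝ ℝ (Fin N)
  have htg : (Set.univ.pi fun _ : Fin N ↦ Complex.polarCoord.target) =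
    MeasurableEquiv.arrowProdEquivProdArrow ℝ ℝ (Fin N) ⁻¹'
      ((univ.pi fun _ => Ioi 0) ×ˢ (univ.pi fun _ => Ioo (-Real.pi) Real.pi)) := by
    ext p
    simp only [Complex.polarCoord_target, mem_univ_pi, mem_preimage, mem_prod,
      ← forall_and]
    rfl
  let g : (Fin N → ℝ) × (Fin N → ℝ) → ℝ≥0∞ := fun q => (Simp N).indicator (fun r => G r * ENNReal.ofReal (∏ j, r j)) q.1
  have hg : ∀ p ∈ (Set.univ.pi fun _ : Fin N ↦ Complex.polarCoord.target), (∏ i, ENNReal.ofReal (p i).1) * (Om N).indicator (fun z => G (rho z)) (fun i ↦ Complex.polarCoord.symm (p i)) =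
      g (MeasurableEquiv.arrowProdEquivProdArrow ℝ ℝ (Fin N) p) := by
    intro p hp
    have hp' : ∀ j, 0 < (p j).1 := fun j => (hp j (mem_univ j)).1
    have hn : ∀ i, ‖Complex.polarCoord.symm (p i)‖ = (p i).1 := by
      intro i; rw [Complex.norm_polarCoord_symm, abs_of_pos (hp' i)]
    have hr : rho (fun i ↦ Complex.polarCoord.symm (p i)) = fun i => (p i).1 := funext hn
    have hpr : (∏ i, ENNReal.ofReal (p i).1) = ENNReal.ofReal (∏ i, (p i).1) :=
      (ENNReal.ofReal_prod_of_nonneg fun i _ => (hp' i).le).symm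
    change _ = (Simp N).indicator (fun r => G r * ENNReal.ofReal (∏ j, r j)) (fun i => (p i).1)
    by_cases hm : (fun i ↦ Complex.polarCoord.symm (p i)) ∈ Om N
    · rw [indicator_of_mem hm, indicator_of_mem, hr, hpr, mul_comm]
      refine ⟨hp', ?_⟩
      have : n1 (fun i ↦ Complex.polarCoord.symm (p i)) < 1 := hm
      simpa only [n1, hn] using this
    · rw [indicator_of_notMem hm, indicator_of_notMem, mul_zero]
      intro h
      apply hm
      change n1 _ < 1
      simpa only [n1, hn] using h.2
  have hIm : Measurable ((Simp N).indicator (fun r => G r * ENNReal.ofReal (∏ j, r j))) :=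
    (hG.mul (by fun_prop)).indicator (isOpen_Simp N).measurableSet
  rw [setLIntegral_congr_fun (MeasurableSet.univ_pi fun _ => Complex.polarCoord.open_target.measurableSet) hg,
    htg, hmp.setLIntegral_comp_preimage_emb (MeasurableEquiv.measurableEmbedding _)]
  have hv : (volume : Measure ((Fin N → ℝ) × (Fin N → ℝ))) = volume.prod volume := rfl
  rw [hv, ← Measure.prod_restrict, lintegral_prod _ (by fun_prop)]
  simp only [g, lintegral_const, Measure.restrict_apply_univ]
  rw [lintegral_mul_const _ hIm, setLIntegral_indicator (isOpen_Simp N).measurableSet, mul_comm]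
  congr 1
  · rw [volume_pi_pi]; simp [two_mul]
  · congr 2
    rw [inter_eq_left]
    exact fun r hr j _ => hr.1 j

theorem mF_nat {N : ℕ} (κ : Fin N → ℕ) (t : TN N) :
    UnitAddTorus.mFourier (fun l => (κ l : ℤ)) t = ∏ l, ef (t l) ^ κ l := by
  simp [UnitAddTorus.mFourier, ef, fourier_apply, ← Circle.coe_pow, AddCircle.toCircle_nsmul]

theorem exists_rot {N : ℕ} {z : XN N} (hz : z ∈ Bs N) : ∃ s : TN N, (∀ j, ef (s j) = z j / ‖z j‖) ∧ 
    rot s (emb (rho z)) = z := by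
  refine ⟨fun j => ((Complex.arg (z j) / (2 * Real.pi) : ℝ) : UnitAddCircle), ?_⟩
  have h1 : ∀ j, ef (((Complex.arg (z j) / (2 * Real.pi) : ℝ) : UnitAddCircle)) = z j / ‖z j‖ := by
    intro j
    have hn : (‖z j‖ : ℂ) ≠ 0 := by exact_mod_cast (norm_pos_iff.2 (hz.2 j)).ne'
    rw [ef_coe, eq_div_iff hn, mul_comm]
    conv_rhs => rw [← Complex.norm_mul_exp_arg_mul_I (z j)]
    congr 2
    have : (Real.pi : ℂ) ≠ 0 := by exact_mod_cast Real.pi_ne_zero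
    push_cast
    field_simp
  refine ⟨h1, ?_⟩
  ext j
  have hn : (‖z j‖ : ℂ) ≠ 0 := by exact_mod_cast (norm_pos_iff.2 (hz.2 j)).ne'
  rw [rot_apply, h1, emb_apply, rho]
  field_simp

theorem rho_rot {N : ℕ} (t : TN N) (z : XN N) : rho (rot t z) = rho z := by
  ext l; simp [rho, rot_apply, norm_ef]

theorem rho_deriv {N : ℕ} {z : XN N} (hz : z ∈ Bs N) : ∃ D : XN N →L[ℝ] (Fin N → ℝ),
    HasFDerivAt rho D z ∧ ∀ i, D (Pi.single i 1) = Pi.single i ((z i).re / ‖z i‖) ∧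
      D (Complex.I • Pi.single i 1) = Pi.single i ((z i).im / ‖z i‖) := by
  have h1 : ∀ l, HasFDerivAt (fun z : XN N => ‖z l‖) ((‖z l‖⁻¹ • innerSL ℝ (z l)).comp 
      (ContinuousLinearMap.proj (R := ℝ) (φ := fun _ : Fin N => ℂ) l)) z := by
    intro l
    have h2 : HasFDerivAt (fun z : XN N => z l) (ContinuousLinearMap.proj (R := ℝ) (φ := fun _ : Fin N => ℂ) l) z :=
      (ContinuousLinearMap.proj (R := ℝ) (φ := fun _ : Fin N => ℂ) l).hasFDerivAt
    have h3 := (h2.norm_sq).sqrt (by have := norm_pos_iff.2 (hz.2 l); positivity)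
    have h4 : (fun z : XN N => ‖z l‖) = fun z => Real.sqrt (‖z l‖^2) := by
      funext z; rw [Real.sqrt_sq (norm_nonneg _)]
    rw [h4]
    refine h3.congr_fderiv ?_
    ext x
    simp [Real.sqrt_sq (norm_nonneg (z l))]
    ring
  refine ⟨_, hasFDerivAt_pi.2 h1, fun i => ⟨?_, ?_⟩⟩
  · ext l
    by_cases hl : l = i
    · subst hl; simp [Complex.inner]; ring
    · simp [hl]
  · ext l
    by_cases hl : l = i
    · subst hl; simp [Complex.inner]; ring
    · simp [hl]

section pos2
variable {N : ℕ} (κ : Fin N → ℕ) {M : ℝ} (hM : 0 ≤ M) {F : Fin N → XN N → ℂ} (h : Dat N M F)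

def xt (N : ℕ) (t : ℝ) (r : Fin N → ℝ) : Fin N → ℝ := fun j => (1 - t) * (1 / (N + 1)) + t * r j
def zp (κ : Fin N → ℕ) (z : XN N) : ℂ := ∏ l, z l ^ κ l

theorem r0_mem (N : ℕ) : (fun _ : Fin N => (1 / (N + 1) : ℝ)) ∈ Simp N := by
  refine ⟨fun j => by positivity, ?_⟩
  simp
  rw [← div_eq_mul_inv, div_lt_one (by positivity)]; linarith

theorem xt_zero (r : Fin N → ℝ) : xt N 0 r = fun _ => (1 / (N + 1) : ℝ) := by ext; simp [xt]
theorem xt_one (r : Fin N → ℝ) : xt N 1 r = r := by ext; simp [xt]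

theorem xt_mem {t : ℝ} (ht : t ∈ Icc (0:ℝ) 1) {r : Fin N → ℝ} (hr : r ∈ Simp N) : xt N t r ∈ Simp N := by
  have := convex_Simp N (r0_mem N) hr (sub_nonneg.2 ht.2) ht.1 (by ring)
  convert! this using 1

theorem xt_mem' {t : ℝ} (ht : t ∈ Ioo (0:ℝ) 1) {z : XN N} (hz : z ∈ Om N) : xt N t (rho z) ∈ Simp N := by
  have h1 : ∀ j, 0 < xt N t (rho z) j := by
    intro j
    have h2 : 0 < (1 - t) * (1 / (N + 1) : ℝ) := mul_pos (by linarith [ht.2]) (by positivity)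
    have h3 : 0 ≤ t * rho z j := mul_nonneg ht.1.le (norm_nonneg _)
    unfold xt; linarith
  refine ⟨h1, ?_⟩
  have hz' : ∑ j, rho z j < 1 := hz
  have h0 := (r0_mem N).2
  have h2 : ∑ j, xt N t (rho z) j = (1 - t) * ∑ j : Fin N, (1 / (N + 1) : ℝ) + t * ∑ j, rho z j := by
    unfold xt; rw [Finset.sum_add_distrib, Finset.mul_sum, Finset.mul_sum]
  rw [h2]
  nlinarith [ht.1, ht.2]

theorem xt_ratio {t : ℝ} (ht : t ∈ Ioo (0:ℝ) 1) {z : XN N} (hz : z ∈ Om N) (j : Fin N) :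
    ‖z j / (xt N t (rho z) j : ℂ)‖ ≤ N + 1 := by
  have hp := (xt_mem' ht hz).1 j
  have hz1 : ‖z j‖ ≤ 1 := (Finset.single_le_sum (f := fun j => ‖z j‖) (fun _ _ => norm_nonneg _)
    (Finset.mem_univ j)).trans (le_of_lt hz)
  rw [norm_div, Complex.norm_real, Real.norm_of_nonneg hp.le, div_le_iff₀ hp]
  have e : (N + 1 : ℝ) * xt N t (rho z) j = (1 - t) + t * ((N + 1) * ‖z j‖) := by
    unfold xt rho; field_simp
  rw [e]
  have : (0:ℝ) ≤ N * ‖z j‖ := by positivity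
  nlinarith [ht.1, ht.2]

def ug (κ : Fin N → ℕ) (F : Fin N → XN N → ℂ) (z : XN N) (t : ℝ) : ℂ :=
  (∏ l, (z l / (xt N t (rho z) l : ℂ)) ^ κ l) *
    ∑ j, 2 * phi F (fun l => (κ l : ℤ)) j (emb (xt N t (rho z))) * ((‖z j‖ - 1 / (N + 1) : ℝ) : ℂ)
def u0 (κ : Fin N → ℕ) (F : Fin N → XN N → ℂ) (z : XN N) : ℂ := ∫ t in Ioo (0:ℝ) 1, ug κ F z t

include hM h in
theorem ug_bound {t : ℝ} (ht : t ∈ Ioo (0:ℝ) 1) {z : XN N} (hz : z ∈ Om N) :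
    ‖ug κ F z t‖ ≤ (∏ l, ((N:ℝ) + 1) ^ κ l) * ∑ _j : Fin N, 2 * M * 1 := by
  unfold ug
  rw [norm_mul]
  refine mul_le_mul ?_ ?_ (norm_nonneg _) (by positivity)
  · rw [norm_prod]
    refine Finset.prod_le_prod (fun _ _ => norm_nonneg _) fun l _ => ?_
    rw [norm_pow]
    exact pow_le_pow_left₀ (norm_nonneg _) (xt_ratio ht hz l) _
  · refine (norm_sum_le _ _).trans (Finset.sum_le_sum fun j _ => ?_)
    have hz1 : ‖z j‖ ≤ 1 := (Finset.single_le_sum (f := fun j => ‖z j‖) (fun _ _ => norm_nonneg _)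
      (Finset.mem_univ j)).trans (le_of_lt hz)
    have hN : (1 / (N + 1) : ℝ) ≤ 1 := by
      rw [div_le_one (by positivity)]; linarith [(Nat.cast_nonneg N : (0:ℝ) ≤ N)]
    have hN0 : (0:ℝ) < (1 / (N + 1) : ℝ) := by positivity
    rw [norm_mul, norm_mul, Complex.norm_real]
    have h1 := (phi_dat (fun l => (κ l : ℤ)) hM h).bd j _ (emb_mem (xt_mem' ht hz))
    have h2 : ‖(‖z j‖ - 1 / (N + 1) : ℝ)‖ ≤ 1 := by
      rw [Real.norm_eq_abs, abs_le]; constructor <;> linarith [norm_nonneg (z j)]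
    rw [show ‖(2:ℂ)‖ = 2 by simp]
    gcongr

include hM h in
theorem ug_cont : ContinuousOn (fun p : XN N × ℝ => ug κ F p.1 p.2) (Om N ×ˢ Ioo (0:ℝ) 1) := by
  have hx : Continuous (fun p : XN N × ℝ => xt N p.2 (rho p.1)) := by
    have := continuous_rho (N := N)
    unfold xt
    refine continuous_pi fun j => ?_
    have h2 : Continuous fun p : XN N × ℝ => rho p.1 j := (continuous_apply j).comp (this.comp continuous_fst)
    fun_prop
  have h1 : ∀ l, ContinuousOn (fun p : XN N × ℝ => p.1 l / (xt N p.2 (rho p.1) l : ℂ)) (Om N ×ˢ Ioo (0:ℝ) 1) := by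
    intro l
    have h3 : Continuous fun p : XN N × ℝ => xt N p.2 (rho p.1) l := (continuous_apply l).comp hx
    have h4 : Continuous fun p : XN N × ℝ => p.1 l := (continuous_apply l).comp continuous_fst
    refine ContinuousOn.div h4.continuousOn (Complex.continuous_ofReal.comp h3).continuousOn ?_
    intro p hp
    have := (xt_mem' hp.2 hp.1).1 l
    exact_mod_cast this.ne'
  have h2 : ∀ j, ContinuousOn (fun p : XN N × ℝ => phi F (fun l => (κ l : ℤ)) j (emb (xt N p.2 (rho p.1))))
      (Om N ×ˢ Ioo (0:ℝ) 1) := fun j =>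
    ((phi_dat (fun l => (κ l : ℤ)) hM h).c1 j).continuousOn.comp (emb.continuous.comp hx).continuousOn
      (fun p hp => emb_mem (xt_mem' hp.2 hp.1))
  have h3 : ∀ j, Continuous (fun p : XN N × ℝ => ((‖p.1 j‖ - 1 / (N + 1) : ℝ) : ℂ)) := by
    intro j
    have h4 : Continuous fun p : XN N × ℝ => p.1 j := (continuous_apply j).comp continuous_fst
    exact Complex.continuous_ofReal.comp (h4.norm.sub continuous_const)
  exact (continuousOn_finsetProd _ fun l _ => (h1 l).pow _).mul
    (continuousOn_finsetSum _ fun j _ => (continuousOn_const.mul (h2 j)).mul (h3 j).continuousOn)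

include hM h in
theorem u0_cont : ContinuousOn (u0 κ F) (Om N) := by
  refine continuousOn_of_dominated (bound := fun _ => (∏ l, ((N:ℝ) + 1) ^ κ l) * ∑ _j : Fin N, 2 * M * 1) ?_ ?_ ?_ ?_
  · intro z hz
    exact ((ug_cont κ hM h).comp (f := fun t : ℝ => (z, t)) (by fun_prop) (fun t ht => ⟨hz, ht⟩)).aestronglyMeasurable measurableSet_Ioo
  · intro z hz
    exact (ae_restrict_iff' measurableSet_Ioo).2 (Filter.Eventually.of_forall fun t ht => ug_bound κ hM h ht hz)
  · exact integrable_const _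
  · exact (ae_restrict_iff' measurableSet_Ioo).2 (Filter.Eventually.of_forall fun t ht =>
      (ug_cont κ hM h).comp (f := fun z : XN N => (z, t)) (by fun_prop) (fun z hz => ⟨hz, ht⟩))

include hM h in
theorem u0_bound {z : XN N} (hz : z ∈ Om N) : ‖u0 κ F z‖ ≤ (∏ l, ((N:ℝ) + 1) ^ κ l) * ∑ _j : Fin N, 2 * M * 1 := by
  refine (norm_setIntegral_le_of_norm_le_const (by simp) (fun t ht => ug_bound κ hM h ht hz)).trans ?_
  simp

include hM h in
theorem u0_eq {ψ : (Fin N → ℝ) → ℂ} (hψ : ∀ a ∈ Simp N, HasFDerivAt ψ (om κ F a) a) {z : XN N} (hz : z ∈ Bs N) :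
    u0 κ F z = zp κ z * (ψ (rho z) - ψ (fun _ => (1 / (N + 1) : ℝ))) := by
  have hr := rho_mem hz
  have hd : ∀ t ∈ uIcc (0:ℝ) 1, HasDerivAt (fun t => ψ (xt N t (rho z)))
      (om κ F (xt N t (rho z)) (fun j => rho z j - 1 / (N + 1))) t := by
    intro t ht
    rw [uIcc_of_le zero_le_one] at ht
    have hx : HasDerivAt (fun t => xt N t (rho z)) (fun j => rho z j - 1 / (N + 1)) t := by
      rw [hasDerivAt_pi]
      intro j
      have := (((hasDerivAt_id t).const_sub 1).mul_const (1 / (N + 1) : ℝ)).add ((hasDerivAt_id t).mul_const (rho z j))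
      convert! this using 1
      ring
    exact (hψ _ (xt_mem ht hr)).comp_hasDerivAt t hx
  have hcx : ContinuousOn (fun t => xt N t (rho z)) (uIcc (0:ℝ) 1) := by
    unfold xt; fun_prop
  have hftc := intervalIntegral.integral_eq_sub_of_hasDerivAt hd (ContinuousOn.intervalIntegrable
    (((om_cont κ hM h).comp hcx (fun t ht => by
      rw [uIcc_of_le zero_le_one] at ht; exact xt_mem ht hr)).clm_apply continuousOn_const))
  rw [xt_zero, xt_one] at hftc
  rw [← hftc, intervalIntegral.integral_of_le zero_le_one, integral_Ioc_eq_integral_Ioo, u0, ← integral_const_mul]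
  refine setIntegral_congr_fun measurableSet_Ioo fun t ht => ?_
  have hs := xt_mem ⟨ht.1.le, ht.2.le⟩ hr
  have hW := Wc_ne κ hs
  simp only [om_apply, ug, Gj, zp, div_pow, Finset.prod_div_distrib]
  rw [show ∏ l, (xt N t (rho z) l : ℂ) ^ κ l = Wc κ (xt N t (rho z)) from rfl, Finset.mul_sum, Finset.mul_sum]
  refine Finset.sum_congr rfl fun j _ => ?_
  simp only [rho]
  push_cast
  ring

theorem zp_rot (t : TN N) (z : XN N) :
    zp κ (rot t z) = UnitAddTorus.mFourier (fun l => (κ l : ℤ)) t * zp κ z := by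
  rw [mF_nat]; simp [zp, rot_apply, mul_pow, Finset.prod_mul_distrib]

theorem u0_rot (t : TN N) (z : XN N) :
    u0 κ F (rot t z) = UnitAddTorus.mFourier (fun l => (κ l : ℤ)) t * u0 κ F z := by
  unfold u0
  rw [← integral_const_mul]
  refine integral_congr_ae (Filter.Eventually.of_forall fun s => ?_)
  simp only [ug, rho_rot]
  rw [← mul_assoc, mF_nat, ← Finset.prod_mul_distrib]
  have : ∀ j, ‖rot t z j‖ = ‖z j‖ := fun j => by simp [rot_apply, norm_ef]
  simp_rw [this]
  congr 1
  refine Finset.prod_congr rfl fun l _ => ?_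
  rw [rot_apply, ← mul_pow, mul_div_assoc]

theorem zp_emb (r : Fin N → ℝ) : zp κ (emb r) = Wc κ r := rfl

include hM h in
theorem sol_dbar {ψ : (Fin N → ℝ) → ℂ} (hψ : ∀ a ∈ Simp N, HasFDerivAt ψ (om κ F a) a) {z : XN N} (hz : z ∈ Bs N) (c : ℂ) :
    DifferentiableAt ℝ (fun z => zp κ z * (ψ (rho z) - c)) z ∧
    ∀ i, dbar (fun z => zp κ z * (ψ (rho z) - c)) z (Pi.single i 1) = phi F (fun l => (κ l : ℤ)) i z := by
  obtain ⟨D, hD, hD'⟩ := rho_deriv hz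
  have hz1 : DifferentiableAt ℂ (zp κ) z := by unfold zp; fun_prop
  have hz2 := hz1.hasFDerivAt.restrictScalars ℝ
  have hz3 := ((hψ _ (rho_mem hz)).comp z hD).sub_const c
  have hz4 := hz2.mul hz3
  refine ⟨hz4.differentiableAt, fun i => ?_⟩
  obtain ⟨s, hs1, hs2⟩ := exists_rot hz
  have hp := phi_rot (fun l => (κ l : ℤ)) F i s (emb (rho z))
  rw [hs2, hs1, mF_nat] at hp
  simp_rw [hs1] at hp
  have hW : Wc κ (rho z) ≠ 0 := Wc_ne κ (rho_mem hz)
  have hn : ∀ j, (‖z j‖ : ℂ) ≠ 0 := fun j => by exact_mod_cast (norm_pos_iff.2 (hz.2 j)).ne'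
  have hpr : ∏ l, (z l / (‖z l‖ : ℂ)) ^ κ l = zp κ z / Wc κ (rho z) := by
    simp only [div_pow, Finset.prod_div_distrib]; rfl
  rw [hpr] at hp
  rw [hp, dbar_of (u := fun z => zp κ z * (ψ (rho z) - c)) hz4]
  have hom : ∀ a : ℝ, om κ F (rho z) (Pi.single i a) = Gj κ F i (rho z) * a := by
    intro a
    rw [om_apply, Finset.sum_eq_single i]
    · simp
    · intro j _ hj; simp [hj]
    · simp
  simp only [add_apply, smul_apply, ContinuousLinearMap.comp_apply, (hD' i).1, (hD' i).2, hom, smul_eq_mul,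
    ContinuousLinearMap.coe_restrictScalars', map_smul, Gj, Function.comp]
  have hre : z i = (z i).re + (z i).im * Complex.I := (Complex.re_add_im _).symm
  have hn' := hn i
  push_cast
  generalize (‖z i‖ : ℂ) = n at hn' ⊢
  conv_rhs => rw [hre]
  field_simp
  linear_combination (Wc κ (rho z) * (ψ (rho z) - c) * (fderiv ℂ (zp κ) z) (Pi.single i 1) * n) * Complex.I_sq

end pos2

theorem sol_pos {N : ℕ} (κ : Fin N → ℕ) {M : ℝ} (hM : 0 ≤ M) {F : Fin N → XN N → ℂ} (h : Dat N M F) :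
    ∃ u, Sol (fun l => (κ l : ℤ)) (phi F (fun l => (κ l : ℤ))) u := by
  obtain ⟨ψ, hψ⟩ := psi_exists κ hM h
  set r0 : Fin N → ℝ := fun _ => (1 / (N + 1) : ℝ) with hr0
  have hWn : ∀ r ∈ Simp N, ‖Wc κ r‖ = ∏ j, r j ^ κ j := by
    intro r hr
    rw [Wc, norm_prod]
    refine Finset.prod_congr rfl fun j _ => ?_
    rw [norm_pow, Complex.norm_real, Real.norm_of_nonneg (hr.1 j).le]
  have hr1 : ∀ r ∈ Simp N, ∀ j, r j ≤ 1 := fun r hr j =>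
    (Finset.single_le_sum (fun j _ => (hr.1 j).le) (Finset.mem_univ j)).trans hr.2.le
  have hψc : ContinuousOn ψ (Simp N) := fun r hr => (hψ r hr).continuousAt.continuousWithinAt
  have hbd : ∃ C, ∀ r ∈ Simp N, (∏ j, r j ^ κ j) * ‖ψ r‖ ≤ C := by
    refine ⟨(∏ l, ((N:ℝ) + 1) ^ κ l) * (∑ _j : Fin N, 2 * M * 1) + ‖ψ r0‖, fun r hr => ?_⟩
    have hB : emb r ∈ Bs N := ⟨emb_mem hr, fun j => by
      rw [emb_apply]; exact_mod_cast (hr.1 j).ne'⟩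
    have hrr : rho (emb r) = r := by
      ext j; simp only [rho, emb_apply, Complex.norm_real]; exact Real.norm_of_nonneg (hr.1 j).le
    have e := u0_eq κ hM h hψ hB
    rw [hrr, zp_emb] at e
    have e2 : Wc κ r * ψ r = u0 κ F (emb r) + Wc κ r * ψ r0 := by rw [e]; ring
    rw [← hWn r hr, ← norm_mul, e2]
    refine (norm_add_le _ _).trans (add_le_add (u0_bound κ hM h hB.1) ?_)
    rw [norm_mul, hWn r hr]
    refine mul_le_of_le_one_left (norm_nonneg _) ?_
    exact Finset.prod_le_one (fun j _ => pow_nonneg (hr.1 j).le _) fun j _ =>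
      pow_le_one₀ (hr.1 j).le (hr1 r hr j)
  obtain ⟨c, hc⟩ := PN N κ ψ (om κ F) hψ (om_cont κ hM h) hbd
  have hu : ∀ z ∈ Bs N, u0 κ F z + zp κ z * (ψ r0 - c) = zp κ z * (ψ (rho z) - c) := by
    intro z hz
    rw [u0_eq κ hM h hψ hz]; ring
  have hue : ∀ z ∈ Bs N, (fun z => u0 κ F z + zp κ z * (ψ r0 - c)) =ᶠ[nhds z]
      fun z => zp κ z * (ψ (rho z) - c) := by
    intro z hz
    filter_upwards [(isOpen_Bs N).mem_nhds hz] with w hw using hu w hw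
  have hSm := (isOpen_Simp N).measurableSet
  refine ⟨fun z => u0 κ F z + zp κ z * (ψ r0 - c), ?_, ?_, ?_, ?_, ?_⟩
  · have h1 : Continuous (zp κ : XN N → ℂ) := by unfold zp; fun_prop
    exact (u0_cont κ hM h).add (h1.continuousOn.mul continuousOn_const)
  · intro t z hz
    beta_reduce
    rw [u0_rot, zp_rot]; ring
  · intro z hz
    exact (sol_dbar κ hM h hψ hz c).1.congr_of_eventuallyEq (hue z hz)
  · intro z hz i
    rw [← (sol_dbar κ hM h hψ hz c).2 i]
    unfold dbar
    rw [(hue z hz).fderiv_eq]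
  · unfold Bk
    refine le_trans ?_ le_self_add
    let G : (Fin N → ℝ) → ℝ≥0∞ := fun r => ‖(Simp N).indicator (fun r => Wc κ r * (ψ r - c)) r‖ₑ ^ 2
    have hGm : Measurable G := by
      refine (measurable_ind hSm ?_).enorm.pow_const 2
      refine ContinuousOn.mul ?_ (hψc.sub continuousOn_const)
      unfold Wc; fun_prop
    let φr : Fin N → (Fin N → ℝ) → ℂ := fun i => (Simp N).indicator (fun r => phi F (fun l => (κ l : ℤ)) i (emb r))
    let H : (Fin N → ℝ) → ℝ≥0∞ := fun r => ∑ j, ‖∑ i, (2 * Vf N j r i : ℂ) * φr i r‖ₑ ^ 2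
    have hφm : ∀ i, Measurable (φr i) := fun i => measurable_ind hSm
      (((phi_dat (fun l => (κ l : ℤ)) hM h).c1 i).continuousOn.comp emb.continuous.continuousOn
        fun r hr => emb_mem hr)
    have hHm : Measurable H := by
      refine Finset.measurable_sum _ fun j _ => (Measurable.enorm ?_).pow_const 2
      refine Finset.measurable_sum _ fun i _ => Measurable.mul ?_ (hφm i)
      have := (measurable_pi_apply i).comp (measurable_Vf N j)
      exact (Complex.measurable_ofReal.comp this).const_mul 2
    have e1 : ∫⁻ z in Om N, ‖u0 κ F z + zp κ z * (ψ r0 - c)‖ₑ ^ 2 = ∫⁻ z in Om N, G (rho z) := by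
      refine lintegral_congr_ae ?_
      filter_upwards [Bs_ae N] with z hz
      have hzn : ‖zp κ z‖ₑ = ‖Wc κ (rho z)‖ₑ := by
        simp [zp, Wc, ← ofReal_norm, rho]
      rw [hu z hz]
      simp only [G]
      rw [indicator_of_mem (rho_mem hz), enorm_mul, enorm_mul, hzn]
    have e2 : ∫⁻ z in Om N, H (rho z) ≤ ∫⁻ z in Om N, ∑ j, ‖∑ i, (2 * Vf N j (fun l => ‖z l‖) i : ℂ) *
      phi F (fun l => (κ l : ℤ)) i (fun l => (‖z l‖ : ℂ))‖ₑ ^ 2 := by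
      refine lintegral_mono_ae ?_
      filter_upwards [Bs_ae N] with z hz
      simp only [H, φr]
      simp_rw [indicator_of_mem (rho_mem hz)]
      exact le_rfl
    have hWt : ∀ r ∈ Simp N, ENNReal.ofReal (Wt κ r) = ‖Wc κ r‖ₑ ^ 2 * ENNReal.ofReal (∏ j, r j) := by
      intro r hr
      rw [← ofReal_norm, hWn r hr, ← ENNReal.ofReal_pow (Finset.prod_nonneg fun j _ => pow_nonneg (hr.1 j).le _),
        ← ENNReal.ofReal_mul (by positivity)]
      congr 1
      rw [Wt, ← Finset.prod_pow, ← Finset.prod_mul_distrib]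
      refine Finset.prod_congr rfl fun j _ => ?_
      ring
    rw [e1]
    refine le_trans ?_ (mul_le_mul_right e2 _)
    rw [polar G hGm, polar H hHm, mul_left_comm]
    refine mul_le_mul_right ?_ _
    refine le_trans (le_of_eq ?_) (hc.trans (le_of_eq ?_))
    · refine setLIntegral_congr_fun hSm fun r hr => ?_
      simp only [G]
      rw [indicator_of_mem hr, hWt r hr, enorm_mul]; ring
    · congr 1
      refine setLIntegral_congr_fun hSm fun r hr => ?_
      simp only [H, φr]
      rw [hWt r hr, ← mul_assoc]
      congr 1
      rw [Finset.sum_mul]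
      refine Finset.sum_congr rfl fun j _ => ?_
      rw [← mul_pow, ← enorm_mul, om_apply, Finset.sum_mul]
      simp_rw [indicator_of_mem hr]
      congr 3
      have := Wc_ne κ hr
      ext i
      simp only [Gj]
      field_simp

theorem sol_ex {N : ℕ} (k : Fin N → ℤ) {M : ℝ} (hM : 0 ≤ M) {F : Fin N → XN N → ℂ} (h : Dat N M F) :
    ∃ u, Sol k (phi F k) u := by
  by_cases hk : ∃ j, k j < 0
  · obtain ⟨j, hj⟩ := hk
    exact sol_neg k hM h j hj
  · push Not at hk
    have := sol_pos (fun l => (k l).toNat) hM h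
    have e : (fun l => ((k l).toNat : ℤ)) = k := by ext l; exact Int.toNat_of_nonneg (hk l)
    rwa [e] at this

theorem enorm_sq_sum_le {ι : Type*} (s : Finset ι) (f : ι → ℂ) (C : ℝ) 
    (h : ∑ k ∈ s, ‖f k‖ ^ 2 ≤ C) : ∑ k ∈ s, ‖f k‖ₑ ^ 2 ≤ ENNReal.ofReal C := by
  have : ∀ k, ‖f k‖ₑ ^ 2 = ENNReal.ofReal (‖f k‖ ^ 2) := fun k => by
    rw [← ofReal_norm, ENNReal.ofReal_pow (norm_nonneg _)]
  simp_rw [this]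
  rw [← ENNReal.ofReal_sum_of_nonneg (fun _ _ => sq_nonneg _)]
  exact ENNReal.ofReal_le_ofReal h

theorem volOm_lt (N : ℕ) : volume (Om N) < ∞ := by
  refine lt_of_le_of_lt (measure_mono ?_) (measure_closedBall_lt_top (x := (0 : XN N)) (r := 1))
  intro z hz
  rw [mem_closedBall_zero_iff, pi_norm_le_iff_of_nonneg zero_le_one]
  intro j
  exact (Finset.single_le_sum (f := fun j => ‖z j‖) (fun _ _ => norm_nonneg _)
      (Finset.mem_univ j)).trans (le_of_lt hz)

theorem bessel1 {N : ℕ} {M : ℝ} (hM : 0 ≤ M) {F : Fin N → XN N → ℂ}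
    (h : Dat N M F) {z : XN N} (hz : z ∈ Om N) (j : Fin N) (s : Finset (Fin N → ℤ)) :
    ∑ k ∈ s, ‖phi F k j z‖ₑ ^ 2 ≤ ENNReal.ofReal (M ^ 2) := by
  refine enorm_sq_sum_le _ _ _ ?_
  have := bessel hM h hz (Pi.single j 1) s
  have e : ∀ k, ∑ i, (Pi.single j (1:ℂ) : Fin N → ℂ) i * phi F k i z = phi F k j z := by
    intro k
    rw [Finset.sum_eq_single j]
    · simp
    · intro i _ hi; simp [hi]
    · simp
  simp_rw [e] at this
  refine this.trans (le_of_eq ?_)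
  have : ∑ i, ‖(Pi.single j (1:ℂ) : Fin N → ℂ) i‖ = 1 := by
    rw [Finset.sum_eq_single j]
    · simp
    · intro i _ hi; simp [hi]
    · simp
  rw [this, mul_one]

theorem phi_meas {N : ℕ} (k : Fin N → ℤ) {M : ℝ} (hM : 0 ≤ M) {F : Fin N → XN N → ℂ}
    (h : Dat N M F) (i : Fin N) : Measurable ((Om N).indicator (phi F k i)) :=
  measurable_ind (isOpen_Om N).measurableSet ((phi_dat k hM h).c1 i).continuousOn

theorem Bk_sum {N : ℕ} (hN : 1 ≤ N) {M : ℝ} (hM : 0 ≤ M) {F : Fin N → XN N → ℂ}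
    (h : Dat N M F) (s : Finset (Fin N → ℤ)) :
    ∑ k ∈ s, Bk (phi F k) ≤ ENNReal.ofReal (16 * N * M ^ 2) * volume (Om N) := by
  have hOm := (isOpen_Om N).measurableSet
  have m1 : ∀ k ∈ s, AEMeasurable (fun z => ∑ j, ‖∑ i, (2 * Vf N j (fun l => ‖z l‖) i : ℂ) *
      phi F k i (fun l => (‖z l‖ : ℂ))‖ₑ ^ 2) (volume.restrict (Om N)) := by
    intro k _
    refine Finset.aemeasurable_fun_sum _ fun j _ => (AEMeasurable.enorm ?_).pow_const 2
    refine Finset.aemeasurable_fun_sum _ fun i _ => AEMeasurable.mul ?_ ?_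
    · have := (measurable_pi_apply i).comp ((measurable_Vf N j).comp (continuous_rho (N := N)).measurable)
      exact ((Complex.measurable_ofReal.comp this).const_mul 2).aemeasurable
    · have h1 : ContinuousOn (fun z : XN N => phi F k i (fun l => (‖z l‖ : ℂ))) (Om N) :=
        ((phi_dat k hM h).c1 i).continuousOn.comp (by fun_prop) (fun z hz => by
          have hz' : ∑ x, ‖z x‖ < 1 := hz; change n1 _ < 1; simpa [n1] using hz')
      exact h1.aemeasurable hOm
  have m2 : ∀ k ∈ s, AEMeasurable (fun z : XN N => ∑ j, 4 * ‖z j‖ₑ ^ 2 * 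
      ∫⁻ t in Icc (0:ℝ) 1, ‖phi F k j (Sj j t z)‖ₑ ^ 2) (volume.restrict (Om N)) := by
    intro k _
    refine Finset.aemeasurable_fun_sum _ fun j _ => AEMeasurable.mul
      (((measurable_pi_apply j).enorm.pow_const 2).const_mul 4).aemeasurable ?_
    have h1 : Measurable (fun p : XN N × ℝ => ‖(Om N).indicator (phi F k j) (Sj j p.2 p.1)‖ₑ ^ 2) := by
      refine ((phi_meas k hM h j).comp ?_).enorm.pow_const 2
      have : Continuous (fun p : XN N × ℝ => Sj j p.2 p.1) := by fun_prop
      exact this.measurable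
    have h2 : Measurable (fun z => ∫⁻ t in Icc (0:ℝ) 1, ‖(Om N).indicator (phi F k j) (Sj j t z)‖ₑ ^ 2) :=
      h1.lintegral_prod_right'
    refine h2.aemeasurable.congr ?_
    refine (ae_restrict_iff' hOm).2 (Filter.Eventually.of_forall fun z hz => ?_)
    refine setLIntegral_congr_fun measurableSet_Icc fun t ht => ?_
    beta_reduce
    rw [indicator_of_mem (Sj_mem j ht hz)]
  unfold Bk
  rw [Finset.sum_add_distrib, ← Finset.mul_sum, ← lintegral_finsetSum' _ m1, ← lintegral_finsetSum' _ m2]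
  have b1 : ∫⁻ z in Om N, ∑ k ∈ s, ∑ j, ‖∑ i, (2 * Vf N j (fun l => ‖z l‖) i : ℂ) *
      phi F k i (fun l => (‖z l‖ : ℂ))‖ₑ ^ 2 ≤ ENNReal.ofReal (16 * N * M ^ 2) * volume (Om N) := by
    rw [← setLIntegral_const]
    refine lintegral_mono_ae ?_
    filter_upwards [Bs_ae N] with z hz
    rw [Finset.sum_comm]
    have hw : (fun l => (‖z l‖ : ℂ)) ∈ Om N := by
      have hz' : ∑ x, ‖z x‖ < 1 := hz.1; change n1 _ < 1; simpa [n1] using hz'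
    have hV := fun j => Vf_bound N j (rho z) (rho_mem hz)
    calc _ ≤ ∑ _j : Fin N, ENNReal.ofReal (16 * M ^ 2) := by
          refine Finset.sum_le_sum fun j _ => ?_
          refine enorm_sq_sum_le _ _ _ ?_
          refine (bessel hM h hw _ s).trans ?_
          have h1 : ∑ i, ‖(2 * Vf N j (fun l => ‖z l‖) i : ℂ)‖ ≤ 4 := by
            have : ∀ i, ‖(2 * Vf N j (fun l => ‖z l‖) i : ℂ)‖ = 2 * |Vf N j (rho z) i| := by
              intro i; rw [norm_mul, Complex.norm_real, Real.norm_eq_abs]; simp; rfl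
            simp_rw [this]
            rw [← Finset.mul_sum]; linarith [hV j]
          have h2 : M * ∑ i, ‖(2 * Vf N j (fun l => ‖z l‖) i : ℂ)‖ ≤ M * 4 :=
            mul_le_mul_of_nonneg_left h1 hM
          calc _ ≤ (M * 4) ^ 2 := pow_le_pow_left₀ (by positivity) h2 2
            _ = _ := by ring
      _ = _ := by
          rw [Finset.sum_const, Finset.card_univ, Fintype.card_fin, nsmul_eq_mul, ← ENNReal.ofReal_natCast,
            ← ENNReal.ofReal_mul (by positivity)]
          congr 1; ring
  have b2 : ∫⁻ z in Om N, ∑ k ∈ s, ∑ j, 4 * ‖z j‖ₑ ^ 2 * 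
      ∫⁻ t in Icc (0:ℝ) 1, ‖phi F k j (Sj j t z)‖ₑ ^ 2 ≤ ENNReal.ofReal (4 * M ^ 2) * volume (Om N) := by
    rw [← setLIntegral_const]
    refine setLIntegral_mono_ae' hOm (Filter.Eventually.of_forall fun z hz => ?_)
    rw [Finset.sum_comm]
    have h1 : ∀ j, ∑ k ∈ s, ∫⁻ t in Icc (0:ℝ) 1, ‖phi F k j (Sj j t z)‖ₑ ^ 2 ≤ ENNReal.ofReal (M ^ 2) := by
      intro j
      rw [← lintegral_finsetSum']
      · calc _ ≤ ∫⁻ t in Icc (0:ℝ) 1, ENNReal.ofReal (M ^ 2) :=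
            setLIntegral_mono_ae' measurableSet_Icc (Filter.Eventually.of_forall fun t ht =>
              bessel1 hM h (Sj_mem j ht hz) j s)
          _ = _ := by simp
      · intro k _
        have hA : ContinuousOn (fun s : ℝ => phi F k j (Sj j s z)) (Icc 0 1) :=
          ((phi_dat k hM h).c1 j).continuousOn.comp (by fun_prop) fun s hs => Sj_mem j hs hz
        exact (hA.aestronglyMeasurable measurableSet_Icc).enorm.pow_const 2
    have h2 : ∑ j, ‖z j‖ ^ 2 ≤ 1 := by
      have h3 : ∀ j, ‖z j‖ ^ 2 ≤ ‖z j‖ := fun j => by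
        have : ‖z j‖ ≤ 1 := (Finset.single_le_sum (f := fun j => ‖z j‖) (fun _ _ => norm_nonneg _)
          (Finset.mem_univ j)).trans (le_of_lt hz)
        nlinarith [norm_nonneg (z j)]
      exact (Finset.sum_le_sum fun j _ => h3 j).trans (le_of_lt hz)
    calc _ ≤ ∑ j, 4 * ‖z j‖ₑ ^ 2 * ENNReal.ofReal (M ^ 2) := by
          refine Finset.sum_le_sum fun j _ => ?_
          rw [← Finset.mul_sum]
          exact mul_le_mul_right (h1 j) _
      _ = 4 * (∑ j, ‖z j‖ₑ ^ 2) * ENNReal.ofReal (M ^ 2) := by rw [Finset.mul_sum, Finset.sum_mul]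
      _ ≤ 4 * 1 * ENNReal.ofReal (M ^ 2) := by
          gcongr
          have := enorm_sq_sum_le Finset.univ z 1 h2
          simpa using this
      _ = _ := by
          rw [ENNReal.ofReal_mul (by norm_num), mul_one]; simp
  calc _ ≤ ENNReal.ofReal (3/4) * (ENNReal.ofReal (16 * N * M ^ 2) * volume (Om N)) +
        ENNReal.ofReal (4 * M ^ 2) * volume (Om N) := by gcongr
    _ = ENNReal.ofReal ((3/4) * (16 * N * M ^ 2) + 4 * M ^ 2) * volume (Om N) := by
        rw [← mul_assoc, ← ENNReal.ofReal_mul (by norm_num), ← add_mul, ← ENNReal.ofReal_add (by positivity) (by positivity)]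
    _ ≤ _ := by
        gcongr
        have : (1:ℝ) ≤ N := by exact_mod_cast hN
        nlinarith [sq_nonneg M]

theorem parseval {N : ℕ} (s : Finset (Fin N → ℤ)) (b : (Fin N → ℤ) → ℂ) :
    ∫⁻ t, ‖∑ k ∈ s, b k * UnitAddTorus.mFourier k t‖ₑ ^ 2 ∂(muT N) = ∑ k ∈ s, ‖b k‖ₑ ^ 2 := by
  let H : C(TN N, ℂ) := ∑ k ∈ s, b k • UnitAddTorus.mFourier k
  have hH : ∀ t, H t = ∑ k ∈ s, b k * UnitAddTorus.mFourier k t := by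
    intro t; simp [H, ContinuousMap.sum_apply]
  have h1 := ContinuousMap.inner_toLp (𝕜 := ℂ) (muT N) H H
  have h2 : H.toLp 2 (muT N) ℂ = ∑ k ∈ s, b k • UnitAddTorus.mFourierLp 2 k := by
    simp only [H, map_sum, map_smul]; rfl
  have h3 := (UnitAddTorus.orthonormal_mFourier (d := Fin N)).inner_sum b b s
  have h4 : ∫ t, ‖H t‖ ^ 2 ∂(muT N) = ∑ k ∈ s, ‖b k‖ ^ 2 := by
    have h5 : ∫ t, H t * (starRingEnd ℂ) (H t) ∂(muT N) = ∑ k ∈ s, (starRingEnd ℂ) (b k) * b k := by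
      rw [← h1, h2]; exact h3
    simp_rw [Complex.mul_conj, mul_comm _ (b _), Complex.mul_conj] at h5
    rw [integral_complex_ofReal] at h5
    simp_rw [Complex.normSq_eq_norm_sq] at h5
    exact_mod_cast h5
  have h6 : ∀ x : ℂ, ‖x‖ₑ ^ 2 = ENNReal.ofReal (‖x‖ ^ 2) := fun x => by
    rw [← ofReal_norm, ENNReal.ofReal_pow (norm_nonneg _)]
  simp_rw [← hH, h6]
  rw [← ofReal_integral_eq_lintegral_ofReal, h4, ENNReal.ofReal_sum_of_nonneg (fun _ _ => sq_nonneg _)]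
  · exact Continuous.integrable_of_hasCompactSupport (by fun_prop) (HasCompactSupport.of_compactSpace _)
  · exact Filter.Eventually.of_forall fun t => sq_nonneg _

theorem rot_mp {N : ℕ} (t : TN N) : MeasurePreserving (rot t : XN N → XN N) volume volume := by
  have h1 : ∀ j, MeasurePreserving (fun x : ℂ => ef (t j) * x) volume volume := by
    intro j
    let c : Circle := ⟨ef (t j), by simp [Submonoid.unitSphere, norm_ef]⟩
    exact (rotation c).measurePreserving
  exact volume_preserving_pi h1

theorem orth {N : ℕ} (s : Finset (Fin N → ℤ)) (u : (Fin N → ℤ) → XN N → ℂ)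
    (hc : ∀ k, ContinuousOn (u k) (Om N))
    (hr : ∀ k t, ∀ z ∈ Om N, u k (rot t z) = UnitAddTorus.mFourier k t * u k z)
    (a : (Fin N → ℤ) → ℂ) (ha : ∀ k ∈ s, ‖a k‖ ≤ 1) :
    ∫⁻ z in Om N, ‖∑ k ∈ s, a k * u k z‖ₑ ^ 2 ≤ ∑ k ∈ s, ∫⁻ z in Om N, ‖u k z‖ₑ ^ 2 := by
  have hOm := (isOpen_Om N).measurableSet
  let v : (Fin N → ℤ) → XN N → ℂ := fun k => (Om N).indicator (u k)
  have hv : ∀ k, Measurable (v k) := fun k => measurable_ind hOm (hc k)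
  have hw : Measurable (fun z => ‖∑ k ∈ s, a k * v k z‖ₑ ^ 2) := by fun_prop
  have hvr : ∀ k t z, v k (rot t z) = UnitAddTorus.mFourier k t * v k z := by
    intro k t z
    by_cases hz : z ∈ Om N
    · simp only [v]; rw [indicator_of_mem hz, indicator_of_mem (rot_mem hz), hr k t z hz]
    · have hz' : rot t z ∉ Om N := by
        intro h; apply hz; change n1 z < 1; rw [← n1_rot t]; exact h
      simp only [v]; rw [indicator_of_notMem hz, indicator_of_notMem hz', mul_zero]
  have e1 : ∫⁻ z in Om N, ‖∑ k ∈ s, a k * u k z‖ₑ ^ 2 = ∫⁻ z, ‖∑ k ∈ s, a k * v k z‖ₑ ^ 2 := by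
    rw [← lintegral_indicator hOm]
    refine lintegral_congr fun z => ?_
    by_cases hz : z ∈ Om N
    · simp only [v, indicator_of_mem hz]
    · simp [v, indicator_of_notMem hz]
  have e2 : ∫⁻ z, ‖∑ k ∈ s, a k * v k z‖ₑ ^ 2 = ∫⁻ z, ∑ k ∈ s, ‖a k * v k z‖ₑ ^ 2 := by
    calc _ = ∫⁻ t, (∫⁻ z, ‖∑ k ∈ s, a k * v k (rot t z)‖ₑ ^ 2) ∂(muT N) := by
          have : ∀ t : TN N, ∫⁻ z, ‖∑ k ∈ s, a k * v k (rot t z)‖ₑ ^ 2 = 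
              ∫⁻ z, ‖∑ k ∈ s, a k * v k z‖ₑ ^ 2 := fun t => (rot_mp t).lintegral_comp hw
          simp_rw [this]; simp
      _ = ∫⁻ t, (∫⁻ z, ‖∑ k ∈ s, (a k * v k z) * UnitAddTorus.mFourier k t‖ₑ ^ 2) ∂(muT N) := by
          simp_rw [hvr]
          refine lintegral_congr fun t => lintegral_congr fun z => ?_
          congr 2
          exact Finset.sum_congr rfl fun k _ => by ring
      _ = ∫⁻ z, ∫⁻ t, ‖∑ k ∈ s, (a k * v k z) * UnitAddTorus.mFourier k t‖ₑ ^ 2 ∂(muT N) := by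
          refine lintegral_lintegral_swap (Measurable.aemeasurable ?_)
          refine (Measurable.enorm (Finset.measurable_sum _ fun k _ => Measurable.mul ?_ ?_)).pow_const 2
          · exact ((hv k).comp measurable_snd).const_mul _
          · exact (UnitAddTorus.mFourier k).continuous.measurable.comp measurable_fst
      _ = _ := by simp_rw [parseval]
  rw [e1, e2, lintegral_finsetSum _ (fun k _ => by fun_prop)]
  refine Finset.sum_le_sum fun k hk => ?_
  rw [← lintegral_indicator hOm]
  refine lintegral_mono fun z => ?_
  by_cases hz : z ∈ Om N
  · rw [indicator_of_mem hz, enorm_mul]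
    simp only [v, indicator_of_mem hz]
    refine pow_le_pow_left' (mul_le_of_le_one_left zero_le ?_) 2
    rw [← ofReal_norm, ← ENNReal.ofReal_one]
    exact ENNReal.ofReal_le_ofReal (ha k hk)
  · simp [v, indicator_of_notMem hz]

section oned
variable {g h : ℂ → ℂ} {S : Set ℂ} (hS : S.Countable) (hg : ContinuousOn g (Metric.closedBall 0 1))
  (hh : ContinuousOn h (Metric.closedBall 0 1))
  (hd : ∀ l ∈ Metric.ball (0:ℂ) 1, l ∉ S → DifferentiableAt ℝ g l ∧ fderiv ℝ g l 1 + Complex.I * fderiv ℝ g l Complex.I = 2 * h l)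

def pe (ρ θ : ℝ) : ℂ := ρ * Complex.exp (θ * Complex.I)
theorem pe_norm (ρ θ : ℝ) : ‖pe ρ θ‖ = |ρ| := by
  simp [pe, Complex.norm_exp_ofReal_mul_I]
@[fun_prop] theorem pe_cont : Continuous (fun p : ℝ × ℝ => pe p.1 p.2) := by unfold pe; fun_prop
theorem pe_exp (τ θ : ℝ) : Complex.exp (τ + θ * Complex.I) = pe (Real.exp τ) θ := by
  rw [Complex.exp_add, pe, Complex.ofReal_exp]

include hS hg hh hd in
theorem rect1 {T : ℝ} (hT : T ≤ 0) :
    (∫ θ in (0:ℝ)..2 * Real.pi, g (pe 1 θ)) - (∫ θ in (0:ℝ)..2 * Real.pi, g (pe (Real.exp T) θ)) =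
    2 * ∫ τ in T..0, (∫ θ in (0:ℝ)..2 * Real.pi, Complex.exp (-(θ * Complex.I)) * h (pe (Real.exp τ) θ)) * Real.exp τ := by
  classical
  let H : ℂ → ℂ := fun ζ => h (Complex.exp ζ) * (starRingEnd ℂ) (Complex.exp ζ)
  let f' : ℂ → ℂ →L[ℝ] ℂ := fun ζ => if Complex.exp ζ ∈ Metric.ball (0:ℂ) 1 ∧ Complex.exp ζ ∉ S then
    fderiv ℝ (fun ζ => g (Complex.exp ζ)) ζ else H ζ • Complex.conjCLE.toContinuousLinearMap
  have hgd : ∀ ζ, Complex.exp ζ ∈ Metric.ball (0:ℂ) 1 ∧ Complex.exp ζ ∉ S → 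
      HasFDerivAt (fun ζ => g (Complex.exp ζ)) ((fderiv ℝ g (Complex.exp ζ)).comp
        ((Complex.exp ζ) • (1 : ℂ →L[ℝ] ℂ))) ζ := by
    intro ζ hζ
    have h1 := (hd _ hζ.1 hζ.2).1.hasFDerivAt
    have h2 := (Complex.hasDerivAt_exp ζ).complexToReal_fderiv
    exact h1.comp ζ h2
  have hlin : ∀ (A : ℂ →L[ℝ] ℂ) (c : ℂ), A c + Complex.I * A (Complex.I * c) = 
      (starRingEnd ℂ) c * (A 1 + Complex.I * A Complex.I) := by
    intro A c
    have e : ∀ x y : ℝ, A (x + y * Complex.I) = x * A 1 + y * A Complex.I := by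
      intro x y
      have e1 : (x + y * Complex.I : ℂ) = x • (1:ℂ) + y • Complex.I := by simp
      rw [e1, map_add, map_smul, map_smul, Complex.real_smul, Complex.real_smul]
    have e2 : Complex.I * c = ((-c.im : ℝ) : ℂ) + (c.re : ℝ) * Complex.I := by
      apply Complex.ext <;> simp
    have e3 : (starRingEnd ℂ) c = c.re - c.im * Complex.I := by
      apply Complex.ext <;> simp
    have e4 := e c.re c.im
    rw [Complex.re_add_im] at e4
    rw [e2, e3, e, e4]
    push_cast
    linear_combination (c.im * A Complex.I) * Complex.I_sq
  have hf' : ∀ ζ, Complex.I • f' ζ 1 - f' ζ Complex.I = 2 * Complex.I * H ζ := by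
    intro ζ
    by_cases hζ : Complex.exp ζ ∈ Metric.ball (0:ℂ) 1 ∧ Complex.exp ζ ∉ S
    · simp only [f', if_pos hζ, (hgd ζ hζ).fderiv]
      have h3 := hlin (fderiv ℝ g (Complex.exp ζ)) (Complex.exp ζ)
      rw [(hd _ hζ.1 hζ.2).2] at h3
      simp [H] at h3 ⊢
      rw [mul_comm (Complex.exp ζ)]
      linear_combination Complex.I * h3 - (fderiv ℝ g (Complex.exp ζ)) (Complex.I * Complex.exp ζ) * Complex.I_sq
    · simp only [f', if_neg hζ]
      simp; ring
  have hb : ∀ ζ : ℂ, ζ.re ≤ 0 → Complex.exp ζ ∈ Metric.closedBall (0:ℂ) 1 := by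
    intro ζ hζ
    rw [mem_closedBall_zero_iff, Complex.norm_exp]; exact Real.exp_le_one_iff.2 hζ
  have hre : ∀ ζ ∈ (uIcc T 0 ×ℂ uIcc (0:ℝ) (2 * Real.pi)), ζ.re ≤ 0 := by
    intro ζ hζ
    have := hζ.1; rw [uIcc_of_le hT] at this; exact this.2
  have hHc : ContinuousOn H (uIcc T 0 ×ℂ uIcc (0:ℝ) (2 * Real.pi)) := by
    refine ContinuousOn.mul (hh.comp (by fun_prop) fun ζ hζ => hb ζ (hre ζ hζ)) (by fun_prop)
  have hR := Complex.integral_boundary_rect_of_hasFDerivAt_real_off_countable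
    (fun ζ => g (Complex.exp ζ)) f' (T : ℂ) ((2 * Real.pi : ℝ) * Complex.I) (Complex.exp ⁻¹' S)
    hS.preimage_cexp (by
      simp only [Complex.ofReal_re, Complex.ofReal_im, Complex.mul_re, Complex.mul_im, Complex.I_re, Complex.I_im]
      simp only [mul_zero, sub_zero, mul_one, add_zero]
      exact hg.comp (by fun_prop) fun ζ hζ => hb ζ (hre ζ hζ)) (by
      intro ζ hζ
      simp only [Complex.ofReal_re, Complex.ofReal_im, Complex.mul_re, Complex.mul_im, Complex.I_re, Complex.I_im] at hζ
      simp only [mul_zero, sub_zero, mul_one, add_zero, min_eq_left hT, max_eq_right hT] at hζ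
      have hz : Complex.exp ζ ∈ Metric.ball (0:ℂ) 1 ∧ Complex.exp ζ ∉ S := by
        refine ⟨?_, hζ.2⟩
        rw [mem_ball_zero_iff, Complex.norm_exp]; exact Real.exp_lt_one_iff.2 hζ.1.1.2
      simp only [f', if_pos hz]
      exact (hgd ζ hz).differentiableAt.hasFDerivAt) (by
      simp only [hf']
      simp only [Complex.ofReal_re, Complex.ofReal_im, Complex.mul_re, Complex.mul_im, Complex.I_re, Complex.I_im]
      simp only [mul_zero, sub_zero, mul_one, add_zero]
      exact ContinuousOn.integrableOn_compact (isCompact_uIcc.reProdIm isCompact_uIcc) (continuousOn_const.mul hHc))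
  simp only [hf', Complex.ofReal_re, Complex.ofReal_im, Complex.mul_re, Complex.mul_im, Complex.I_re, Complex.I_im] at hR
  simp only [mul_zero, sub_zero, mul_one, add_zero] at hR
  have hper : ∀ x : ℝ, Complex.exp (x + ((2 * Real.pi : ℝ) : ℂ) * Complex.I) = Complex.exp (x + ((0:ℝ):ℂ) * Complex.I) := by
    intro x
    rw [Complex.exp_add, Complex.exp_add]; push_cast; rw [Complex.exp_two_pi_mul_I]; simp
  simp only [hper, sub_self, zero_add, pe_exp, Real.exp_zero, smul_eq_mul] at hR
  have hH : ∀ x y : ℝ, 2 * Complex.I * H (x + y * Complex.I) =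
      2 * Complex.I * Real.exp x * (Complex.exp (-(y * Complex.I)) * h (pe (Real.exp x) y)) := by
    intro x y
    simp only [H, pe_exp]
    have : (starRingEnd ℂ) (pe (Real.exp x) y) = Real.exp x * Complex.exp (-(y * Complex.I)) := by
      simp [pe, ← Complex.exp_conj]
    rw [this]; ring
  simp only [hH, intervalIntegral.integral_const_mul] at hR
  have h5 : ∀ x : ℝ, 2 * Complex.I * Real.exp x * (∫ y in (0:ℝ)..2 * Real.pi, Complex.exp (-(y * Complex.I)) * h (pe (Real.exp x) y))
    = 2 * Complex.I * ((∫ y in (0:ℝ)..2 * Real.pi, Complex.exp (-(y * Complex.I)) * h (pe (Real.exp x) y)) * Real.exp x) := by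
    intro x; ring
  simp only [h5, intervalIntegral.integral_const_mul] at hR
  apply mul_left_cancel₀ Complex.I_ne_zero
  linear_combination hR


include hS hg hh hd in
theorem MF1 : IntervalIntegrable (fun ρ : ℝ => ∫ θ in (0:ℝ)..2 * Real.pi, Complex.exp (-(θ * Complex.I)) * h (pe ρ θ)) volume 0 1 ∧
    (∫ θ in (0:ℝ)..2 * Real.pi, g (pe 1 θ)) - 2 * Real.pi * g 0 =
    2 * ∫ ρ in (0:ℝ)..1, (∫ θ in (0:ℝ)..2 * Real.pi, Complex.exp (-(θ * Complex.I)) * h (pe ρ θ)) := by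
  have hpi : (0:ℝ) ≤ 2 * Real.pi := by positivity
  let P : ℝ → ℝ := fun ρ => max 0 (min ρ 1)
  have hP : Continuous P := by fun_prop
  have hP1 : ∀ ρ ∈ Icc (0:ℝ) 1, P ρ = ρ := by
    intro ρ hρ; simp [P, hρ.1, hρ.2]
  have hmem : ∀ ρ, ∀ θ, pe (P ρ) θ ∈ Metric.closedBall (0:ℂ) 1 := by
    intro ρ θ
    have : 0 ≤ P ρ ∧ P ρ ≤ 1 := by simp [P]
    rw [mem_closedBall_zero_iff, pe_norm, abs_of_nonneg this.1]; exact this.2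
  have hpc : Continuous (fun p : ℝ × ℝ => pe (P p.1) p.2) :=
    pe_cont.comp (f := fun p : ℝ × ℝ => (P p.1, p.2)) (by fun_prop)
  let K : ℝ → ℂ := fun ρ => ∫ θ in (0:ℝ)..2 * Real.pi, g (pe (P ρ) θ)
  let J : ℝ → ℂ := fun ρ => ∫ θ in (0:ℝ)..2 * Real.pi, Complex.exp (-(θ * Complex.I)) * h (pe (P ρ) θ)
  have hK : Continuous K := by
    apply intervalIntegral.continuous_parametric_intervalIntegral_of_continuous'
    exact hg.comp_continuous hpc fun p => hmem _ _
  have hJ : Continuous J := by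
    apply intervalIntegral.continuous_parametric_intervalIntegral_of_continuous'
    have := hh.comp_continuous hpc fun p => hmem _ _
    exact Continuous.mul (by fun_prop) this
  have key : ∀ ε ∈ Ioc (0:ℝ) 1, K 1 - K ε = 2 * ∫ ρ in ε..1, J ρ := by
    intro ε hε
    have h1 := rect1 hS hg hh hd (Real.log_nonpos hε.1.le hε.2)
    have h2 := intervalIntegral.integral_deriv_smul_comp (a := Real.log ε) (b := 0) (f := Real.exp) (f' := Real.exp)
      (g := J)
      (fun x _ => Real.hasDerivAt_exp x) Real.continuous_exp.continuousOn hJ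
    rw [Real.exp_log hε.1, Real.exp_zero] at h2
    rw [Real.exp_log hε.1] at h1
    have e1 : K 1 = ∫ θ in (0:ℝ)..2 * Real.pi, g (pe 1 θ) := by simp [K, hP1]
    have e2 : K ε = ∫ θ in (0:ℝ)..2 * Real.pi, g (pe ε θ) := by simp only [K, hP1 ε ⟨hε.1.le, hε.2⟩]
    rw [e1, e2, h1, ← h2]
    congr 1
    apply intervalIntegral.integral_congr
    intro τ hτ
    rw [uIcc_of_le (Real.log_nonpos hε.1.le hε.2)] at hτ
    simp only [J, Function.comp, hP1 _ ⟨(Real.exp_pos τ).le, Real.exp_le_one_iff.2 hτ.2⟩, Complex.real_smul]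
    ring
  have lim1 : Filter.Tendsto (fun ε => K 1 - K ε) (nhdsWithin 0 (Ioi 0)) (nhds (K 1 - K 0)) :=
    ((continuous_const.sub hK).tendsto 0).mono_left nhdsWithin_le_nhds
  have lim2 : Filter.Tendsto (fun ε => 2 * ∫ ρ in ε..1, J ρ) (nhdsWithin 0 (Ioi 0)) (nhds (2 * ∫ ρ in (0:ℝ)..1, J ρ)) := by
    have : Continuous (fun ε => 2 * ∫ ρ in ε..1, J ρ) := by
      have h3 := intervalIntegral.continuous_primitive (μ := volume) (fun a b => hJ.intervalIntegrable a b) 1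
      have h7 : (fun ε => 2 * ∫ ρ in ε..1, J ρ) = fun ε => 2 * -∫ ρ in (1:ℝ)..ε, J ρ := by
        funext ε; rw [intervalIntegral.integral_symm]
      rw [h7]
      exact continuous_const.mul h3.neg
    exact (this.tendsto 0).mono_left nhdsWithin_le_nhds
  have h4 := tendsto_nhds_unique (lim1.congr' (by
    filter_upwards [Ioc_mem_nhdsGT (zero_lt_one (α := ℝ))] with ε hε using key ε hε)) lim2
  have h5 : K 1 = ∫ θ in (0:ℝ)..2 * Real.pi, g (pe 1 θ) := by simp [K, hP1]
  have h6 : K 0 = 2 * Real.pi * g 0 := by simp [K, hP1, pe]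
  rw [h5, h6] at h4
  constructor
  · refine (hJ.intervalIntegrable 0 1).congr fun ρ hρ => ?_
    rw [uIoc_of_le zero_le_one] at hρ
    simp only [J, hP1 ρ ⟨hρ.1.le, hρ.2⟩]
  rw [h4]
  congr 1
  apply intervalIntegral.integral_congr
  intro ρ hρ
  rw [uIcc_of_le zero_le_one] at hρ
  simp only [J, hP1 ρ hρ]
end oned

def Ks (N : ℕ) (s : ℝ) : Set (XN N) := {w | n1 w ≤ s}
theorem n1_add {N : ℕ} (z w : XN N) : n1 (z + w) ≤ n1 z + n1 w := by
  unfold n1; rw [← Finset.sum_add_distrib]; exact Finset.sum_le_sum fun j _ => norm_add_le _ _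
theorem n1_smulc {N : ℕ} (a : ℂ) (w : XN N) : n1 (a • w) = ‖a‖ * n1 w := by
  simp [n1, Finset.mul_sum]
theorem n1_smulr {N : ℕ} (a : ℝ) (w : XN N) : n1 (a • w) = |a| * n1 w := by
  simp [n1, Finset.mul_sum]
theorem n1_nonneg {N : ℕ} (w : XN N) : 0 ≤ n1 w := Finset.sum_nonneg fun j _ => norm_nonneg _
theorem le_n1 {N : ℕ} (w : XN N) (j : Fin N) : ‖w j‖ ≤ n1 w :=
  Finset.single_le_sum (f := fun j => ‖w j‖) (fun i _ => norm_nonneg _) (Finset.mem_univ j)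
theorem isCompact_Ks (N : ℕ) (s : ℝ) : IsCompact (Ks N s) := by
  refine Metric.isCompact_of_isClosed_isBounded (isClosed_le continuous_n1 continuous_const) ?_
  refine (Metric.isBounded_closedBall (x := (0 : XN N)) (r := max s 0)).subset fun w hw => ?_
  rw [mem_closedBall_zero_iff, pi_norm_le_iff_of_nonneg (le_max_right _ _)]
  intro j
  exact ((le_n1 w j).trans hw).trans (le_max_left _ _)
theorem Ks_meas (N : ℕ) (s : ℝ) : MeasurableSet (Ks N s) := (isCompact_Ks N s).measurableSet
theorem Ks_add {N : ℕ} {s : ℝ} {z w : XN N} (h : n1 z + s < 1) (hw : w ∈ Ks N s) {l : ℂ} (hl : ‖l‖ ≤ 1) :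
    z + l • w ∈ Om N := by
  have h1 := n1_add z (l • w)
  rw [n1_smulc] at h1
  have h2 : ‖l‖ * n1 w ≤ 1 * n1 w := mul_le_mul_of_nonneg_right hl (n1_nonneg w)
  have h3 : n1 w ≤ s := hw
  show n1 _ < 1
  linarith

/-- one-dimensional data -/
structure PreSol {N : ℕ} (G : Fin N → XN N → ℂ) (u : XN N → ℂ) : Prop where
  cont : ContinuousOn u (Om N)
  diff : ∀ z ∈ Bs N, DifferentiableAt ℝ u z
  dbar : ∀ z ∈ Bs N, ∀ i, dbar u z (Pi.single i 1) = G i z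
  gc : ∀ i, ContinuousOn (G i) (Om N)

def Phi {N : ℕ} (G : Fin N → XN N → ℂ) (z w : XN N) (ρ : ℝ) : ℂ :=
  ∑ j, (starRingEnd ℂ) (w j) * G j (z + ρ • w)

theorem MFw {N : ℕ} {G : Fin N → XN N → ℂ} {u : XN N → ℂ} (h : PreSol G u) {s : ℝ} {z : XN N}
    (hs : n1 z + s < 1) {w : XN N} (hw : w ∈ Ks N s) (hw0 : ∀ j, w j ≠ 0) :
    (2 * Real.pi) * u z = ∫ ρ in (0:ℝ)..1, ∫ θ in (0:ℝ)..2 * Real.pi, (u (z + pe 1 θ • w) -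
      2 * Phi G z (pe 1 θ • w) ρ) := by
  have hlin : Continuous fun l : ℂ => z + l • w := by fun_prop
  have hmap : ∀ l ∈ Metric.closedBall (0:ℂ) 1, z + l • w ∈ Om N := fun l hl =>
    Ks_add hs hw (by simpa using hl)
  have hgc : ContinuousOn (fun l : ℂ => u (z + l • w)) (Metric.closedBall 0 1) :=
    h.cont.comp hlin.continuousOn hmap
  have hhc : ContinuousOn (fun l : ℂ => ∑ j, (starRingEnd ℂ) (w j) * G j (z + l • w)) (Metric.closedBall 0 1) :=
    continuousOn_finsetSum _ fun j _ => continuousOn_const.mul ((h.gc j).comp hlin.continuousOn hmap)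
  have h1 := MF1 (g := fun l : ℂ => u (z + l • w)) (h := fun l => ∑ j, (starRingEnd ℂ) (w j) * G j (z + l • w))
    (S := ⋃ j, {- z j / w j}) (countable_iUnion fun j => countable_singleton _) hgc hhc (by
      intro l hl hlS
      have hB : z + l • w ∈ Bs N := by
        refine ⟨hmap l (Metric.ball_subset_closedBall hl), fun j hj => hlS ?_⟩
        simp only [mem_iUnion, mem_singleton_iff]
        refine ⟨j, ?_⟩
        rw [eq_div_iff (hw0 j)]
        simp at hj
        linear_combination hj
      have hd := h.diff _ hB
      have hl' : HasFDerivAt (fun l : ℂ => z + l • w) ((ContinuousLinearMap.id ℝ ℂ).smulRight w) l := by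
        exact (((ContinuousLinearMap.id ℝ ℂ).smulRight w).hasFDerivAt).const_add z
      have hc := hd.hasFDerivAt.comp l hl'
      refine ⟨hc.differentiableAt, ?_⟩
      have e := hc.fderiv
      simp only [Function.comp_def] at e
      rw [e]
      have e2 := dbar_basis u (z + l • w) w
      simp only [h.dbar _ hB] at e2
      rw [← e2, dbar]
      simp; ring)
  simp only [zero_smul, add_zero] at h1
  have hP : ∀ ρ θ : ℝ, Phi G z (pe 1 θ • w) ρ = Complex.exp (-(θ * Complex.I)) * ∑ j, (starRingEnd ℂ) (w j) * G j (z + pe ρ θ • w) := by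
    intro ρ θ
    rw [Phi, Finset.mul_sum]
    refine Finset.sum_congr rfl fun j _ => ?_
    have e1 : ρ • pe 1 θ • w = pe ρ θ • w := by
      rw [← smul_assoc]; congr 1; simp [pe]
    have e2 : (starRingEnd ℂ) (pe 1 θ) = Complex.exp (-(θ * Complex.I)) := by
      simp [pe, ← Complex.exp_conj]
    rw [e1, Pi.smul_apply, smul_eq_mul, map_mul, e2]; ring
  simp_rw [hP]
  have hpm : ∀ ρ ∈ Icc (0:ℝ) 1, ∀ θ, pe ρ θ ∈ Metric.closedBall (0:ℂ) 1 := by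
    intro ρ hρ θ
    rw [mem_closedBall_zero_iff, pe_norm, abs_of_nonneg hρ.1]; exact hρ.2
  have hpc : ∀ ρ, Continuous (pe ρ) := fun ρ => pe_cont.comp (f := fun θ => (ρ, θ)) (by fun_prop)
  have h2 : ∀ ρ ∈ uIcc (0:ℝ) 1, (∫ θ in (0:ℝ)..2 * Real.pi, (u (z + pe 1 θ • w) -
      2 * (Complex.exp (-(θ * Complex.I)) * ∑ j, (starRingEnd ℂ) (w j) * G j (z + pe ρ θ • w)))) =
      (∫ θ in (0:ℝ)..2 * Real.pi, u (z + pe 1 θ • w)) - 2 * ∫ θ in (0:ℝ)..2 * Real.pi,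
        Complex.exp (-(θ * Complex.I)) * ∑ j, (starRingEnd ℂ) (w j) * G j (z + pe ρ θ • w) := by
    intro ρ hρ
    rw [uIcc_of_le zero_le_one] at hρ
    rw [intervalIntegral.integral_sub, intervalIntegral.integral_const_mul]
    · exact (hgc.comp_continuous (hpc 1) (hpm 1 (by simp))).intervalIntegrable _ _
    · have := hhc.comp_continuous (hpc ρ) (hpm ρ hρ)
      refine Continuous.intervalIntegrable (continuous_const.mul (Continuous.mul (by fun_prop) this)) _ _
  rw [intervalIntegral.integral_congr h2, intervalIntegral.integral_sub (by simp) (h1.1.const_mul 2),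
    intervalIntegral.integral_const_mul, intervalIntegral.integral_const]
  have h3 := h1.2
  simp only [sub_zero, one_smul]
  linear_combination -h3

theorem MF {N : ℕ} {G : Fin N → XN N → ℂ} {u : XN N → ℂ} (h : PreSol G u) {s : ℝ} {z : XN N}
    (hs : n1 z + s < 1) (c : XN N → ℂ) (hc : Continuous c) (hcr : ∀ t w, c (rot t w) = c w) :
    (∫ w in Ks N s, c w) * u z = ∫ a in Ks N s ×ˢ Icc (0:ℝ) 1, c a.1 * (u (z + a.1) - 2 * Phi G z a.1 a.2) := by
  have hK := isCompact_Ks N s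
  set A : XN N × ℝ → ℂ := fun a => c a.1 * (u (z + a.1) - 2 * Phi G z a.1 a.2) with hA
  have hAc : ContinuousOn A (Ks N s ×ˢ Icc (0:ℝ) 1) := by
    refine (hc.comp continuous_fst).continuousOn.mul (ContinuousOn.sub ?_ (continuousOn_const.mul ?_))
    · refine h.cont.comp (by fun_prop) fun a ha => ?_
      simpa using Ks_add hs ha.1 (l := 1) (by simp)
    · refine continuousOn_finsetSum _ fun j _ => ContinuousOn.mul (by fun_prop) ?_
      refine (h.gc j).comp (by fun_prop) fun a ha => ?_
      have := Ks_add hs ha.1 (l := (a.2 : ℂ)) (by simpa [abs_of_nonneg ha.2.1] using ha.2.2)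
      simpa using this
  have hpi : (0:ℝ) ≤ 2 * Real.pi := by positivity
  let τ : ℝ → TN N := fun θ _ => ((θ / (2 * Real.pi) : ℝ) : UnitAddCircle)
  have hτ : ∀ θ w, rot (τ θ) w = pe 1 θ • w := by
    intro θ w; ext j
    rw [rot_apply, ef_coe, pe, Pi.smul_apply, smul_eq_mul]
    congr 1
    simp only [Complex.ofReal_one, one_mul]
    congr 1
    have : (Real.pi : ℂ) ≠ 0 := by exact_mod_cast Real.pi_ne_zero
    push_cast
    field_simp
  have hpK : ∀ θ, ∀ w ∈ Ks N s, pe 1 θ • w ∈ Ks N s := by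
    intro θ w hw
    show n1 _ ≤ s
    have hw' : n1 w ≤ s := hw
    rw [n1_smulc, pe_norm]; simpa using hw'
  let B : XN N → ℝ × ℝ → ℂ := fun w p => A (pe 1 p.2 • w, p.1)
  have hBc : ContinuousOn (Function.uncurry B) (Ks N s ×ˢ (Icc (0:ℝ) 1 ×ˢ Icc 0 (2 * Real.pi))) := by
    refine hAc.comp ?_ fun a ha => ⟨hpK _ _ ha.1, ha.2.1⟩
    have : Continuous (fun a : XN N × ℝ × ℝ => pe 1 a.2.2) := pe_cont.comp (f := fun a : XN N × ℝ × ℝ => (1, a.2.2)) (by fun_prop)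
    fun_prop
  have hBi : Integrable (Function.uncurry B) ((volume.restrict (Ks N s)).prod (volume.restrict (Icc (0:ℝ) 1 ×ˢ Icc 0 (2 * Real.pi)))) := by
    rw [Measure.prod_restrict]
    exact hBc.integrableOn_compact (hK.prod (isCompact_Icc.prod isCompact_Icc))
  have hsw := integral_integral_swap hBi
  have hL : ∀ᵐ w ∂(volume.restrict (Ks N s)), (∫ p in Icc (0:ℝ) 1 ×ˢ Icc 0 (2 * Real.pi), B w p) = 2 * Real.pi * u z * c w := by
    have hsub : Ks N s ⊆ Om N := fun w hw => by
      have h1 : n1 w ≤ s := hw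
      have := n1_nonneg z
      show n1 w < 1
      linarith
    filter_upwards [ae_restrict_of_ae_restrict_of_subset hsub (Bs_ae N), ae_restrict_mem (Ks_meas N s)] with w hw0 hw
    have h1 := MFw h hs hw hw0.2
    rw [Measure.volume_eq_prod, setIntegral_prod]
    · rw [h1, integral_Icc_eq_integral_Ioc, ← intervalIntegral.integral_of_le zero_le_one,
        ← intervalIntegral.integral_mul_const]
      refine intervalIntegral.integral_congr fun ρ _ => ?_
      rw [integral_Icc_eq_integral_Ioc, ← intervalIntegral.integral_of_le hpi, ← intervalIntegral.integral_mul_const]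
      refine intervalIntegral.integral_congr fun θ _ => ?_
      have : c (pe 1 θ • w) = c w := by rw [← hτ, hcr]
      simp only [B, hA, this]; ring
    · refine ContinuousOn.integrableOn_compact (isCompact_Icc.prod isCompact_Icc) ?_
      exact hBc.comp (f := fun p => (w, p)) (by fun_prop) fun p hp => ⟨hw, hp⟩
  have hR : ∀ p : ℝ × ℝ, (∫ w in Ks N s, B w p) = ∫ w in Ks N s, A (w, p.1) := by
    intro p
    have hpre : (rot (τ p.2) : XN N → XN N) ⁻¹' (Ks N s) = Ks N s := by
      ext w; simp [Ks, n1_rot]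
    have he : MeasurableEmbedding (rot (τ p.2) : XN N → XN N) := by
      refine (rot (τ p.2)).continuous.measurableEmbedding fun x y hxy => ?_
      have := congrArg (rot (- τ p.2)) hxy
      rw [← rot_add, ← rot_add] at this
      simpa [funext_iff, rot_apply, ef_zero] using this
    have := (rot_mp (τ p.2)).setIntegral_preimage_emb he (fun w => A (w, p.1)) (Ks N s)
    rw [hpre] at this
    rw [← this]
    simp only [B, hτ]
  rw [integral_congr_ae hL, integral_const_mul] at hsw
  simp only [hR] at hsw
  rw [Measure.volume_eq_prod, ← Measure.prod_restrict, integral_fun_fst (fun ρ => ∫ w in Ks N s, A (w, ρ))] at hsw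
  have hAi : Integrable A ((volume.restrict (Ks N s)).prod (volume.restrict (Icc (0:ℝ) 1))) := by
    rw [Measure.prod_restrict]
    exact hAc.integrableOn_compact (hK.prod isCompact_Icc)
  rw [Measure.volume_eq_prod, ← Measure.prod_restrict, integral_prod_symm _ hAi]
  have h2 : (2 * Real.pi : ℂ) ≠ 0 := by
    have : (Real.pi : ℂ) ≠ 0 := by exact_mod_cast Real.pi_ne_zero
    simp [this]
  apply mul_left_cancel₀ h2
  have h3 : ((volume.restrict (Icc (0:ℝ) (2 * Real.pi))).real univ) = 2 * Real.pi := by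
    simp [Measure.real, Real.pi_pos.le]
  rw [h3, Complex.real_smul] at hsw
  push_cast at hsw
  linear_combination hsw

theorem mF_coeff {N : ℕ} (b : (Fin N → ℤ) →₀ ℂ) (k : Fin N → ℤ) :
    ∫ t, (b.sum fun p a => a • UnitAddTorus.mFourier p : C(TN N, ℂ)) t * UnitAddTorus.mFourier (-k) t ∂(muT N) = b k := by
  set H : C(TN N, ℂ) := b.sum fun p a => a • UnitAddTorus.mFourier p with hHd
  have h1 := ContinuousMap.inner_toLp (𝕜 := ℂ) (muT N) (UnitAddTorus.mFourier k) H
  have h2 : H.toLp 2 (muT N) ℂ = ∑ p ∈ b.support, b p • UnitAddTorus.mFourierLp 2 p := by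
    simp only [hHd, Finsupp.sum, map_sum, map_smul]; rfl
  have h3 := (UnitAddTorus.orthonormal_mFourier (d := Fin N)).inner_right_finsupp b k
  simp only [UnitAddTorus.mFourier_neg]
  rw [← h1, h2]; exact h3

def pk (N : ℕ) (t : TN N) : ℝ := ∏ j, ‖1 + ef (t j)‖ ^ 2 / 4
theorem continuous_pk (N : ℕ) : Continuous (pk N) := by unfold pk; fun_prop
theorem pk_nonneg {N : ℕ} (t : TN N) : 0 ≤ pk N t := Finset.prod_nonneg fun _ _ => by positivity
theorem pk_zero (N : ℕ) : pk N 0 = 1 := by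
  unfold pk; refine Finset.prod_eq_one fun j _ => ?_
  simp only [Pi.zero_apply, ef_zero]; norm_num
theorem pk_le (t : UnitAddCircle) : ‖1 + ef t‖ ^ 2 / 4 ≤ 1 := by
  have := norm_add_le (1:ℂ) (ef t)
  rw [norm_ef, norm_one] at this
  nlinarith [norm_nonneg (1 + ef t)]
theorem pk_lt {t : UnitAddCircle} (ht : t ≠ 0) : ‖1 + ef t‖ ^ 2 / 4 < 1 := by
  have h0 : ef t ≠ 1 := by
    intro h
    apply ht
    unfold ef at h
    rw [fourier_apply, one_smul] at h
    have : AddCircle.toCircle t = AddCircle.toCircle (0 : UnitAddCircle) := by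
      apply Circle.ext; rw [h]; simp
    exact AddCircle.injective_toCircle one_ne_zero this
  have h1 : ‖ef t‖ ^ 2 = 1 := by rw [norm_ef]; norm_num
  rw [Complex.sq_norm, Complex.normSq_apply] at h1 ⊢
  simp only [Complex.add_re, Complex.add_im, Complex.one_re, Complex.one_im, zero_add]
  have h2 : (ef t).re ≠ 1 := by
    intro h; apply h0; apply Complex.ext
    · simpa using h
    · rw [h] at h1; simp; nlinarith
  have h3 : (ef t).re ≤ 1 := by nlinarith [mul_self_nonneg (ef t).im]
  have h4 := lt_of_le_of_ne h3 h2
  nlinarith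

def pkC (N : ℕ) : C(TN N, ℂ) := ⟨fun t => pk N t, by have := continuous_pk N; fun_prop⟩
theorem pkC_mem (N : ℕ) : pkC N ∈ UnitAddTorus.mFourierSubalgebra (Fin N) := by
  have hm : ∀ k, UnitAddTorus.mFourier k ∈ UnitAddTorus.mFourierSubalgebra (Fin N) := by
    intro k
    have := UnitAddTorus.mFourierSubalgebra_coe (d := Fin N)
    have h2 : UnitAddTorus.mFourier k ∈ Submodule.span ℂ (range (UnitAddTorus.mFourier (d := Fin N))) :=
      Submodule.subset_span ⟨k, rfl⟩
    rw [← this] at h2; exact h2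
  have e : pkC N = ∏ j, (4⁻¹ : ℂ) • ((1 + UnitAddTorus.mFourier (Pi.single j 1)) * star (1 + UnitAddTorus.mFourier (Pi.single j 1))) := by
    ext t
    simp only [pkC, ContinuousMap.coe_mk, pk, ContinuousMap.prod_apply, Complex.ofReal_prod]
    refine Finset.prod_congr rfl fun j _ => ?_
    have : UnitAddTorus.mFourier (Pi.single j 1) t = ef (t j) := by
      rw [UnitAddTorus.mFourier_single]; rfl
    simp only [ContinuousMap.smul_apply, ContinuousMap.mul_apply, ContinuousMap.star_apply, ContinuousMap.add_apply, ContinuousMap.one_apply, this, smul_eq_mul]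
    have h2 := Complex.mul_conj (1 + ef (t j))
    rw [Complex.normSq_eq_norm_sq] at h2
    rw [show star (1 + ef (t j)) = (starRingEnd ℂ) (1 + ef (t j)) from rfl, h2]
    push_cast; ring
  rw [e]
  refine prod_mem fun j _ => ?_
  have h1 : (1 + UnitAddTorus.mFourier (Pi.single j 1)) ∈ UnitAddTorus.mFourierSubalgebra (Fin N) := add_mem (one_mem _) (hm _)
  exact SMulMemClass.smul_mem _ (mul_mem h1 (star_mem h1))

structure Ker {N : ℕ} (κ : ℕ → C(TN N, ℂ)) (s : ℕ → Finset (Fin N → ℤ)) (a : ℕ → (Fin N → ℤ) → ℂ) : Prop where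
  nrm : ∀ n, ∫ t, ‖κ n t‖ ∂(muT N) ≤ 1
  lim : ∀ f : TN N → ℂ, Continuous f → Filter.Tendsto (fun n => ∫ t, κ n t * f t ∂(muT N)) Filter.atTop (nhds (f 0))
  sum : ∀ n t, κ n t = ∑ k ∈ s n, a n k * UnitAddTorus.mFourier (-k) t
  out : ∀ n k, k ∉ s n → a n k = 0
  bd : ∀ n k, ‖a n k‖ ≤ 1
  one : ∀ k, Filter.Tendsto (fun n => a n k) Filter.atTop (nhds 1)

theorem ker_ex (N : ℕ) : ∃ κ s a, Ker (N := N) κ s a := by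
  classical
  let I : ℕ → ℝ := fun n => ∫ t, pk N t ^ n ∂(muT N)
  let κ : ℕ → C(TN N, ℂ) := fun n => ((I n : ℂ)⁻¹) • (pkC N) ^ n
  have hκ : ∀ n t, κ n t = (((I n)⁻¹ * pk N t ^ n : ℝ) : ℂ) := by
    intro n t; simp [κ, pkC]
  have hI : ∀ n, 0 ≤ I n := fun n => integral_nonneg fun t => pow_nonneg (pk_nonneg t) n
  have hnrm : ∀ n, ∫ t, ‖κ n t‖ ∂(muT N) ≤ 1 := by
    intro n
    have : ∀ t, ‖κ n t‖ = (I n)⁻¹ * pk N t ^ n := by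
      intro t; rw [hκ, Complex.norm_real, Real.norm_of_nonneg]
      exact mul_nonneg (inv_nonneg.2 (hI n)) (pow_nonneg (pk_nonneg t) n)
    simp_rw [this]
    rw [integral_const_mul]
    exact inv_mul_le_one
  have hlim : ∀ f : TN N → ℂ, Continuous f → Filter.Tendsto (fun n => ∫ t, κ n t * f t ∂(muT N)) Filter.atTop (nhds (f 0)) := by
    intro f hf
    have := tendsto_setIntegral_pow_smul_of_unique_maximum_of_isCompact_of_continuousOn (μ := muT N) (s := univ)
      (x₀ := (0 : TN N)) (c := pk N) (g := f) isCompact_univ (continuous_pk N).continuousOn (by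
        intro t _ ht
        rw [pk_zero]
        obtain ⟨j, hj⟩ : ∃ j, t j ≠ 0 := by
          by_contra hcon; push Not at hcon; exact ht (funext hcon)
        unfold pk
        rw [← Finset.mul_prod_erase _ _ (Finset.mem_univ j)]
        have h1 : ∏ x ∈ Finset.univ.erase j, ‖1 + ef (t x)‖ ^ 2 / 4 ≤ 1 :=
          Finset.prod_le_one (fun _ _ => by positivity) fun i _ => pk_le _
        have h2 := pk_lt hj
        have h3 : 0 ≤ ‖1 + ef (t j)‖ ^ 2 / 4 := by positivity
        nlinarith) (fun t _ => pk_nonneg t) (by rw [pk_zero]; norm_num) (by simp) hf.continuousOn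
    simp only [Measure.restrict_univ] at this
    refine this.congr fun n => ?_
    rw [← integral_smul]
    refine integral_congr_ae (Filter.Eventually.of_forall fun t => ?_)
    simp only [hκ, Complex.real_smul]; push_cast; ring
  have hspan : ∀ n, ∃ b : (Fin N → ℤ) →₀ ℂ, (b.sum fun p a => a • UnitAddTorus.mFourier p) = κ n := by
    intro n
    rw [← Finsupp.mem_span_range_iff_exists_finsupp, ← UnitAddTorus.mFourierSubalgebra_coe]
    exact SMulMemClass.smul_mem (s := UnitAddTorus.mFourierSubalgebra (Fin N)) _ (pow_mem (pkC_mem N) n)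
  choose b hb using hspan
  have hco : ∀ n k, ∫ t, κ n t * UnitAddTorus.mFourier k t ∂(muT N) = b n (-k) := by
    intro n k
    have := mF_coeff (b n) (-k)
    rwa [hb, neg_neg] at this
  refine ⟨κ, fun n => (b n).support.map (Equiv.neg _).toEmbedding, fun n k => b n (-k), hnrm, hlim, ?_, ?_, ?_, ?_⟩
  · intro n t
    rw [Finset.sum_map]
    have := congrArg (fun f : C(TN N, ℂ) => f t) (hb n)
    simp only [Finsupp.sum, ContinuousMap.sum_apply] at this
    rw [← this]
    simp
  · intro n k hk
    by_contra hne
    apply hk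
    rw [Finset.mem_map]
    exact ⟨-k, Finsupp.mem_support_iff.2 hne, by simp⟩
  · intro n k
    rw [← hco]
    refine (norm_integral_le_integral_norm _).trans ?_
    simp only [norm_mul, mF_norm, mul_one]
    exact hnrm n
  · intro k
    have := hlim (UnitAddTorus.mFourier k) (ContinuousMap.continuous _)
    simp only [hco] at this
    have e : UnitAddTorus.mFourier k (0 : TN N) = 1 := by simp [UnitAddTorus.mFourier]
    rwa [e] at this

theorem Ks_add1 {N : ℕ} {s : ℝ} {z w : XN N} (h : n1 z + s < 1) (hw : w ∈ Ks N s) : z + w ∈ Om N := by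
  simpa using Ks_add h hw (l := 1) (by simp)

theorem shift_cont {N : ℕ} {g : XN N → ℂ} (hg : ContinuousOn g (Om N)) {s : ℝ} {z : XN N}
    (hs : n1 z + s < 1) : ContinuousOn (fun w => g (z + w)) (Ks N s) :=
  hg.comp (by fun_prop) fun _ hw => Ks_add1 hs hw
theorem shift_int {N : ℕ} {g : XN N → ℂ} (hg : ContinuousOn g (Om N)) {s : ℝ} {z : XN N}
    (hs : n1 z + s < 1) : IntegrableOn (fun w => g (z + w)) (Ks N s) :=
  (shift_cont hg hs).integrableOn_compact (isCompact_Ks N s)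

theorem L12 {N : ℕ} {g : XN N → ℂ} (hg : ContinuousOn g (Om N)) {s : ℝ} {z : XN N}
    (hs : n1 z + s < 1) {C : ℝ≥0∞} (hC : C ≠ ∞) (hl : ∫⁻ w in Om N, ‖g w‖ₑ ^ 2 ≤ C) :
    ∫ w in Ks N s, ‖g (z + w)‖ ≤ Real.sqrt (volume.real (Ks N s) * C.toReal) := by
  have h1 : (∫⁻ w in Ks N s, ‖g (z + w)‖ₑ) ^ 2 ≤ volume (Ks N s) * C := by
    have := lintegral_CS (volume.restrict (Ks N s)) (fun w => ‖g (z + w)‖ₑ)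
      (shift_int hg hs).aestronglyMeasurable.enorm
    refine this.trans ?_
    rw [Measure.restrict_apply_univ]
    refine mul_le_mul_right (le_trans ?_ hl) _
    rw [← lintegral_indicator (isOpen_Om N).measurableSet, ← lintegral_indicator (Ks_meas N s),
      ← lintegral_add_left_eq_self ((Om N).indicator _) z]
    refine lintegral_mono fun w => ?_
    by_cases hw : w ∈ Ks N s
    · rw [indicator_of_mem hw, indicator_of_mem (Ks_add1 hs hw)]
    · rw [indicator_of_notMem hw]; exact zero_le
  have hv : volume (Ks N s) ≠ ∞ := (isCompact_Ks N s).measure_lt_top.ne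
  rw [integral_norm_eq_lintegral_enorm (shift_int hg hs).aestronglyMeasurable]
  apply Real.le_sqrt_of_sq_le
  rw [← ENNReal.toReal_pow, Measure.real, ← ENNReal.toReal_mul]
  exact ENNReal.toReal_mono (ENNReal.mul_ne_top hv hC) h1

theorem presol_sum {N : ℕ} (S : Finset (Fin N → ℤ)) (a : (Fin N → ℤ) → ℂ) (φ : (Fin N → ℤ) → Fin N → XN N → ℂ)
    (u : (Fin N → ℤ) → XN N → ℂ) (h : ∀ k, PreSol (φ k) (u k)) :
    PreSol (fun j z => ∑ k ∈ S, a k * φ k j z) (fun z => ∑ k ∈ S, a k * u k z) := by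
  have hd : ∀ z ∈ Bs N, HasFDerivAt (fun z => ∑ k ∈ S, a k * u k z) (∑ k ∈ S, a k • fderiv ℝ (u k) z) z := by
    intro z hz
    exact HasFDerivAt.fun_sum fun k _ => ((h k).diff z hz).hasFDerivAt.const_mul (a k)
  refine ⟨continuousOn_finsetSum _ fun k _ => continuousOn_const.mul (h k).cont, fun z hz => (hd z hz).differentiableAt, ?_,
    fun i => continuousOn_finsetSum _ fun k _ => continuousOn_const.mul ((h k).gc i)⟩
  intro z hz i
  rw [dbar_of (hd z hz)]
  have : ∀ k, φ k i z = dbar (u k) z (Pi.single i 1) := fun k => ((h k).dbar z hz i).symm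
  simp only [this, dbar, sum_apply, smul_apply, smul_eq_mul]
  rw [Finset.mul_sum, ← Finset.sum_add_distrib, Finset.sum_div]
  exact Finset.sum_congr rfl fun k _ => by ring

theorem avg_ker {N : ℕ} {M : ℝ} {F : Fin N → XN N → ℂ} (h : Dat N M F) {κ s a} (hk : Ker (N := N) κ s a)
    (n : ℕ) (j : Fin N) {z : XN N} (hz : z ∈ Om N) : avg (κ n) F j z = ∑ k ∈ s n, a n k * phi F k j z := by
  simp only [phi, avg]
  have hc : Continuous fun t => F j (rot t z) :=
    (h.c1 j).continuousOn.comp_continuous (by fun_prop) fun t => rot_mem hz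
  simp_rw [← integral_const_mul]
  rw [← integral_finsetSum]
  · refine integral_congr_ae (Filter.Eventually.of_forall fun t => ?_)
    simp only
    rw [hk.sum, Finset.sum_mul, Finset.sum_mul]
    exact Finset.sum_congr rfl fun k _ => by ring
  · intro k _
    have := (UnitAddTorus.mFourier (-k) : C(TN N, ℂ)).continuous
    exact Continuous.integrable_of_hasCompactSupport (continuous_const.mul ((this.mul (by fun_prop)).mul hc)) (HasCompactSupport.of_compactSpace _)

structure Apx {N : ℕ} (M : ℝ) (F : Fin N → XN N → ℂ) (κ : ℕ → C(TN N, ℂ)) (v : ℕ → XN N → ℂ) : Prop where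
  nrm : ∀ n, ∫ t, ‖κ n t‖ ∂(muT N) ≤ 1
  lim : ∀ f : TN N → ℂ, Continuous f → Filter.Tendsto (fun n => ∫ t, κ n t * f t ∂(muT N)) Filter.atTop (nhds (f 0))
  pre : ∀ n, PreSol (avg (κ n) F) (v n)
  l2 : ∀ n, ∫⁻ z in Om N, ‖v n z‖ₑ ^ 2 ≤ ENNReal.ofReal (16 * N * M ^ 2) * volume (Om N)
  conv : ∀ (z : XN N) (s : ℝ), n1 z + s < 1 →
    ∃ L, Filter.Tendsto (fun n => ∫ w in Ks N s, v n (z + w)) Filter.atTop (nhds L)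

theorem apx_ex {N : ℕ} (hN : 1 ≤ N) {M : ℝ} (hM : 0 ≤ M) {F : Fin N → XN N → ℂ} (h : Dat N M F) :
    ∃ κ v, Apx M F κ v := by
  obtain ⟨κ, s, a, hk⟩ := ker_ex N
  choose u hu using fun k => sol_ex k hM h
  have hpre : ∀ k, PreSol (phi F k) (u k) := fun k =>
    ⟨(hu k).cont, (hu k).diff, (hu k).dbar, fun i => ((phi_dat k hM h).c1 i).continuousOn⟩
  have hl2 : ∀ (S : Finset (Fin N → ℤ)) (b : (Fin N → ℤ) → ℂ), (∀ k, ‖b k‖ ≤ 1) →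
      ∫⁻ z in Om N, ‖∑ k ∈ S, b k * u k z‖ₑ ^ 2 ≤ ENNReal.ofReal (16 * N * M ^ 2) * volume (Om N) := by
    intro S b hb
    refine (orth S u (fun k => (hu k).cont) (fun k => (hu k).rot) b (fun k _ => hb k)).trans ?_
    exact (Finset.sum_le_sum fun k _ => (hu k).l2).trans (Bk_sum hN hM h S)
  have hCt : ENNReal.ofReal (16 * N * M ^ 2) * volume (Om N) ≠ ∞ := ENNReal.mul_ne_top ENNReal.ofReal_ne_top (volOm_lt N).ne
  refine ⟨κ, fun n z => ∑ k ∈ s n, a n k * u k z, hk.nrm, hk.lim, ?_, fun n => hl2 _ _ (hk.bd n), ?_⟩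
  · intro n
    have := presol_sum (s n) (a n) (phi F) u hpre
    refine ⟨this.cont, this.diff, fun z hz i => ?_, fun i => (this.gc i).congr fun z hz => avg_ker h hk n i hz⟩
    rw [this.dbar z hz i, avg_ker h hk n i hz.1]
  · intro z r hr
    set ℓ : (Fin N → ℤ) → ℂ := fun k => ∫ w in Ks N r, u k (z + w) with hℓ
    have hint : ∀ (S : Finset (Fin N → ℤ)) (b : (Fin N → ℤ) → ℂ),
        ∫ w in Ks N r, ∑ k ∈ S, b k * u k (z + w) = ∑ k ∈ S, b k * ℓ k := by
      intro S b
      rw [integral_finsetSum]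
      · simp_rw [integral_const_mul, hℓ]
      · intro k _
        exact (shift_int (hu k).cont hr).const_mul _
    have hsum : Summable fun k => ‖ℓ k‖ := by
      refine summable_of_sum_le (c := Real.sqrt (volume.real (Ks N r) * (ENNReal.ofReal (16 * N * M ^ 2) * volume (Om N)).toReal))
        (fun k => norm_nonneg _) fun S => ?_
      let σ : (Fin N → ℤ) → ℂ := fun k => (starRingEnd ℂ) (ℓ k) / ‖ℓ k‖
      have hσ1 : ∀ k, ‖σ k‖ ≤ 1 := by
        intro k; simp only [σ, norm_div, RCLike.norm_conj, Complex.norm_real, norm_norm]; exact div_self_le_one _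
      have hσ2 : ∀ k, σ k * ℓ k = ‖ℓ k‖ := by
        intro k
        by_cases hz : ℓ k = 0
        · simp [hz]
        · have h0 : (‖ℓ k‖ : ℂ) ≠ 0 := by exact_mod_cast norm_ne_zero_iff.2 hz
          simp only [σ]
          rw [div_mul_eq_mul_div, div_eq_iff h0, mul_comm, Complex.mul_conj, Complex.normSq_eq_norm_sq]
          push_cast; ring
      have h1 := hint S σ
      simp_rw [hσ2] at h1
      have h2 : ∑ k ∈ S, ‖ℓ k‖ = ‖∫ w in Ks N r, ∑ k ∈ S, σ k * u k (z + w)‖ := by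
        rw [h1, ← Complex.ofReal_sum, Complex.norm_real, Real.norm_of_nonneg (Finset.sum_nonneg fun _ _ => norm_nonneg _)]
      rw [h2]
      refine (norm_integral_le_integral_norm _).trans ?_
      exact L12 (g := fun z => ∑ k ∈ S, σ k * u k z) (continuousOn_finsetSum _ fun k _ => continuousOn_const.mul (hu k).cont) hr hCt (hl2 S σ hσ1)
    refine ⟨∑' k, 1 * ℓ k, ?_⟩
    have := tendsto_tsum_of_dominated_convergence (f := fun n k => a n k * ℓ k) (g := fun k => 1 * ℓ k) (𝓕 := Filter.atTop) hsum
      (fun k => (hk.one k).mul_const _) (Filter.Eventually.of_forall fun n k => by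
        rw [norm_mul]; exact mul_le_of_le_one_left (norm_nonneg _) (hk.bd n k))
    refine this.congr fun n => ?_
    rw [hint]
    exact tsum_eq_sum fun k hk' => by rw [hk.out n k hk', zero_mul]

theorem avg_bd {N : ℕ} (c : C(TN N, ℂ)) (hc : ∫ t, ‖c t‖ ∂(muT N) ≤ 1) {M : ℝ} (hM : 0 ≤ M) {F : Fin N → XN N → ℂ}
    (h : Dat N M F) : Dat N M (avg c F) := by
  simpa using avg_dat c hM h 1 hc

theorem rot_zero {N : ℕ} (z : XN N) : rot 0 z = z := by ext j; simp [rot_apply, ef_zero]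

theorem Phi_mem {N : ℕ} {s : ℝ} {z : XN N} (hs : n1 z + s < 1) {a : XN N × ℝ} (ha : a ∈ Ks N s ×ˢ Icc (0:ℝ) 1) :
    z + a.2 • a.1 ∈ Om N := by
  have := Ks_add hs ha.1 (l := (a.2 : ℂ)) (by simpa [abs_of_nonneg ha.2.1] using ha.2.2)
  simpa using this

theorem Phi_cont {N : ℕ} {G : Fin N → XN N → ℂ} (hG : ∀ j, ContinuousOn (G j) (Om N)) {s : ℝ} {z : XN N}
    (hs : n1 z + s < 1) : ContinuousOn (fun a : XN N × ℝ => Phi G z a.1 a.2) (Ks N s ×ˢ Icc (0:ℝ) 1) := by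
  refine continuousOn_finsetSum _ fun j _ => ContinuousOn.mul (by fun_prop) ?_
  exact (hG j).comp (by fun_prop) fun a ha => Phi_mem hs ha

theorem Phi_bd {N : ℕ} {M : ℝ} {G : Fin N → XN N → ℂ} (hG : ∀ j, ∀ z ∈ Om N, ‖G j z‖ ≤ M) (hM : 0 ≤ M) {s : ℝ} {z : XN N}
    (hs : n1 z + s < 1) {a : XN N × ℝ} (ha : a ∈ Ks N s ×ˢ Icc (0:ℝ) 1) : ‖Phi G z a.1 a.2‖ ≤ s * M := by
  refine (norm_sum_le _ _).trans ?_
  calc ∑ j, ‖(starRingEnd ℂ) (a.1 j) * G j (z + a.2 • a.1)‖ ≤ ∑ j, ‖a.1 j‖ * M := by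
        refine Finset.sum_le_sum fun j _ => ?_
        rw [norm_mul, RCLike.norm_conj]
        exact mul_le_mul_of_nonneg_left (hG j _ (Phi_mem hs ha)) (norm_nonneg _)
    _ = n1 a.1 * M := by rw [n1, Finset.sum_mul]
    _ ≤ s * M := mul_le_mul_of_nonneg_right ha.1 hM

theorem MFs {N : ℕ} {G : Fin N → XN N → ℂ} {u : XN N → ℂ} (h : PreSol G u) {s : ℝ} {z : XN N}
    (hs : n1 z + s < 1) (c : XN N → ℂ) (hc : Continuous c) (hcr : ∀ t w, c (rot t w) = c w) :
    (∫ w in Ks N s, c w) * u z = (∫ w in Ks N s, c w * u (z + w)) -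
      2 * ∫ a in Ks N s ×ˢ Icc (0:ℝ) 1, c a.1 * Phi G z a.1 a.2 := by
  rw [MF h hs c hc hcr]
  have hKc := (isCompact_Ks N s).prod (isCompact_Icc (a := (0:ℝ)) (b := 1))
  simp_rw [mul_sub]
  have hI1 : IntegrableOn (fun a : XN N × ℝ => c a.1 * u (z + a.1)) (Ks N s ×ˢ Icc (0:ℝ) 1) := by
    refine ContinuousOn.integrableOn_compact hKc ?_
    exact (hc.comp continuous_fst).continuousOn.mul ((shift_cont h.cont hs).comp continuousOn_fst fun a ha => ha.1)
  have hI2 : IntegrableOn (fun a : XN N × ℝ => c a.1 * (2 * Phi G z a.1 a.2)) (Ks N s ×ˢ Icc (0:ℝ) 1) := by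
    refine ContinuousOn.integrableOn_compact hKc ?_
    exact (hc.comp continuous_fst).continuousOn.mul (continuousOn_const.mul (Phi_cont h.gc hs))
  rw [integral_sub hI1 hI2, ← integral_const_mul]
  congr 1
  · rw [Measure.volume_eq_prod, ← Measure.prod_restrict, integral_fun_fst (fun w => c w * u (z + w))]
    simp
  · refine integral_congr_ae (Filter.Eventually.of_forall fun a => ?_)
    simp only; ring

theorem avg_lim {N : ℕ} {M : ℝ} {F : Fin N → XN N → ℂ} (h : Dat N M F) {κ v} (hA : Apx M F κ v) (j : Fin N) {z : XN N}
    (hz : z ∈ Om N) : Filter.Tendsto (fun n => avg (κ n) F j z) Filter.atTop (nhds (F j z)) := by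
  have hc : Continuous fun t => F j (rot t z) :=
    (h.c1 j).continuousOn.comp_continuous (by fun_prop) fun t => rot_mem hz
  have := hA.lim (fun t => (starRingEnd ℂ) (ef (t j)) * F j (rot t z)) (Continuous.mul (by fun_prop) hc)
  simp only [Pi.zero_apply, ef_zero, map_one, rot_zero, one_mul] at this
  refine this.congr fun n => ?_
  simp only [avg, mul_assoc]

theorem E_lim {N : ℕ} {M : ℝ} (hM : 0 ≤ M) {F : Fin N → XN N → ℂ} (h : Dat N M F) {κ v} (hA : Apx M F κ v) {s : ℝ} {z : XN N}
    (hs : n1 z + s < 1) (c : XN N → ℂ) (hc : Continuous c) :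
    Filter.Tendsto (fun n => ∫ a in Ks N s ×ˢ Icc (0:ℝ) 1, c a.1 * Phi (avg (κ n) F) z a.1 a.2) Filter.atTop
      (nhds (∫ a in Ks N s ×ˢ Icc (0:ℝ) 1, c a.1 * Phi F z a.1 a.2)) := by
  have hKc := (isCompact_Ks N s).prod (isCompact_Icc (a := (0:ℝ)) (b := 1))
  have hcc : ContinuousOn (fun a : XN N × ℝ => c a.1) (Ks N s ×ˢ Icc (0:ℝ) 1) := (hc.comp continuous_fst).continuousOn
  refine tendsto_integral_of_dominated_convergence (fun a => ‖c a.1‖ * (s * M)) ?_ ?_ ?_ ?_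
  · intro n
    exact (hcc.mul (Phi_cont (hA.pre n).gc hs)).aestronglyMeasurable_of_isCompact hKc hKc.measurableSet
  · exact ((hcc.norm.mul continuousOn_const).integrableOn_compact hKc)
  · intro n
    filter_upwards [ae_restrict_mem hKc.measurableSet] with a ha
    rw [norm_mul]
    exact mul_le_mul_of_nonneg_left (Phi_bd (avg_bd _ (hA.nrm n) hM h).bd hM hs ha) (norm_nonneg _)
  · filter_upwards [ae_restrict_mem hKc.measurableSet] with a ha
    refine Filter.Tendsto.const_mul _ (tendsto_finsetSum _ fun j _ => Filter.Tendsto.const_mul _ ?_)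
    exact avg_lim h hA j (Phi_mem hs ha)

open scoped Pointwise in
theorem volKs {N : ℕ} {s : ℝ} (hs : 0 < s) : s ^ (2 * N) * volume.real (Om N) ≤ volume.real (Ks N s) := by
  have h1 : s • Om N ⊆ Ks N s := by
    rintro _ ⟨w, hw, rfl⟩
    have hw' : n1 w < 1 := hw
    show n1 (s • w) ≤ s
    rw [n1_smulr, abs_of_pos hs]; nlinarith
  have h2 := Measure.addHaar_smul (volume : Measure (XN N)) s (Om N)
  have h3 : Module.finrank ℝ (XN N) = 2 * N := by
    rw [Module.finrank_pi_fintype]; simp [Complex.finrank_real_complex, mul_comm]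
  rw [h3, abs_of_pos (by positivity)] at h2
  have h4 : (volume (s • Om N)).toReal = s ^ (2 * N) * volume.real (Om N) := by
    rw [h2, ENNReal.toReal_mul, ENNReal.toReal_ofReal (by positivity)]; rfl
  rw [← h4]
  exact ENNReal.toReal_mono (isCompact_Ks N s).measure_lt_top.ne (measure_mono h1)
theorem volOm_pos (N : ℕ) : 0 < volume.real (Om N) := by
  refine ENNReal.toReal_pos ?_ (volOm_lt N).ne
  exact ((isOpen_Om N).measure_pos volume ⟨0, by simp [Om, n1]⟩).ne'
theorem volKs_pos {N : ℕ} {s : ℝ} (hs : 0 < s) : 0 < volume.real (Ks N s) :=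
  lt_of_lt_of_le (mul_pos (by positivity) (volOm_pos N)) (volKs hs)

theorem v_bd {N : ℕ} {M : ℝ} (hM : 0 ≤ M) {F : Fin N → XN N → ℂ} (h : Dat N M F) {κ v} (hA : Apx M F κ v)
    (n : ℕ) {z : XN N} (hz : z ∈ Om N) : ‖v n z‖ ≤ 2 * (1 + 2 * Real.sqrt N) * (1 / (1 - n1 z)) ^ N * M := by
  have hz' : n1 z < 1 := hz
  have key : ∀ s, 0 < s → s < 1 - n1 z → ‖v n z‖ ≤ 2 * (1 + 2 * Real.sqrt N) * (1 / s) ^ N * M := by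
    intro s hs0 hs1
    have hs : n1 z + s < 1 := by linarith
    have hs2 : s < 1 := by have := n1_nonneg z; linarith
    have h1 := MFs (hA.pre n) hs (fun _ => 1) continuous_const (fun _ _ => rfl)
    have hV := volKs_pos (N := N) hs0
    simp only [one_mul] at h1
    set V := volume.real (Ks N s) with hVd
    have h2 : (∫ w in Ks N s, (1:ℂ)) = V := by simp [hVd]
    rw [h2] at h1
    have hCt : ENNReal.ofReal (16 * N * M ^ 2) * volume (Om N) ≠ ∞ := ENNReal.mul_ne_top ENNReal.ofReal_ne_top (volOm_lt N).ne
    have h3 := L12 (hA.pre n).cont hs hCt (hA.l2 n)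
    have h4 : ‖∫ a in Ks N s ×ˢ Icc (0:ℝ) 1, Phi (avg (κ n) F) z a.1 a.2‖ ≤ s * M * V := by
      have hKc := (isCompact_Ks N s).prod (isCompact_Icc (a := (0:ℝ)) (b := 1))
      refine (norm_setIntegral_le_of_norm_le_const hKc.measure_lt_top fun a ha =>
        Phi_bd (avg_bd _ (hA.nrm n) hM h).bd hM hs ha).trans (le_of_eq ?_)
      congr 1
      rw [Measure.volume_eq_prod, measureReal_prod_prod]; simp [hVd]
    have h5 : V * ‖v n z‖ ≤ Real.sqrt (V * (ENNReal.ofReal (16 * N * M ^ 2) * volume (Om N)).toReal) + 2 * (s * M * V) := by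
      have : ‖(V : ℂ) * v n z‖ = V * ‖v n z‖ := by rw [norm_mul, Complex.norm_real, Real.norm_of_nonneg hV.le]
      rw [← this, h1]
      refine (norm_sub_le _ _).trans (add_le_add ((norm_integral_le_integral_norm _).trans h3) ?_)
      rw [norm_mul, Complex.norm_ofNat]
      exact mul_le_mul_of_nonneg_left h4 (by norm_num)
    have h6 : Real.sqrt (V * (ENNReal.ofReal (16 * N * M ^ 2) * volume (Om N)).toReal) ≤ V * (4 * Real.sqrt N * (1 / s) ^ N * M) := by
      rw [ENNReal.toReal_mul, ENNReal.toReal_ofReal (by positivity)]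
      apply Real.sqrt_le_iff.2 ⟨by positivity, ?_⟩
      have h7 := volKs (N := N) hs0
      rw [← hVd] at h7
      have h8 : volume.real (Om N) ≤ V * ((1 / s) ^ N) ^ 2 := by
        rw [← pow_mul, mul_comm N 2, one_div, inv_pow, ← div_eq_mul_inv, le_div_iff₀ (by positivity)]
        linarith
      have h9 : (Real.sqrt N) ^ 2 = N := Real.sq_sqrt (by positivity)
      calc V * (16 * N * M ^ 2 * volume.real (Om N)) ≤ V * (16 * N * M ^ 2 * (V * ((1 / s) ^ N) ^ 2)) := by gcongr
        _ = (V * (4 * Real.sqrt N * (1 / s) ^ N * M)) ^ 2 := by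
          linear_combination (-(16) * V^2*M^2*((1/s)^N)^2) * h9
    have h10 : (1:ℝ) ≤ (1 / s) ^ N := one_le_pow₀ (by rw [one_div]; exact (one_le_inv₀ hs0).2 hs2.le)
    have h11 : V * ‖v n z‖ ≤ V * (2 * (1 + 2 * Real.sqrt N) * (1 / s) ^ N * M) := by
      have h12 : s * M ≤ (1 / s) ^ N * M := mul_le_mul_of_nonneg_right (hs2.le.trans h10) hM
      nlinarith
    exact le_of_mul_le_mul_left h11 hV
  have hlim : Filter.Tendsto (fun s : ℝ => 2 * (1 + 2 * Real.sqrt N) * (1 / s) ^ N * M) (nhdsWithin (1 - n1 z) (Iio (1 - n1 z)))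
      (nhds (2 * (1 + 2 * Real.sqrt N) * (1 / (1 - n1 z)) ^ N * M)) := by
    refine Filter.Tendsto.mono_left (ContinuousAt.tendsto ?_) nhdsWithin_le_nhds
    have : (1 - n1 z) ≠ 0 := by linarith
    fun_prop (disch := assumption)
  refine ge_of_tendsto hlim ?_
  filter_upwards [Ioo_mem_nhdsLT (show (0:ℝ) < 1 - n1 z by linarith)] with s hs
  exact key s hs.1 hs.2

theorem v_conv {N : ℕ} {M : ℝ} (hM : 0 ≤ M) {F : Fin N → XN N → ℂ} (h : Dat N M F) {κ v} (hA : Apx M F κ v)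
    {z : XN N} (hz : z ∈ Om N) : ∃ L, Filter.Tendsto (fun n => v n z) Filter.atTop (nhds L) := by
  have hz' : n1 z < 1 := hz
  set s := (1 - n1 z) / 2 with hsd
  have hs : n1 z + s < 1 := by linarith
  have hs0 : 0 < s := by linarith
  obtain ⟨L, hL⟩ := hA.conv z s hs
  have hE := E_lim hM h hA hs (fun _ => 1) continuous_const
  have hV : (volume.real (Ks N s) : ℂ) ≠ 0 := by exact_mod_cast (volKs_pos (N := N) hs0).ne'
  refine ⟨_, ((hL.sub (hE.const_mul 2)).div_const (volume.real (Ks N s) : ℂ)).congr fun n => ?_⟩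
  have h1 := MFs (hA.pre n) hs (fun _ => 1) continuous_const (fun _ _ => rfl)
  rw [div_eq_iff hV]
  simp only [one_mul] at h1 ⊢
  rw [← h1]; simp [mul_comm]

def eta (N : ℕ) (s : ℝ) (w : XN N) : ℂ := (Real.smoothTransition (s ^ 2 / (N + 1) - ∑ j, ‖w j‖ ^ 2) : ℝ)
theorem eta_cd (N : ℕ) (s : ℝ) : ContDiff ℝ 1 (eta N s) := by
  unfold eta
  refine Complex.ofRealCLM.contDiff.comp (Real.smoothTransition.contDiff.comp (contDiff_const.sub ?_))
  exact ContDiff.sum fun j _ => (contDiff_apply ℝ ℂ j).norm_sq ℝ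
theorem eta_rot {N : ℕ} (s : ℝ) (t : TN N) (w : XN N) : eta N s (rot t w) = eta N s w := by
  simp [eta, rot_apply, norm_ef]
theorem eta_supp {N : ℕ} {s : ℝ} (hs : 0 < s) {w : XN N} (hw : w ∉ Ks N s) : eta N s w = 0 := by
  have hw' : s < n1 w := not_le.1 hw
  have h1 : (n1 w) ^ 2 ≤ N * ∑ j, ‖w j‖ ^ 2 := by
    simpa [n1] using sq_sum_le_card_mul_sum_sq (s := (Finset.univ : Finset (Fin N))) (f := fun j => ‖w j‖)
  rw [eta, Real.smoothTransition.zero_of_nonpos]; · simp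
  rw [sub_nonpos, div_le_iff₀ (by positivity)]
  have h2 : 0 ≤ ∑ j, ‖w j‖ ^ 2 := by positivity
  nlinarith
theorem eta_int {N : ℕ} {s : ℝ} (hs : 0 < s) : (∫ w in Ks N s, eta N s w) ≠ 0 := by
  rw [setIntegral_eq_integral_of_forall_compl_eq_zero fun w hw => eta_supp hs hw]
  unfold eta
  rw [integral_complex_ofReal, Complex.ofReal_ne_zero]
  refine ne_of_gt (Continuous.integral_pos_of_hasCompactSupport_nonneg_nonzero (x := 0) ?_ ?_ ?_ ?_)
  · exact Real.smoothTransition.continuous.comp (by fun_prop)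
  · refine HasCompactSupport.intro (isCompact_Ks N s) fun w hw => ?_
    have := eta_supp hs hw
    simpa [eta] using this
  · intro w; exact Real.smoothTransition.nonneg _
  · simp only [Pi.zero_apply, norm_zero]
    refine (Real.smoothTransition.pos_of_pos ?_).ne'
    simp; positivity

theorem shiftK {N : ℕ} {s r : ℝ} (hs : 0 < s) (v : XN N → ℂ) {z : XN N} (hz : n1 z < r) :
    ∫ w in Ks N s, eta N s w * v (z + w) = ∫ w in Ks N (r + s), v w * eta N s (w - z) := by
  rw [setIntegral_eq_integral_of_forall_compl_eq_zero, setIntegral_eq_integral_of_forall_compl_eq_zero,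
    ← integral_add_left_eq_self (fun w => v w * eta N s (w - z)) z]
  · refine integral_congr_ae (Filter.Eventually.of_forall fun w => ?_)
    simp [mul_comm]
  · intro w hw
    rw [eta_supp hs, mul_zero]
    intro h
    apply hw
    have h1 := n1_add z (w - z)
    have h2 : n1 (w - z) ≤ s := h
    rw [add_sub_cancel] at h1
    show n1 w ≤ _
    linarith
  · intro w hw
    rw [eta_supp hs hw, zero_mul]

def DD (N : ℕ) (s r : ℝ) (v : XN N → ℂ) (G : Fin N → XN N → ℂ) (z : XN N) : XN N →L[ℝ] ℂ :=
  (∫ w in Ks N s, eta N s w)⁻¹ • ((∫ w in Ks N (r + s), v w • (-(fderiv ℝ (eta N s) (w - z)))) -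
    (2:ℂ) • ∑ j, ∫ a in Ks N s ×ˢ Icc (0:ℝ) 1, (eta N s a.1 * (starRingEnd ℂ) (a.1 j)) • fderiv ℝ (G j) (z + a.2 • a.1))

theorem rep {N : ℕ} {s r : ℝ} (hs : 0 < s) (hr : r + s < 1) (v : XN N → ℂ)
    (hvm : AEStronglyMeasurable v (volume.restrict (Ks N (r + s)))) (B : ℝ) (hvb : ∀ w ∈ Ks N (r + s), ‖v w‖ ≤ B)
    (G : Fin N → XN N → ℂ) (hG : ∀ j, ContDiffOn ℝ 1 (G j) (Om N))
    (hid : ∀ z, n1 z < r → (∫ w in Ks N s, eta N s w) * v z = (∫ w in Ks N s, eta N s w * v (z + w)) -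
      2 * ∫ a in Ks N s ×ˢ Icc (0:ℝ) 1, eta N s a.1 * Phi G z a.1 a.2) :
    (∀ z, n1 z < r → HasFDerivAt v (DD N s r v G z) z) ∧ ContinuousOn (DD N s r v G) {z | n1 z < r} := by
  have hU : IsOpen {z : XN N | n1 z < r} := isOpen_lt continuous_n1 continuous_const
  have hec := (eta_cd N s).continuous
  have hd : Differentiable ℝ (eta N s) := (eta_cd N s).differentiable (by simp)
  have hfc : Continuous (fderiv ℝ (eta N s)) := (eta_cd N s).continuous_fderiv (by simp)
  obtain ⟨a1, a2⟩ := paramInt (isCompact_Ks N (r + s)) (Ks_meas N _) (isCompact_Ks N _).measure_lt_top.ne hU v hvm B hvb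
    (fun p => eta N s (p.1 - p.2)) (fun p => -(fderiv ℝ (eta N s) (p.1 - p.2)))
    (Continuous.continuousOn (by fun_prop)) (Continuous.continuousOn (by fun_prop)) (by
      intro a _ z _
      have h1 : HasFDerivAt (fun z : XN N => a - z) (-(ContinuousLinearMap.id ℝ (XN N))) z :=
        (hasFDerivAt_id z).const_sub a
      have h2 := (hd (a - z)).hasFDerivAt.comp z h1
      convert! h2 using 1
      ext ξ; simp)
  have hKc := (isCompact_Ks N s).prod (isCompact_Icc (a := (0:ℝ)) (b := 1))
  have hmem : ∀ a ∈ Ks N s ×ˢ Icc (0:ℝ) 1, ∀ z, n1 z < r → z + a.2 • a.1 ∈ Om N :=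
    fun a ha z hz => Phi_mem (by linarith) ha
  have b : ∀ j, (∀ z, n1 z < r → HasFDerivAt (fun z => ∫ a in Ks N s ×ˢ Icc (0:ℝ) 1, (eta N s a.1 * (starRingEnd ℂ) (a.1 j)) * G j (z + a.2 • a.1))
      (∫ a in Ks N s ×ˢ Icc (0:ℝ) 1, (eta N s a.1 * (starRingEnd ℂ) (a.1 j)) • fderiv ℝ (G j) (z + a.2 • a.1)) z) ∧
      ContinuousOn (fun z => ∫ a in Ks N s ×ˢ Icc (0:ℝ) 1, (eta N s a.1 * (starRingEnd ℂ) (a.1 j)) • fderiv ℝ (G j) (z + a.2 • a.1)) {z | n1 z < r} := by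
    intro j
    obtain ⟨g1, g2⟩ := contDiffOn_fderiv (isOpen_Om N) (hG j)
    have hcc : ContinuousOn (fun a : XN N × ℝ => eta N s a.1 * (starRingEnd ℂ) (a.1 j)) (Ks N s ×ˢ Icc (0:ℝ) 1) :=
      Continuous.continuousOn (by fun_prop)
    obtain ⟨C0, hC0⟩ := hKc.exists_bound_of_continuousOn hcc
    exact paramInt (A := XN N × ℝ) hKc hKc.measurableSet hKc.measure_lt_top.ne hU _
      (hcc.aestronglyMeasurable_of_isCompact hKc hKc.measurableSet) C0 hC0
      (fun p => G j (p.2 + p.1.2 • p.1.1)) (fun p => fderiv ℝ (G j) (p.2 + p.1.2 • p.1.1))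
      ((hG j).continuousOn.comp (by fun_prop) fun p hp => hmem p.1 hp.1 p.2 hp.2)
      (g2.comp (by fun_prop) fun p hp => hmem p.1 hp.1 p.2 hp.2)
      (fun a ha z hz => (hasFDerivAt_comp_add_right (a.2 • a.1)).2 (g1 _ (hmem a ha z hz)))
  have hC := eta_int (N := N) hs
  have hE : ∀ z, n1 z < r → v z = (∫ w in Ks N s, eta N s w)⁻¹ • ((∫ w in Ks N (r + s), v w * eta N s (w - z)) -
      (2:ℂ) • ∑ j, ∫ a in Ks N s ×ˢ Icc (0:ℝ) 1, (eta N s a.1 * (starRingEnd ℂ) (a.1 j)) * G j (z + a.2 • a.1)) := by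
    intro z hz
    have h1 := hid z hz
    rw [shiftK hs v hz] at h1
    have h2 : (∫ a in Ks N s ×ˢ Icc (0:ℝ) 1, eta N s a.1 * Phi G z a.1 a.2) =
        ∑ j, ∫ a in Ks N s ×ˢ Icc (0:ℝ) 1, (eta N s a.1 * (starRingEnd ℂ) (a.1 j)) * G j (z + a.2 • a.1) := by
      rw [← integral_finsetSum]
      · simp only [Phi, Finset.mul_sum, mul_assoc]
      · intro j _
        refine ContinuousOn.integrableOn_compact hKc (ContinuousOn.mul (Continuous.continuousOn (by fun_prop)) ?_)
        exact (hG j).continuousOn.comp (by fun_prop) fun a ha => hmem a ha z hz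
    rw [h2] at h1
    rw [smul_eq_mul, smul_eq_mul, ← h1, inv_mul_cancel_left₀ hC]
  constructor
  · intro z hz
    have h1 := ((a1 z hz).sub ((HasFDerivAt.fun_sum fun j _ => (b j).1 z hz : HasFDerivAt (fun z => ∑ j, ∫ a in Ks N s ×ˢ Icc (0:ℝ) 1, (eta N s a.1 * (starRingEnd ℂ) (a.1 j)) * G j (z + a.2 • a.1)) _ z).const_smul (2:ℂ))).const_smul
      ((∫ w in Ks N s, eta N s w)⁻¹)
    refine h1.congr_of_eventuallyEq ?_
    filter_upwards [hU.mem_nhds hz] with x hx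
    rw [hE x hx]; rfl
  · unfold DD
    exact (a2.sub ((continuousOn_finsetSum _ fun j _ => (b j).2).const_smul (2:ℂ))).const_smul
      ((∫ w in Ks N s, eta N s w)⁻¹)

theorem DD_apply {N : ℕ} {s r : ℝ} (hr : r + s < 1) {v : XN N → ℂ}
    (hvm : AEStronglyMeasurable v (volume.restrict (Ks N (r + s)))) {B : ℝ} (hvb : ∀ w ∈ Ks N (r + s), ‖v w‖ ≤ B)
    {G : Fin N → XN N → ℂ} (hG : ∀ j, ContDiffOn ℝ 1 (G j) (Om N)) {z : XN N} (hz : n1 z < r) (ξ : XN N) :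
    DD N s r v G z ξ = (∫ w in Ks N s, eta N s w)⁻¹ * ((∫ w in Ks N (r + s), v w * (-(fderiv ℝ (eta N s) (w - z) ξ))) -
    2 * ∑ j, ∫ a in Ks N s ×ˢ Icc (0:ℝ) 1, (eta N s a.1 * (starRingEnd ℂ) (a.1 j)) * fderiv ℝ (G j) (z + a.2 • a.1) ξ) := by
  have hec := (eta_cd N s).continuous
  have hfc : Continuous (fderiv ℝ (eta N s)) := (eta_cd N s).continuous_fderiv (by simp)
  have hKc := (isCompact_Ks N s).prod (isCompact_Icc (a := (0:ℝ)) (b := 1))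
  unfold DD
  simp only [smul_apply, sub_apply, sum_apply, smul_eq_mul]
  congr 2
  · rw [ContinuousLinearMap.integral_apply]
    · rfl
    · have h1 : IntegrableOn (fun w => -(fderiv ℝ (eta N s) (w - z))) (Ks N (r + s)) :=
        ContinuousOn.integrableOn_compact (isCompact_Ks N _) (Continuous.continuousOn (by fun_prop))
      refine h1.bdd_smul B hvm ?_
      filter_upwards [ae_restrict_mem (Ks_meas N _)] with w hw using hvb w hw
  · congr 1
    refine Finset.sum_congr rfl fun j _ => ?_
    rw [ContinuousLinearMap.integral_apply]
    · rfl
    · refine ContinuousOn.integrableOn_compact hKc (ContinuousOn.smul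
        (f := fun a : XN N × ℝ => eta N s a.1 * (starRingEnd ℂ) (a.1 j)) (Continuous.continuousOn (by fun_prop)) ?_)
      exact (contDiffOn_fderiv (isOpen_Om N) (hG j)).2.comp (by fun_prop) fun a ha => Phi_mem (by linarith) ha

theorem avg_fd_lim {N : ℕ} {M : ℝ} {F : Fin N → XN N → ℂ} (h : Dat N M F) {κ v} (hA : Apx M F κ v) (j : Fin N) {z : XN N}
    (hz : z ∈ Om N) (ξ : XN N) : Filter.Tendsto (fun n => fderiv ℝ (avg (κ n) F j) z ξ) Filter.atTop (nhds (fderiv ℝ (F j) z ξ)) := by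
  have hc : Continuous fun t => fderiv ℝ (F j) (rot t z) :=
    (contDiffOn_fderiv (isOpen_Om N) (h.c1 j)).2.comp_continuous (by fun_prop) fun t => rot_mem hz
  have hc2 : Continuous fun t => fderiv ℝ (F j) (rot t z) (rot t ξ) := hc.clm_apply (by fun_prop)
  have := hA.lim (fun t => (starRingEnd ℂ) (ef (t j)) * fderiv ℝ (F j) (rot t z) (rot t ξ)) (Continuous.mul (by fun_prop) hc2)
  simp only [Pi.zero_apply, ef_zero, map_one, rot_zero, one_mul] at this
  refine this.congr fun n => ?_
  rw [avg_fderiv_apply _ h j hz]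
  simp only [mul_assoc]

theorem avg_fd_bd {N : ℕ} {M : ℝ} {F : Fin N → XN N → ℂ} (h : Dat N M F) {κ v} (hA : Apx M F κ v) (j : Fin N) {q : ℝ}
    (hq : q < 1) (ξ : XN N) : ∃ C, ∀ n, ∀ z, n1 z ≤ q → ‖fderiv ℝ (avg (κ n) F j) z ξ‖ ≤ C := by
  have hK := isCompact_Ks N q
  have hKO : Ks N q ⊆ Om N := fun w hw => lt_of_le_of_lt (show n1 w ≤ q from hw) hq
  have hf := (contDiffOn_fderiv (isOpen_Om N) (h.c1 j)).2.mono hKO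
  obtain ⟨C, hC⟩ := hK.exists_bound_of_continuousOn hf
  refine ⟨max C 0 * ‖ξ‖, fun n z hz => ?_⟩
  have hzO : z ∈ Om N := hKO hz
  have hr : ∀ t : TN N, ‖rot t ξ‖ ≤ ‖ξ‖ := fun t => by
    rw [pi_norm_le_iff_of_nonneg (norm_nonneg _)]
    intro i; rw [rot_apply, norm_mul, norm_ef, one_mul]; exact norm_le_pi_norm ξ i
  rw [avg_fderiv_apply _ h j hzO]
  calc _ ≤ ∫ t, ‖κ n t‖ * (max C 0 * ‖ξ‖) ∂(muT N) := by
        refine norm_integral_le_of_norm_le ?_ (Filter.Eventually.of_forall fun t => ?_)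
        · exact Continuous.integrable_of_hasCompactSupport (by fun_prop) (HasCompactSupport.of_compactSpace _)
        · rw [norm_mul, norm_mul, RCLike.norm_conj, norm_ef, mul_one]
          refine mul_le_mul_of_nonneg_left ?_ (norm_nonneg _)
          refine (ContinuousLinearMap.le_opNorm _ _).trans ?_
          refine mul_le_mul ((hC _ ?_).trans (le_max_left _ _)) (hr t) (norm_nonneg _) (le_max_right _ _)
          show n1 _ ≤ q
          rwa [n1_rot]
    _ = (∫ t, ‖κ n t‖ ∂(muT N)) * (max C 0 * ‖ξ‖) := integral_mul_const _ _
    _ ≤ 1 * (max C 0 * ‖ξ‖) := mul_le_mul_of_nonneg_right (hA.nrm n) (by positivity)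
    _ = _ := one_mul _

theorem DD_lim {N : ℕ} {M : ℝ} {F : Fin N → XN N → ℂ} (h : Dat N M F) {κ v} (hA : Apx M F κ v)
    {s r : ℝ} (hr : r + s < 1) {B : ℝ} (hvb : ∀ n, ∀ w ∈ Ks N (r + s), ‖v n w‖ ≤ B)
    (hvm : ∀ n, AEStronglyMeasurable (v n) (volume.restrict (Ks N (r + s))))
    {u : XN N → ℂ} (hum : AEStronglyMeasurable u (volume.restrict (Ks N (r + s)))) (hub : ∀ w ∈ Ks N (r + s), ‖u w‖ ≤ B)
    (hu : ∀ w ∈ Ks N (r + s), Filter.Tendsto (fun n => v n w) Filter.atTop (nhds (u w)))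
    {z : XN N} (hz : n1 z < r) (ξ : XN N) :
    Filter.Tendsto (fun n => DD N s r (v n) (avg (κ n) F) z ξ) Filter.atTop (nhds (DD N s r u F z ξ)) := by
  have hec := (eta_cd N s).continuous
  have hfc : Continuous (fderiv ℝ (eta N s)) := (eta_cd N s).continuous_fderiv (by simp)
  have hKc := (isCompact_Ks N s).prod (isCompact_Icc (a := (0:ℝ)) (b := 1))
  rw [DD_apply hr hum hub h.c1 hz]
  have hdat : ∀ n j, ContDiffOn ℝ 1 (avg (κ n) F j) (Om N) := fun n j => (avg_hasFDerivAt (κ n) h j).2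
  simp_rw [fun n => DD_apply hr (hvm n) (hvb n) (hdat n) hz ξ]
  have hmem : ∀ a ∈ Ks N s ×ˢ Icc (0:ℝ) 1, z + a.2 • a.1 ∈ Om N := fun a ha => Phi_mem (by linarith) ha
  refine Filter.Tendsto.const_mul _ (Filter.Tendsto.sub ?_ (Filter.Tendsto.const_mul _ (tendsto_finsetSum _ fun j _ => ?_)))
  · have hgc : Continuous fun w => -(fderiv ℝ (eta N s) (w - z) ξ) := by fun_prop
    refine tendsto_integral_of_dominated_convergence (fun w => B * ‖-(fderiv ℝ (eta N s) (w - z) ξ)‖) ?_ ?_ ?_ ?_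
    · exact fun n => (hvm n).mul hgc.aestronglyMeasurable
    · exact (continuous_const.mul hgc.norm).continuousOn.integrableOn_compact (isCompact_Ks N _)
    · intro n
      filter_upwards [ae_restrict_mem (Ks_meas N _)] with w hw
      rw [norm_mul]; exact mul_le_mul_of_nonneg_right (hvb n w hw) (norm_nonneg _)
    · filter_upwards [ae_restrict_mem (Ks_meas N _)] with w hw using (hu w hw).mul_const _
  · obtain ⟨C, hC⟩ := avg_fd_bd h hA j hr ξ
    have hgc : Continuous fun a : XN N × ℝ => eta N s a.1 * (starRingEnd ℂ) (a.1 j) := by fun_prop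
    refine tendsto_integral_of_dominated_convergence (fun a => ‖eta N s a.1 * (starRingEnd ℂ) (a.1 j)‖ * C) ?_ ?_ ?_ ?_
    · intro n
      refine ContinuousOn.aestronglyMeasurable_of_isCompact (hgc.continuousOn.mul ?_) hKc hKc.measurableSet
      refine ContinuousOn.clm_apply ?_ continuousOn_const
      exact (contDiffOn_fderiv (isOpen_Om N) (hdat n j)).2.comp (by fun_prop) hmem
    · exact (hgc.norm.mul continuous_const).continuousOn.integrableOn_compact hKc
    · intro n
      filter_upwards [ae_restrict_mem hKc.measurableSet] with a ha
      rw [norm_mul]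
      refine mul_le_mul_of_nonneg_left (hC n _ ?_) (norm_nonneg _)
      have h1 := n1_add z (a.2 • a.1)
      rw [n1_smulr, abs_of_nonneg ha.2.1] at h1
      have h2 : n1 a.1 ≤ s := ha.1
      nlinarith [ha.2.2, n1_nonneg a.1]
    · filter_upwards [ae_restrict_mem hKc.measurableSet] with a ha
      exact (avg_fd_lim h hA j (hmem a ha) ξ).const_mul _

theorem core {N : ℕ} (hN : 1 ≤ N) {M : ℝ} (hM : 0 ≤ M) {F : Fin N → XN N → ℂ} (h : Dat N M F) :
    ∃ u : XN N → ℂ, ContDiffOn ℝ 1 u (Om N) ∧ (∀ z ∈ Om N, ∀ ξ, dbar u z ξ = ∑ j, (starRingEnd ℂ) (ξ j) * F j z) ∧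
      ∀ z ∈ Om N, ‖u z‖ ≤ 2 * (1 + 2 * Real.sqrt N) * (1 / (1 - n1 z)) ^ N * M := by
  obtain ⟨κ, v, hA⟩ := apx_ex hN hM h
  choose! u hu using fun z (hz : z ∈ Om N) => v_conv hM h hA hz
  have hub : ∀ z ∈ Om N, ‖u z‖ ≤ 2 * (1 + 2 * Real.sqrt N) * (1 / (1 - n1 z)) ^ N * M := fun z hz =>
    le_of_tendsto (hu z hz).norm (Filter.Eventually.of_forall fun n => v_bd hM h hA n hz)
  have loc : ∀ z0 ∈ Om N, ∃ r s : ℝ, n1 z0 < r ∧ r < 1 ∧ (∀ z, n1 z < r → HasFDerivAt u (DD N s r u F z) z) ∧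
      ContinuousOn (DD N s r u F) {z | n1 z < r} ∧ ∀ z ∈ Bs N, n1 z < r → ∀ i, dbar u z (Pi.single i 1) = F i z := by
    intro z0 hz0
    have hz0' : n1 z0 < 1 := hz0
    set s := (1 - n1 z0) / 3 with hsd
    have hs : 0 < s := by linarith
    set r := n1 z0 + s with hrd
    have hr : r + s < 1 := by linarith
    have hKO : Ks N (r + s) ⊆ Om N := fun w hw => lt_of_le_of_lt (show n1 w ≤ r + s from hw) hr
    set B := 2 * (1 + 2 * Real.sqrt N) * (1 / (1 - (r + s))) ^ N * M with hB
    have hle : ∀ w ∈ Ks N (r + s), 2 * (1 + 2 * Real.sqrt N) * (1 / (1 - n1 w)) ^ N * M ≤ B := by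
      intro w hw
      have hw' : n1 w ≤ r + s := hw
      have h1 : 1 / (1 - n1 w) ≤ 1 / (1 - (r + s)) := one_div_le_one_div_of_le (by linarith) (by linarith)
      have h2 : 0 ≤ 1 / (1 - n1 w) := by apply one_div_nonneg.2; linarith
      rw [hB]; gcongr
    have hvb : ∀ n, ∀ w ∈ Ks N (r + s), ‖v n w‖ ≤ B := fun n w hw => (v_bd hM h hA n (hKO hw)).trans (hle w hw)
    have hub' : ∀ w ∈ Ks N (r + s), ‖u w‖ ≤ B := fun w hw => (hub w (hKO hw)).trans (hle w hw)
    have hvm : ∀ n, AEStronglyMeasurable (v n) (volume.restrict (Ks N (r + s))) := fun n =>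
      ((hA.pre n).cont.mono hKO).aestronglyMeasurable_of_isCompact (isCompact_Ks N _) (Ks_meas N _)
    have hul : ∀ w ∈ Ks N (r + s), Filter.Tendsto (fun n => v n w) Filter.atTop (nhds (u w)) := fun w hw => hu w (hKO hw)
    have hum : AEStronglyMeasurable u (volume.restrict (Ks N (r + s))) :=
      aestronglyMeasurable_of_tendsto_ae Filter.atTop hvm (by
        filter_upwards [ae_restrict_mem (Ks_meas N _)] with w hw using hul w hw)
    have hec := (eta_cd N s).continuous
    have hv1 : ∀ n z, n1 z < r → _ := fun n z hz => MFs (hA.pre n) (show n1 z + s < 1 by linarith) (eta N s) hec (eta_rot s)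
    have hshift : ∀ z, n1 z < r → ∀ w ∈ Ks N s, z + w ∈ Ks N (r + s) := by
      intro z hz w hw
      have h1 := n1_add z w
      have h2 : n1 w ≤ s := hw
      show n1 _ ≤ _
      linarith
    have hu1 : ∀ z, n1 z < r → (∫ w in Ks N s, eta N s w) * u z = (∫ w in Ks N s, eta N s w * u (z + w)) -
        2 * ∫ a in Ks N s ×ˢ Icc (0:ℝ) 1, eta N s a.1 * Phi F z a.1 a.2 := by
      intro z hz
      have hzs : n1 z + s < 1 := by linarith
      have hzO : z ∈ Om N := show n1 z < 1 by linarith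
      have hL := (hu z hzO).const_mul (∫ w in Ks N s, eta N s w)
      simp_rw [fun n => hv1 n z hz] at hL
      refine tendsto_nhds_unique hL (Filter.Tendsto.sub ?_ ((E_lim hM h hA hzs (eta N s) hec).const_mul 2))
      refine tendsto_integral_of_dominated_convergence (fun w => ‖eta N s w‖ * B) ?_ ?_ ?_ ?_
      · intro n
        exact (hec.continuousOn.mul (shift_cont (hA.pre n).cont hzs)).aestronglyMeasurable_of_isCompact (isCompact_Ks N _) (Ks_meas N _)
      · exact (hec.norm.mul continuous_const).continuousOn.integrableOn_compact (isCompact_Ks N _)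
      · intro n
        filter_upwards [ae_restrict_mem (Ks_meas N _)] with w hw
        rw [norm_mul]; exact mul_le_mul_of_nonneg_left (hvb n _ (hshift z hz w hw)) (norm_nonneg _)
      · filter_upwards [ae_restrict_mem (Ks_meas N _)] with w hw
        exact (hul _ (hshift z hz w hw)).const_mul _
    obtain ⟨d1, d2⟩ := rep hs hr u hum B hub' F h.c1 hu1
    refine ⟨r, s, by linarith, by linarith, d1, d2, fun z hzB hz i => ?_⟩
    have e : ∀ n, HasFDerivAt (v n) (DD N s r (v n) (avg (κ n) F) z) z := fun n =>
      (rep hs hr (v n) (hvm n) B (hvb n) _ (fun j => (avg_hasFDerivAt (κ n) h j).2) (hv1 n)).1 z hz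
    rw [dbar_of (d1 z hz)]
    have hl := fun ξ => DD_lim h hA hr hvb hvm hum hub' hul hz ξ
    have h3 := ((hl (Pi.single i 1)).add ((hl (Complex.I • Pi.single i 1)).const_mul Complex.I)).div_const 2
    refine tendsto_nhds_unique (h3.congr fun n => ?_) (avg_lim h hA i hzB.1)
    rw [← dbar_of (e n), (hA.pre n).dbar z hzB]
  have hcd : ContDiffOn ℝ 1 u (Om N) := by
    intro z0 hz0
    obtain ⟨r, s, h1, h2, d1, d2, -⟩ := loc z0 hz0
    have hU : IsOpen {z : XN N | n1 z < r} := isOpen_lt continuous_n1 continuous_const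
    exact ((contDiffOn_one_of hU d1 d2).contDiffAt (hU.mem_nhds h1)).contDiffWithinAt
  refine ⟨u, hcd, fun z hz ξ => ?_, hub⟩
  rw [dbar_basis]
  refine Finset.sum_congr rfl fun j _ => ?_
  congr 1
  have hae : (fun z => dbar u z (Pi.single j 1)) =ᵐ[volume.restrict (Om N)] F j := by
    filter_upwards [Bs_ae N] with z hz
    obtain ⟨r, s, h1, -, -, -, d3⟩ := loc z hz.1
    exact d3 z hz h1 j
  exact Measure.eqOn_open_of_ae_eq hae (isOpen_Om N) (cont_dbar (isOpen_Om N) hcd _) (h.c1 j).continuousOn hz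

theorem dbar_lin {V W : Type*} [NormedAddCommGroup V] [NormedSpace ℂ V] [NormedAddCommGroup W] [NormedSpace ℂ W]
    (L : V →L[ℂ] W) (c : ℂ) (u : W → ℂ) {z : V} (hu : DifferentiableAt ℝ u (L z)) (ξ : V) :
    dbar (fun z => c * u (L z)) z ξ = c * dbar u (L z) (L ξ) := by
  have h1 : HasFDerivAt (fun z => c * u (L z)) (c • (fderiv ℝ u (L z)).comp (L.restrictScalars ℝ)) z :=
    (hu.hasFDerivAt.comp z (L.restrictScalars ℝ).hasFDerivAt).const_mul c
  unfold dbar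
  rw [h1.fderiv]
  simp
  ring

/-- Let `N ≥ 1`, `0 < R < ∞`, and let `f` be a `∂̄`-closed `(0,1)`-form of
class `C¹` on `B_N(R) ⊆ ℂ^N` (`l¹` norm) with `|f|₀ < ∞`. Then there is a continuously
differentiable `u : B_N(R) → ℂ` with `∂̄u = f` and
`|u(z)| ≤ 2(R + 2R√N)·(R/(R−‖z‖))^N·|f|₀` for all `z ∈ B_N(R)`. -/
theorem statement2 (N : ℕ) (hN : 1 ≤ N) (R : ℝ) (hR : 0 < R) (f : EN N → EN N → ℂ)
    (hform : IsForm01 1 {z : EN N | ‖z‖ < R} f)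
    (hclosed : DbarClosed {z : EN N | ‖z‖ < R} f)
    (hfin : BddAbove (formSet0 f {z : EN N | ‖z‖ < R})) :
    ∃ u : EN N → ℂ,
      ContDiffOn ℝ 1 u {z : EN N | ‖z‖ < R} ∧
      (∀ z : EN N, ‖z‖ < R → ∀ ξ : EN N, dbar u z ξ = f z ξ) ∧
      ∀ z : EN N, ‖z‖ < R →
        ‖u z‖ ≤ 2 * (R + 2 * R * Real.sqrt N) * (R / (R - ‖z‖)) ^ N *
          formNorm0 f {z : EN N | ‖z‖ < R} := by
  obtain ⟨hadd, hsm, hcd⟩ := hform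
  set Ω := {z : EN N | ‖z‖ < R} with hΩ
  set M := formNorm0 f Ω with hMd
  have hRc : (R : ℂ) ≠ 0 := by exact_mod_cast hR.ne'
  have hΩo : IsOpen Ω := isOpen_lt continuous_norm continuous_const
  have h0 : (0 : EN N) ∈ Ω := by show ‖(0 : EN N)‖ < R; simpa using hR
  have hb : ∀ z ∈ Ω, ∀ ξ, ‖ξ‖ ≤ 1 → ‖f z ξ‖ ≤ M := fun z hz ξ hξ => le_csSup hfin ⟨z, hz, ξ, hξ, rfl⟩
  have hM : 0 ≤ M := (norm_nonneg _).trans (hb 0 h0 0 (by simp))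
  let Q : EN N ≃L[ℂ] XN N := PiLp.continuousLinearEquiv 1 ℂ (fun _ => ℂ)
  have hQ : ∀ z : EN N, n1 (Q z) = ‖z‖ := fun z => by
    rw [PiLp.norm_eq_of_L1]; rfl
  let e : Fin N → EN N := fun j => Q.symm (Pi.single j 1)
  have hQe : ∀ z : EN N, z = ∑ j, (Q z j) • e j := by
    intro z
    apply Q.injective
    rw [map_sum]
    ext i
    simp [e, Finset.sum_apply, Pi.single_apply]
  have hen : ∀ j, ‖e j‖ ≤ 1 := by
    intro j
    rw [← hQ]
    simp only [e, ContinuousLinearEquiv.apply_symm_apply, n1]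
    rw [Finset.sum_eq_single j]
    · simp
    · intro i _ hij; simp [hij]
    · simp
  have hf0 : ∀ z ∈ Ω, f z 0 = 0 := fun z hz => by simpa using hsm z hz 0 0
  have hfe : ∀ z ∈ Ω, ∀ ξ, f z ξ = ∑ j, (starRingEnd ℂ) (Q ξ j) * f z (e j) := by
    intro z hz ξ
    have hs : ∀ (s : Finset (Fin N)) (g : Fin N → EN N), f z (∑ j ∈ s, g j) = ∑ j ∈ s, f z (g j) := by
      intro s g
      classical
      induction s using Finset.induction_on with
      | empty => simpa using hf0 z hz
      | insert a s ha ih => rw [Finset.sum_insert ha, Finset.sum_insert ha, hadd z hz, ih]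
    conv_lhs => rw [hQe ξ]
    rw [hs]
    exact Finset.sum_congr rfl fun j _ => hsm z hz _ _
  let S : XN N →L[ℂ] EN N := (R : ℂ) • (Q.symm : XN N →L[ℂ] EN N)
  let T : EN N →L[ℂ] XN N := (R : ℂ)⁻¹ • (Q : EN N →L[ℂ] XN N)
  have hST : ∀ z, S (T z) = z := fun z => by
    show (R : ℂ) • Q.symm ((R : ℂ)⁻¹ • Q z) = z
    rw [map_smul, ContinuousLinearEquiv.symm_apply_apply, smul_inv_smul₀ hRc]
  have hSn : ∀ z, ‖S z‖ = R * n1 z := fun z => by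
    have : ‖Q.symm z‖ = n1 z := by rw [← hQ]; simp
    show ‖(R : ℂ) • Q.symm z‖ = _
    rw [norm_smul, this]; simp [abs_of_pos hR]
  have hTn : ∀ z, n1 (T z) = ‖z‖ / R := fun z => by
    have := hSn (T z); rw [hST] at this; rw [this]; field_simp
  have hSm : ∀ z ∈ Om N, S z ∈ Ω := fun z hz => by
    have hz' : n1 z < 1 := hz
    show ‖S z‖ < R
    rw [hSn]; nlinarith
  have hTm : ∀ z ∈ Ω, T z ∈ Om N := fun z hz => by
    show n1 (T z) < 1
    rw [hTn, div_lt_one hR]; exact hz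
  have hfc : ∀ ξ, ContDiffOn ℝ 1 (fun w => f w ξ) Ω := fun ξ =>
    hcd.comp (f := fun w => (w, ξ)) (by fun_prop) fun w hw => ⟨hw, mem_univ _⟩
  have hfd : ∀ ξ, ∀ w ∈ Ω, DifferentiableAt ℝ (fun w => f w ξ) w := fun ξ w hw =>
    ((hfc ξ).differentiableOn (by simp)).differentiableAt (hΩo.mem_nhds hw)
  have hdat : Dat N M (fun j z => f (S z) (e j)) := by
    refine ⟨fun j => ?_, fun j z hz => hb _ (hSm z hz) _ (hen j), fun z hz i j => ?_⟩
    · exact (hfc (e j)).comp (S.restrictScalars ℝ).contDiff.contDiffOn hSm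
    · have h1 : ∀ i j, dbar (fun z => f (S z) (e j)) z (Pi.single i 1) = dbar (fun w => f w (e j)) (S z) (S (Pi.single i 1)) := by
        intro i j
        simpa using dbar_lin S 1 (fun w => f w (e j)) (hfd (e j) _ (hSm z hz)) (Pi.single i 1)
      have h2 : ∀ i : Fin N, S (Pi.single i 1) = (R:ℂ) • e i := fun i => rfl
      rw [h1, h1, h2, h2, dbar_smul, dbar_smul, hclosed _ (hSm z hz)]
  obtain ⟨u, hu1, hu2, hu3⟩ := core hN hM hdat
  refine ⟨fun z => (R:ℂ) * u (T z), ?_, ?_, ?_⟩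
  · exact contDiffOn_const.mul (hu1.comp (T.restrictScalars ℝ).contDiff.contDiffOn hTm)
  · intro z hz ξ
    have hd := (hu1.differentiableOn (by simp)).differentiableAt ((isOpen_Om N).mem_nhds (hTm z hz))
    rw [dbar_lin T _ _ hd, hu2 _ (hTm z hz), hST, hfe z hz ξ, Finset.mul_sum]
    refine Finset.sum_congr rfl fun j _ => ?_
    have : T ξ j = (R:ℂ)⁻¹ * Q ξ j := rfl
    rw [this, map_mul, map_inv₀, Complex.conj_ofReal]
    field_simp
  · intro z hz
    have h1 := hu3 _ (hTm z hz)
    rw [norm_mul, Complex.norm_real, Real.norm_of_nonneg hR.le]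
    have h2 : 1 / (1 - n1 (T z)) = R / (R - ‖z‖) := by
      have : R - ‖z‖ ≠ 0 := by linarith
      rw [hTn, one_sub_div hR.ne', one_div_div]
    rw [h2] at h1
    calc R * ‖u (T z)‖ ≤ R * _ := mul_le_mul_of_nonneg_left h1 hR.le
      _ = _ := by ring
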